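/- arXiv:2101.09803 — 3 statements merged into one kernel-verified Lean document; each statement's English description precedes it below -/
import Mathlib

section
/- Let φ: R → R' be a surjective algebra retract of standard graded k-algebras (i.e., there exists a graded k-algebra map σ: R' → R with φ∘σ = id). Then R is Koszul if and only if R' is Koszul and R', viewed as an R-module via φ, has a linear free resolution over R. -/
open MvPolynomial

noncomputable section

variable {k : Type} [Field k]

/-- The degree-`d` graded piece of the standard graded algebra `S/I`. -/
def qdeg {n : ℕ} (I : Ideal (MvPolynomial (Fin n) k)) (d : ℕ) :
    Submodule k (MvPolynomial (Fin n) k ⧸ I) :=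
  (homogeneousSubmodule (Fin n) k d).map (Ideal.Quotient.mkₐ k I).toLinearMap

/-- An ideal of `A`, viewed as a submodule of `Fin 1 → A`. -/
def idealToPi {A : Type} [CommRing A] (J : Ideal A) : Submodule A (Fin 1 → A) :=
  Submodule.map (LinearMap.pi fun _ : Fin 1 => (LinearMap.id : A →ₗ[A] A)) J

/-- `LinSolvable lin t N` : the submodule `N` of a finite free module admits a linear free
resolution of length `t`: it is the image of a matrix all of whose entries lie in `lin`
(the set of linear forms), whose kernel is again the image of such a matrix, and so on,
`t + 1` steps in total. -/
def LinSolvable {A : Type} [CommRing A] (lin : Set A) :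
    ℕ → ∀ {m : ℕ}, Submodule A (Fin m → A) → Prop
  | 0, m, N => ∃ (r : ℕ) (C : Matrix (Fin m) (Fin r) A),
      (∀ i j, C i j ∈ lin) ∧ LinearMap.range C.mulVecLin = N
  | (t + 1), m, N => ∃ (r : ℕ) (C : Matrix (Fin m) (Fin r) A),
      (∀ i j, C i j ∈ lin) ∧ LinearMap.range C.mulVecLin = N ∧
      LinSolvable lin t (LinearMap.ker C.mulVecLin)

/-- A standard graded algebra `R = S/I` is Koszul if the residue field `k = R/R₊` has a linear
free resolution over `R`, i.e. the irrelevant ideal `R₊` admits linear resolutions of every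
finite length. -/
def IsKoszul {n : ℕ} (I : Ideal (MvPolynomial (Fin n) k)) : Prop :=
  ∀ t : ℕ, LinSolvable (↑(qdeg I 1)) t
    (idealToPi (Ideal.map (Ideal.Quotient.mk I)
      (Ideal.span (Set.range (X : Fin n → MvPolynomial (Fin n) k)))))


structure SG (k A : Type) [Field k] [CommRing A] [Algebra k A] where
  lin : Submodule k A
  fin : Module.Finite k lin
  ε : A →ₐ[k] k
  π : ℕ → A →+ A
  π_zero : ∀ a, π 0 a = algebraMap k A (ε a)
  π_mul : ∀ d l a, l ∈ lin → π (d + 1) (l * a) = l * π d a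
  ε_lin : ∀ l ∈ lin, ε l = 0
  π_one : ∀ a, π 1 a ∈ lin
  ker_le : ∀ a, ε a = 0 → a ∈ Ideal.span (lin : Set A)
  sum_π : ∀ a, ∃ n, ∀ m, n ≤ m → a = ∑ d ∈ Finset.range m, π d a

namespace SG

variable {A : Type} [CommRing A] [Algebra k A] (G : SG k A)

lemma π_one_lin {l : A} (hl : l ∈ G.lin) : G.π 1 l = l := by
  have := G.π_mul 0 l 1 hl
  simpa [G.π_zero] using this

lemma lin_mul {l : A} (hl : l ∈ G.lin) (c : k) : l * algebraMap k A c ∈ G.lin := by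
  rw [mul_comm, ← Algebra.smul_def]; exact G.lin.smul_mem c hl

lemma mul_lin {l : A} (hl : l ∈ G.lin) (c : k) : algebraMap k A c * l ∈ G.lin := by
  rw [← Algebra.smul_def]; exact G.lin.smul_mem c hl

lemma π_mulVec {m r : ℕ} (C : Matrix (Fin m) (Fin r) A) (hC : ∀ i j, C i j ∈ G.lin) (d : ℕ)
    (v : Fin r → A) (i : Fin m) :
    G.π (d + 1) (C.mulVec v i) = C.mulVec (fun j => G.π d (v j)) i := by
  simp only [Matrix.mulVec, dotProduct, map_sum]
  exact Finset.sum_congr rfl fun j _ => G.π_mul d _ _ (hC i j)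

lemma ε_mulVec {m r : ℕ} (C : Matrix (Fin m) (Fin r) A) (hC : ∀ i j, C i j ∈ G.lin)
    (v : Fin r → A) (i : Fin m) : G.ε (C.mulVec v i) = 0 := by
  simp only [Matrix.mulVec, dotProduct, map_sum, map_mul]
  exact Finset.sum_eq_zero fun j _ => by rw [G.ε_lin _ (hC i j), zero_mul]

/-- constant matrices relating two linear matrices -/
lemma exists_const {m r r' : ℕ} (C : Matrix (Fin m) (Fin r) A) (hC : ∀ i j, C i j ∈ G.lin)
    (C' : Matrix (Fin m) (Fin r') A) (hC' : ∀ i j, C' i j ∈ G.lin)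
    (h : LinearMap.range C'.mulVecLin ≤ LinearMap.range C.mulVecLin) :
    ∃ g : Matrix (Fin r) (Fin r') k, C' = C * g.map (algebraMap k A) := by
  have : ∀ j, ∃ v, C.mulVec v = fun i => C' i j := by
    intro j
    have : C'.mulVecLin (Pi.single j 1) ∈ LinearMap.range C.mulVecLin := h ⟨_, rfl⟩
    obtain ⟨v, hv⟩ := this
    refine ⟨v, ?_⟩
    simp only [Matrix.mulVecLin_apply, Matrix.mulVec_single_one] at hv
    rw [hv]; rfl
  choose v hv using this
  refine ⟨Matrix.of fun i j => G.ε (v j i), ?_⟩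
  ext i j
  have h1 := G.π_mulVec C hC 0 (v j) i
  rw [hv j, zero_add, G.π_one_lin (hC' i j)] at h1
  rw [h1]
  simp [Matrix.mulVec, dotProduct, Matrix.mul_apply, G.π_zero]

lemma linSolvable_range {t m : ℕ} {N : Submodule A (Fin m → A)}
    (h : LinSolvable (G.lin : Set A) t N) : ∃ (r : ℕ) (C : Matrix (Fin m) (Fin r) A),
      (∀ i j, C i j ∈ G.lin) ∧ LinearMap.range C.mulVecLin = N := by
  cases t with
  | zero => exact h
  | succ t => obtain ⟨r, C, h1, h2, -⟩ := h; exact ⟨r, C, h1, h2⟩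

lemma linSolvable_ε {t m : ℕ} {N : Submodule A (Fin m → A)}
    (h : LinSolvable (G.lin : Set A) t N) {v : Fin m → A} (hv : v ∈ N) (i : Fin m) :
    G.ε (v i) = 0 := by
  obtain ⟨r, C, h1, rfl⟩ := G.linSolvable_range h
  obtain ⟨w, rfl⟩ := hv
  exact G.ε_mulVec C h1 w i

lemma const_mul_lin {p q s : ℕ} (g : Matrix (Fin p) (Fin q) k) (C : Matrix (Fin q) (Fin s) A)
    (hC : ∀ i j, C i j ∈ G.lin) (i j) : (g.map (algebraMap k A) * C) i j ∈ G.lin := by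
  rw [Matrix.mul_apply]
  exact Submodule.sum_mem _ fun l _ => G.mul_lin (hC l j) _

lemma linSolvable_map {t m m' : ℕ} {N : Submodule A (Fin m → A)}
    (h : LinSolvable (G.lin : Set A) t N) (g : Matrix (Fin m') (Fin m) k)
    (g' : Matrix (Fin m) (Fin m') k) (hg : g' * g = 1) :
    LinSolvable (G.lin : Set A) t (N.map (g.map (algebraMap k A)).mulVecLin) := by
  have hinj : (g'.map (algebraMap k A)) * (g.map (algebraMap k A)) = 1 := by
    rw [← Matrix.map_mul, hg]; simp
  cases t with
  | zero =>
    obtain ⟨r, C, h1, rfl⟩ := h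
    refine ⟨r, _, G.const_mul_lin g C h1, ?_⟩
    rw [Matrix.mulVecLin_mul, LinearMap.range_comp]
  | succ t =>
    obtain ⟨r, C, h1, rfl, h3⟩ := h
    refine ⟨r, _, G.const_mul_lin g C h1, ?_, ?_⟩
    · rw [Matrix.mulVecLin_mul, LinearMap.range_comp]
    · convert h3 using 1
      ext v
      simp only [LinearMap.mem_ker, Matrix.mulVecLin_apply]
      constructor
      · intro h
        have := congrArg (g'.map (algebraMap k A)).mulVec h
        rwa [Matrix.mulVec_mulVec, ← Matrix.mul_assoc, hinj, Matrix.one_mul,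
          Matrix.mulVec_zero] at this
      · intro h
        rw [← Matrix.mulVec_mulVec, h, Matrix.mulVec_zero]

lemma const_inv {m r r' : ℕ} (C : Matrix (Fin m) (Fin r) A) 
    (hmin : ∀ v, C.mulVec v = 0 → ∀ i, G.ε (v i) = 0)
    (C' : Matrix (Fin m) (Fin r') A)
    (g : Matrix (Fin r) (Fin r') k) (hg : C' = C * g.map (algebraMap k A))
    (h : Matrix (Fin r') (Fin r) k) (hh : C = C' * h.map (algebraMap k A)) : g * h = 1 := by
  have h0 : C * ((g * h - 1).map (algebraMap k A)) = 0 := by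
    rw [Matrix.map_sub _ (by simp), Matrix.map_mul, Matrix.mul_sub, ← Matrix.mul_assoc, ← hg, ← hh]
    simp
  rw [← sub_eq_zero]
  ext i j
  have := hmin (fun i => algebraMap k A ((g * h - 1 : Matrix (Fin r) (Fin r) k) i j)) (by
    ext l
    have := congrFun (congrFun h0 l) j
    simpa [Matrix.mul_apply, Matrix.mulVec, dotProduct] using this) i
  simpa using this

theorem solvable_ker {t m r : ℕ} (C : Matrix (Fin m) (Fin r) A) (hC : ∀ i j, C i j ∈ G.lin)
    (hmin : ∀ v, C.mulVec v = 0 → ∀ i, G.ε (v i) = 0)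
    (h : LinSolvable (G.lin : Set A) (t + 1) (LinearMap.range C.mulVecLin)) :
    LinSolvable (G.lin : Set A) t (LinearMap.ker C.mulVecLin) := by
  obtain ⟨r', C', h1, h2, h3⟩ := h
  obtain ⟨g, hg⟩ := G.exists_const C hC C' h1 h2.le
  obtain ⟨g', hg'⟩ := G.exists_const C' h1 C hC h2.ge
  have e1 := G.const_inv C hmin C' g hg g' hg'
  have e2 := G.const_inv C' (fun v hv => G.linSolvable_ε h3 (by simpa using hv)) C g' hg' g hg
  convert G.linSolvable_map h3 g g' e2 using 1
  ext v
  simp only [LinearMap.mem_ker, Matrix.mulVecLin_apply, Submodule.mem_map]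
  constructor
  · intro hv
    refine ⟨(g'.map (algebraMap k A)).mulVec v, ?_, ?_⟩
    · rw [Matrix.mulVec_mulVec, ← hg', hv]
    · rw [Matrix.mulVec_mulVec, ← Matrix.map_mul, e1]; simp
  · rintro ⟨w, hw, rfl⟩
    rw [Matrix.mulVec_mulVec, ← hg, hw]

/-- The submodule generated by the linear vectors of `N`. -/
def linPart {m : ℕ} (N : Submodule A (Fin m → A)) : Submodule A (Fin m → A) :=
  Submodule.span A {v | v ∈ N ∧ ∀ i, v i ∈ G.lin}

lemma linPart_le {m : ℕ} (N : Submodule A (Fin m → A)) : G.linPart N ≤ N :=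
  Submodule.span_le.2 fun _ h => h.1

lemma exists_canon {m : ℕ} (N : Submodule A (Fin m → A)) :
    ∃ (p : Σ r : ℕ, Matrix (Fin m) (Fin r) A), (∀ i j, p.2 i j ∈ G.lin) ∧
      LinearMap.range p.2.mulVecLin = G.linPart N ∧
      ∀ v, p.2.mulVec v = 0 → ∀ i, G.ε (v i) = 0 := by
  let W : Submodule k (Fin m → A) := N.restrictScalars k ⊓ Submodule.pi Set.univ (fun _ => G.lin)
  have hW : ∀ v, v ∈ W ↔ v ∈ N ∧ ∀ i, v i ∈ G.lin := by
    intro v; simp [W, Submodule.mem_pi]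
  have : Module.Finite k W := by
    have := G.fin
    let f : W →ₗ[k] (Fin m → G.lin) := 
      { toFun := fun w i => ⟨w.1 i, ((hW _).1 w.2).2 i⟩
        map_add' := fun _ _ => rfl
        map_smul' := fun _ _ => rfl }
    refine Module.Finite.of_injective f ?_
    intro a b hab
    ext i
    exact congrArg Subtype.val (congrFun hab i)
  let b := Module.finBasis k W
  refine ⟨⟨_, Matrix.of fun i j => (b j).1 i⟩, fun i j => ((hW _).1 (b j).2).2 i, ?_, ?_⟩
  · rw [Matrix.range_mulVecLin]
    apply le_antisymm
    · rw [Submodule.span_le]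
      rintro _ ⟨j, rfl⟩
      exact Submodule.subset_span ((hW _).1 (b j).2)
    · refine Submodule.span_le.2 ?_
      intro v hv
      have h1 := b.sum_repr ⟨v, (hW v).2 hv⟩
      have h2 := congrArg Subtype.val h1
      simp only [AddSubmonoidClass.coe_finsetSum, Submodule.coe_smul] at h2
      rw [← h2]
      refine Submodule.sum_mem _ fun j _ => ?_
      rw [← algebraMap_smul A]
      exact Submodule.smul_mem _ _ (Submodule.subset_span ⟨j, rfl⟩)
  · intro v hv
    have h1 : ∑ j, G.ε (v j) • b j = 0 := by
      ext i
      have := congrArg (G.π (0 + 1)) (congrFun hv i)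
      have h' := G.π_mulVec (Matrix.of fun i j => (b j).1 i)
        (fun i j => ((hW _).1 (b j).2).2 i) 0 v i
      have this := h'.symm.trans this
      simp [Matrix.mulVec, dotProduct, G.π_zero] at this
      simp [AddSubmonoidClass.coe_finsetSum, Algebra.smul_def]
      rw [← this]
      exact Finset.sum_congr rfl fun j _ => mul_comm _ _
    exact fun i => Fintype.linearIndependent_iff.1 b.linearIndependent _ h1 i

/-- chosen minimal matrix generating the linear part of `N` -/
def canon {m : ℕ} (N : Submodule A (Fin m → A)) : Σ r : ℕ, Matrix (Fin m) (Fin r) A :=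
  (G.exists_canon N).choose

lemma canon_spec {m : ℕ} (N : Submodule A (Fin m → A)) : (∀ i j, (G.canon N).2 i j ∈ G.lin) ∧
      LinearMap.range (G.canon N).2.mulVecLin = G.linPart N ∧
      ∀ v, (G.canon N).2.mulVec v = 0 → ∀ i, G.ε (v i) = 0 :=
  (G.exists_canon N).choose_spec

def aux (N : Submodule A (Fin 1 → A)) : ℕ → Σ m r : ℕ, Matrix (Fin m) (Fin r) A
  | 0 => ⟨1, G.canon N⟩
  | i + 1 => ⟨(aux N i).2.1, G.canon (LinearMap.ker (aux N i).2.2.mulVecLin)⟩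

def bx (N : Submodule A (Fin 1 → A)) : ℕ → ℕ
  | 0 => 1
  | i + 1 => (G.aux N i).2.1

def bX (N : Submodule A (Fin 1 → A)) : ∀ i, Matrix (Fin (G.bx N i)) (Fin (G.bx N (i + 1))) A
  | 0 => (G.canon N).2
  | i + 1 => (G.aux N (i + 1)).2.2

lemma bX_zero (N : Submodule A (Fin 1 → A)) : 
    LinearMap.range (G.bX N 0).mulVecLin = G.linPart N := (G.canon_spec N).2.1

lemma bX_succ (N : Submodule A (Fin 1 → A)) (i : ℕ) : 
    LinearMap.range (G.bX N (i + 1)).mulVecLin =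
      G.linPart (LinearMap.ker (G.bX N i).mulVecLin) := by
  cases i with
  | zero => exact (G.canon_spec _).2.1
  | succ i => exact (G.canon_spec _).2.1

lemma bX_lin (N : Submodule A (Fin 1 → A)) (i : ℕ) : ∀ p q, G.bX N i p q ∈ G.lin := by
  cases i with
  | zero => exact (G.canon_spec _).1
  | succ i => exact (G.canon_spec _).1

lemma bX_min (N : Submodule A (Fin 1 → A)) (i : ℕ) :
    ∀ v, (G.bX N i).mulVec v = 0 → ∀ i, G.ε (v i) = 0 := by
  cases i with
  | zero => exact (G.canon_spec _).2.2
  | succ i => exact (G.canon_spec _).2.2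

lemma le_linPart {m r : ℕ} (C : Matrix (Fin m) (Fin r) A) (hC : ∀ i j, C i j ∈ G.lin) :
    LinearMap.range C.mulVecLin ≤ G.linPart (LinearMap.range C.mulVecLin) := by
  conv_lhs => rw [Matrix.range_mulVecLin]
  rw [Submodule.span_le]
  rintro _ ⟨j, rfl⟩
  refine Submodule.subset_span ⟨⟨Pi.single j 1, ?_⟩, fun i => hC i j⟩
  simp

lemma linSolvable_linPart {t m : ℕ} {N : Submodule A (Fin m → A)}
    (h : LinSolvable (G.lin : Set A) t N) : G.linPart N = N := by
  obtain ⟨r, C, h1, rfl⟩ := G.linSolvable_range h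
  exact le_antisymm (G.linPart_le _) (G.le_linPart C h1)

/-- exactness of the canonical complex for a module with linear resolution -/
lemma bX_solv (N : Submodule A (Fin 1 → A)) (h : ∀ t, LinSolvable (G.lin : Set A) t N) (i : ℕ) :
    ∀ t, LinSolvable (G.lin : Set A) t (LinearMap.range (G.bX N i).mulVecLin) := by
  induction i with
  | zero =>
    rw [bX_zero, G.linSolvable_linPart (h 0)]; exact h
  | succ i ih =>
    have := fun t => G.solvable_ker (G.bX N i) (G.bX_lin N i) (G.bX_min N i) (ih (t + 1))
    rw [bX_succ, G.linSolvable_linPart (this 0)]; exact this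

lemma bX_ker (N : Submodule A (Fin 1 → A)) (h : ∀ t, LinSolvable (G.lin : Set A) t N) (i : ℕ) :
    LinearMap.range (G.bX N (i + 1)).mulVecLin = LinearMap.ker (G.bX N i).mulVecLin := by
  rw [bX_succ]
  exact G.linSolvable_linPart (G.solvable_ker (t := 0) (G.bX N i) (G.bX_lin N i) (G.bX_min N i)
    (G.bX_solv N h i 1))

lemma bX_mul (N : Submodule A (Fin 1 → A)) (i : ℕ) : G.bX N i * G.bX N (i + 1) = 0 := by
  have h : LinearMap.range (G.bX N (i + 1)).mulVecLin ≤ LinearMap.ker (G.bX N i).mulVecLin := by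
    rw [bX_succ]; exact G.linPart_le _
  ext p q
  have := h ⟨Pi.single q 1, rfl⟩
  simp only [LinearMap.mem_ker, Matrix.mulVecLin_apply, Matrix.mulVec_single_one] at this
  exact congrFun this p

lemma π_pow {n : ℕ} : ∀ {d : ℕ} {a : A}, d < n → a ∈ Ideal.span (G.lin : Set A) ^ n →
    G.π d a = 0 := by
  induction n with
  | zero => intro d a h; omega
  | succ n ih =>
    intro d a hd ha
    rw [pow_succ'] at ha
    have key : ∀ l ∈ Ideal.span (G.lin : Set A), ∀ b ∈ Ideal.span (G.lin : Set A) ^ n,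
        G.π d (l * b) = 0 := by
      intro l hl
      induction hl using Submodule.span_induction with
      | mem l hl =>
        intro b hb
        cases d with
        | zero => rw [G.π_zero, map_mul, G.ε_lin _ hl]; simp
        | succ d => rw [G.π_mul d l b hl, ih (by omega) hb, mul_zero]
      | zero => intro b _; simp
      | add l l' _ _ h h' => intro b hb; rw [add_mul, map_add, h b hb, h' b hb, add_zero]
      | smul r l _ h =>
        intro b hb
        have := h (r * b) (Ideal.mul_mem_left _ _ hb)
        rw [smul_eq_mul, mul_comm r l, mul_assoc, this]
    induction ha using Submodule.mul_induction_on' with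
    | mem_mul_mem l hl b hb => exact key l hl b hb
    | add a _ b _ h h' => rw [map_add, h, h', add_zero]

lemma nakayama {m : ℕ} (N : Submodule A (Fin m → A))
    (h : N ≤ G.linPart N ⊔ Ideal.span (G.lin : Set A) • N) : G.linPart N = N := by
  refine le_antisymm (G.linPart_le N) ?_
  set 𝔪 := Ideal.span (G.lin : Set A)
  have hn : ∀ n : ℕ, N ≤ G.linPart N ⊔ 𝔪 ^ n • N := by
    intro n
    induction n with
    | zero => simp
    | succ n ih =>
      refine ih.trans (sup_le le_sup_left ?_)
      refine (Submodule.smul_mono (le_refl (𝔪 ^ n)) h).trans ?_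
      rw [Submodule.smul_sup]
      refine sup_le (Submodule.smul_le_right.trans le_sup_left) ?_
      rw [← Submodule.mul_smul, ← pow_succ]
      exact le_sup_right
  intro v hv
  have hπ : ∀ d, (fun i => G.π d (v i)) ∈ G.linPart N := by
    intro d
    obtain ⟨l, hl, r, hr, rfl⟩ := Submodule.mem_sup.1 (hn (d + 1) hv)
    have hr0 : ∀ i, G.π d (r i) = 0 := by
      intro i
      refine G.π_pow (Nat.lt_succ_self d) ?_
      have : (𝔪 ^ (d + 1) • N).map (LinearMap.proj i) ≤ 𝔪 ^ (d + 1) := by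
        rw [Submodule.map_smul'']
        exact Ideal.mul_le_left
      exact this ⟨r, hr, rfl⟩
    simp only [Pi.add_apply, map_add, hr0, add_zero]
    obtain ⟨h1, h2, -⟩ := G.canon_spec N
    rw [← h2] at hl ⊢
    obtain ⟨w, rfl⟩ := hl
    cases d with
    | zero =>
      convert Submodule.zero_mem _ using 1
      ext i
      simp [G.π_zero, G.ε_mulVec _ h1]
    | succ d =>
      refine ⟨fun j => G.π d (w j), ?_⟩
      ext i
      simp [G.π_mulVec _ h1]
  choose n hn using fun i => G.sum_π (v i)
  have : v = ∑ d ∈ Finset.range (∑ i, n i), fun i => G.π d (v i) := by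
    ext i
    rw [Finset.sum_apply]
    exact hn i _ (Finset.single_le_sum (f := n) (fun _ _ => Nat.zero_le _) (Finset.mem_univ i))
  rw [this]
  exact Submodule.sum_mem _ fun d _ => hπ d

/-- exactness of the canonical complex at a spot -/
def Ex (N : Submodule A (Fin 1 → A)) : ℕ → Prop
  | 0 => G.linPart N = N
  | a + 1 => G.linPart (LinearMap.ker (G.bX N a).mulVecLin) = LinearMap.ker (G.bX N a).mulVecLin

lemma ex_of_solvable (N : Submodule A (Fin 1 → A)) (h : ∀ t, LinSolvable (G.lin : Set A) t N) :
    ∀ i, G.Ex N i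
  | 0 => G.linSolvable_linPart (h 0)
  | i + 1 => by rw [Ex, ← bX_succ]; exact G.bX_ker N h i

lemma lin_of_ex (N : Submodule A (Fin 1 → A)) (h : ∀ i, G.Ex N i) :
    ∀ t, LinSolvable (G.lin : Set A) t N := by
  have : ∀ t i, LinSolvable (G.lin : Set A) t (LinearMap.range (G.bX N i).mulVecLin) := by
    intro t
    induction t with
    | zero => exact fun i => ⟨_, _, G.bX_lin N i, rfl⟩
    | succ t ih =>
      intro i
      refine ⟨_, _, G.bX_lin N i, rfl, ?_⟩
      have := ih (i + 1)
      rwa [bX_succ, h (i + 1)] at this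
  intro t
  have h0 := this t 0
  rwa [bX_zero, h 0] at h0

lemma ε_mul {m r s : ℕ} (C : Matrix (Fin m) (Fin r) A) (hC : ∀ i j, C i j ∈ G.lin)
    (M : Matrix (Fin r) (Fin s) A) (i j) : G.ε ((C * M) i j) = 0 := by
  simp only [Matrix.mul_apply, map_sum, map_mul]
  exact Finset.sum_eq_zero fun l _ => by rw [G.ε_lin _ (hC i l), zero_mul]

lemma ε_mul' {m r s : ℕ} (C : Matrix (Fin r) (Fin s) A) (hC : ∀ i j, C i j ∈ G.lin)
    (M : Matrix (Fin m) (Fin r) A) (i j) : G.ε ((M * C) i j) = 0 := by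
  simp only [Matrix.mul_apply, map_sum, map_mul]
  exact Finset.sum_eq_zero fun l _ => by rw [G.ε_lin _ (hC l j), mul_zero]

lemma π_matmul {m r s : ℕ} (C : Matrix (Fin m) (Fin r) A) (hC : ∀ i j, C i j ∈ G.lin)
    (M : Matrix (Fin r) (Fin s) A) (d : ℕ) : (C * M).map (G.π (d + 1)) = C * M.map (G.π d) := by
  ext i j
  simp only [Matrix.mul_apply, Matrix.map_apply, map_sum]
  exact Finset.sum_congr rfl fun l _ => G.π_mul d _ _ (hC i l)

lemma π_matmul' {m r s : ℕ} (C : Matrix (Fin r) (Fin s) A) (hC : ∀ i j, C i j ∈ G.lin)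
    (M : Matrix (Fin m) (Fin r) A) (d : ℕ) : (M * C).map (G.π (d + 1)) = M.map (G.π d) * C := by
  ext i j
  simp only [Matrix.mul_apply, Matrix.map_apply, map_sum]
  exact Finset.sum_congr rfl fun l _ => by
    rw [mul_comm, G.π_mul d _ _ (hC l j), mul_comm]

end SG

lemma exists_mat_of_range {A : Type} [CommRing A] {m r s : ℕ} (C : Matrix (Fin m) (Fin r) A)
    (M : Matrix (Fin m) (Fin s) A)
    (h : ∀ j, (fun i => M i j) ∈ LinearMap.range C.mulVecLin) :
    ∃ U : Matrix (Fin r) (Fin s) A, C * U = M := by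
  choose u hu using h
  refine ⟨Matrix.of fun i j => u j i, ?_⟩
  ext i j
  have := congrFun (hu j) i
  simpa [Matrix.mul_apply, Matrix.mulVec, dotProduct] using this

lemma mem_idealToPi {A : Type} [CommRing A] {J : Ideal A} {v : Fin 1 → A} :
    v ∈ idealToPi J ↔ v 0 ∈ J := by
  constructor
  · rintro ⟨a, ha, rfl⟩; exact ha
  · intro h
    refine ⟨v 0, h, ?_⟩
    ext i
    rw [Subsingleton.elim i 0]; rfl

section Total

variable {A : Type} [CommRing A] {x y : ℕ → ℕ}

/-- families of matrices indexed by bidegrees -/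
abbrev TT (A : Type) (x y : ℕ → ℕ) : Type := ∀ a b : ℕ, Matrix (Fin (x a)) (Fin (y b)) A

/-- the total differential -/
def dd (X : ∀ a, Matrix (Fin (x a)) (Fin (x (a + 1))) A)
    (S : ∀ b, Matrix (Fin (y (b + 1))) (Fin (y b)) A) : TT A x y →ₗ[A] TT A x y where
  toFun z a b := X a * z (a + 1) b + (-1 : A) ^ a • (z a (b + 1) * S b)
  map_add' z w := by
    funext a b
    simp only [Pi.add_apply, Matrix.mul_add, Matrix.add_mul, smul_add]
    abel
  map_smul' r z := by
    funext a b
    simp only [Pi.smul_apply, Matrix.mul_smul, Matrix.smul_mul, smul_add, RingHom.id_apply]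
    rw [smul_comm]

lemma dd_apply (X : ∀ a, Matrix (Fin (x a)) (Fin (x (a + 1))) A)
    (S : ∀ b, Matrix (Fin (y (b + 1))) (Fin (y b)) A) (z : TT A x y) (a b : ℕ) :
    dd X S z a b = X a * z (a + 1) b + (-1 : A) ^ a • (z a (b + 1) * S b) := rfl

lemma dd_dd (X : ∀ a, Matrix (Fin (x a)) (Fin (x (a + 1))) A)
    (S : ∀ b, Matrix (Fin (y (b + 1))) (Fin (y b)) A) (hX : ∀ a, X a * X (a + 1) = 0)
    (hS : ∀ b, S (b + 1) * S b = 0) (z : TT A x y) : dd X S (dd X S z) = 0 := by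
  funext a b
  simp only [dd_apply, Matrix.mul_add, Matrix.add_mul, smul_add, Matrix.mul_smul, Matrix.smul_mul]
  rw [← Matrix.mul_assoc, hX, Matrix.mul_assoc (z a (b + 1 + 1)), hS, Matrix.mul_assoc, pow_succ]
  simp

/-- homogeneous elements of total degree `n` -/
def Tn (A : Type) [CommRing A] (x y : ℕ → ℕ) (n : ℕ) : Submodule A (TT A x y) where
  carrier := {z | ∀ a b, a + b ≠ n → z a b = 0}
  add_mem' {z w} hz hw a b h := by simp [hz a b h, hw a b h]
  zero_mem' a b h := rfl
  smul_mem' r z hz a b h := by simp [hz a b h]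

lemma mem_Tn {n : ℕ} {z : TT A x y} : z ∈ Tn A x y n ↔ ∀ a b, a + b ≠ n → z a b = 0 := Iff.rfl

lemma dd_mem (X : ∀ a, Matrix (Fin (x a)) (Fin (x (a + 1))) A)
    (S : ∀ b, Matrix (Fin (y (b + 1))) (Fin (y b)) A) {n : ℕ} {z : TT A x y}
    (hz : z ∈ Tn A x y (n + 1)) : dd X S z ∈ Tn A x y n := by
  intro a b h
  rw [dd_apply, hz (a + 1) b (by omega), hz a (b + 1) (by omega)]
  simp

/-- a family concentrated in a single bidegree -/
def sg (a b : ℕ) (M : Matrix (Fin (x a)) (Fin (y b)) A) : TT A x y :=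
  Pi.single a (Pi.single b M : ∀ b, Matrix (Fin (x a)) (Fin (y b)) A)

lemma sg_same (a b : ℕ) (M : Matrix (Fin (x a)) (Fin (y b)) A) : sg a b M a b = M := by
  simp [sg]

lemma sg_ne (a b a' b' : ℕ) (M : Matrix (Fin (x a)) (Fin (y b)) A) (h : a' ≠ a ∨ b' ≠ b) :
    sg a b M a' b' = 0 := by
  by_cases ha : a' = a
  · subst ha
    have hb : b' ≠ b := by tauto
    simp [sg, hb]
  · simp [sg, ha]

lemma sg_mem (a b n : ℕ) (M : Matrix (Fin (x a)) (Fin (y b)) A) (h : a + b = n) :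
    sg a b M ∈ Tn A x y n := by
  intro a' b' h'
  apply sg_ne
  omega

variable {B : Type} [CommRing B] (φ : A →+* B) (σ : B →+* A)

def EX (φ : A →+* B) (X : ∀ a, Matrix (Fin (x a)) (Fin (x (a + 1))) A) : ℕ → Prop
  | 0 => ∀ (s : ℕ) (M : Matrix (Fin (x 0)) (Fin s) A), M.map φ = 0 →
      ∃ U : Matrix (Fin (x (0 + 1))) (Fin s) A, X 0 * U = M
  | a + 1 => ∀ (s : ℕ) (M : Matrix (Fin (x (a + 1))) (Fin s) A), X a * M = 0 →
      ∃ U : Matrix (Fin (x (a + 1 + 1))) (Fin s) A, X (a + 1) * U = M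

variable (X : ∀ a, Matrix (Fin (x a)) (Fin (x (a + 1))) A)
    (Y : ∀ b, Matrix (Fin (y (b + 1))) (Fin (y b)) B)

/-- the zig-zag lemma -/
lemma zigzag (hφσ : ∀ b, φ (σ b) = b) (hX0 : (X 0).map φ = 0) (hX : ∀ a, X a * X (a + 1) = 0)
    (hY : ∀ b, Y (b + 1) * Y b = 0) (n c : ℕ) (hE : ∀ a, a + c + 1 ≤ n → EX φ X a)
    (z : TT A x y) (hz : z ∈ Tn A x y n)
    (hdz : ∀ a b, c ≤ b → dd X (fun b => (Y b).map σ) z a b = 0) :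
    ∃ (z' w : TT A x y) (v : Matrix (Fin (x 0)) (Fin (y n)) B),
      z' ∈ Tn A x y n ∧ w ∈ Tn A x y (n + 1) ∧ (∀ a b, c + 1 ≤ b → z' a b = 0) ∧
      dd X (fun b => (Y b).map σ) (sg 0 n (v.map σ)) = 0 ∧
      z = z' + sg 0 n (v.map σ) + dd X (fun b => (Y b).map σ) w := by
  set S : ∀ b, Matrix (Fin (y (b + 1))) (Fin (y b)) A := fun b => (Y b).map σ with hSdef
  have hS : ∀ b, S (b + 1) * S b = 0 := by
    intro b
    simp only [hSdef]
    rw [← Matrix.map_mul, hY]; simp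
  suffices H : ∀ (j : ℕ) (z : TT A x y), z ∈ Tn A x y n → 
      (∀ a b, c ≤ b → dd X S z a b = 0) → (∀ a b, c + 1 + j ≤ b → z a b = 0) →
      ∃ (z' w : TT A x y) (v : Matrix (Fin (x 0)) (Fin (y n)) B),
      z' ∈ Tn A x y n ∧ w ∈ Tn A x y (n + 1) ∧ (∀ a b, c + 1 ≤ b → z' a b = 0) ∧
      dd X S (sg 0 n (v.map σ)) = 0 ∧
      z = z' + sg 0 n (v.map σ) + dd X S w by
    exact H (n + 1) z hz hdz (fun a b h => hz a b (by omega))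
  clear hdz hz z
  intro j
  induction j with
  | zero =>
    intro z hz hdz hzb
    refine ⟨z, 0, 0, hz, Submodule.zero_mem _, hzb, ?_, ?_⟩
    · have : (sg 0 n ((0 : Matrix (Fin (x 0)) (Fin (y n)) B).map σ) : TT A x y) = 0 := by
        simp [sg]
      rw [this, map_zero]
    · simp [sg]
  | succ j ih =>
    intro z hz hdz hzb
    -- general step
    have step : ∀ (s w : TT A x y) (v : Matrix (Fin (x 0)) (Fin (y n)) B), 
        s = sg 0 n (v.map σ) → dd X S s = 0 → w ∈ Tn A x y (n + 1) → 
        (∀ a b, c + 1 + j ≤ b → (z - s - dd X S w) a b = 0) → 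
        ∃ (z' w : TT A x y) (v : Matrix (Fin (x 0)) (Fin (y n)) B),
          z' ∈ Tn A x y n ∧ w ∈ Tn A x y (n + 1) ∧ (∀ a b, c + 1 ≤ b → z' a b = 0) ∧
          dd X S (sg 0 n (v.map σ)) = 0 ∧
          z = z' + sg 0 n (v.map σ) + dd X S w := by
      intro s w v hs hds hw hb
      have hd : dd X S (z - s - dd X S w) = dd X S z := by
        rw [map_sub, map_sub, hds, dd_dd X S hX hS]; simp
      obtain ⟨z', w', v', h1, h2, h3, h4, h5⟩ := ih (z - s - dd X S w)
        (Submodule.sub_mem _ (Submodule.sub_mem _ hz (hs ▸ sg_mem 0 n n _ (by omega)))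
          (dd_mem X S hw)) (by rw [hd]; exact hdz) hb
      have hadd : (sg 0 n ((v + v').map σ) : TT A x y) = sg 0 n (v.map σ) + sg 0 n (v'.map σ) := by
        rw [Matrix.map_add _ (by simp)]
        simp only [sg, Pi.single_add]
      refine ⟨z', w + w', v + v', h1, Submodule.add_mem _ hw h2, h3, ?_, ?_⟩
      · rw [hadd, map_add, h4, ← hs, hds, add_zero]
      · rw [hadd, map_add, ← hs]
        have : z = (z - s - dd X S w) + s + dd X S w := by abel
        rw [this, h5]; abel
    have hzero : dd X S (0 : TT A x y) = 0 := map_zero _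
    have hsg0 : (0 : TT A x y) = sg 0 n ((0 : Matrix (Fin (x 0)) (Fin (y n)) B).map σ) := by
      simp [sg]
    rcases lt_trichotomy (c + 1 + j) n with hlt | heq | hgt
    · obtain ⟨a, ha⟩ : ∃ a, a + 1 + (c + 1 + j) = n := ⟨n - (c + 1 + j) - 1, by omega⟩
      have h0 := hdz a (c + 1 + j) (by omega)
      rw [dd_apply, hzb a (c + 1 + j + 1) (by omega)] at h0
      simp only [Matrix.zero_mul, smul_zero, add_zero] at h0
      obtain ⟨U, hU⟩ := hE (a + 1) (by omega) _ _ h0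
      refine step 0 (sg (a + 2) (c + 1 + j) U) 0 hsg0 hzero (sg_mem _ _ _ _ (by omega)) ?_
      intro a' b' hb'
      simp only [Pi.sub_apply, dd_apply, sub_zero]
      rw [sg_ne _ _ a' (b' + 1) _ (by omega)]
      by_cases hb : b' = c + 1 + j
      · subst hb
        by_cases haa : a' = a + 1
        · subst haa
          rw [sg_same, hU]; simp
        · rw [sg_ne _ _ _ _ _ (by omega), hz a' (c + 1 + j) (by omega)]; simp
      · rw [sg_ne _ _ _ _ _ (by omega), hzb a' b' (by omega)]; simp
    · subst heq
      have h0 := hdz 0 (c + j) (by omega)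
      rw [dd_apply] at h0
      have hcj : c + j + 1 = c + 1 + j := by omega
      have hds : dd X S (sg 0 (c + 1 + j) (((z 0 (c + 1 + j)).map φ).map σ)) = 0 := by
        have h1 := congrArg (fun M => Matrix.map M φ) h0
        have h2 : (z 0 (c + j + 1)).map φ * Y (c + j) = 0 := by
          have hSφ : (S (c + j)).map φ = Y (c + j) := by
            ext p q; simp [hSdef, hφσ]
          simp only [Matrix.map_add φ (map_add φ), Matrix.map_mul, hX0, pow_zero, one_smul,
            Matrix.zero_mul, zero_add, hSφ] at h1
          simpa using h1
        rw [← hcj]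
        funext a' b'
        rw [dd_apply, sg_ne _ _ _ _ _ (by omega)]
        by_cases hh : a' = 0 ∧ b' = c + j
        · obtain ⟨rfl, rfl⟩ := hh
          rw [sg_same]
          simp only [hSdef]
          rw [← Matrix.map_mul, h2]; simp
        · rw [sg_ne _ _ _ _ _ (by omega)]; simp
      obtain ⟨U, hU⟩ := hE 0 (by omega) _ (z 0 (c + 1 + j) - ((z 0 (c + 1 + j)).map φ).map σ) (by
        ext p q; simp [hφσ])
      refine step _ (sg 1 (c + 1 + j) U) _ rfl hds (sg_mem _ _ _ _ (by omega)) ?_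
      intro a' b' hb'
      simp only [Pi.sub_apply, dd_apply]
      rw [sg_ne 1 _ a' (b' + 1) _ (by omega)]
      by_cases hb : b' = c + 1 + j
      · subst hb
        by_cases haa : a' = 0
        · subst haa
          rw [sg_same, sg_same, hU]; simp
        · rw [sg_ne _ _ _ _ _ (by omega), sg_ne _ _ _ _ _ (by omega),
            hz a' (c + 1 + j) (by omega)]; simp
      · rw [sg_ne _ _ _ _ _ (by omega), sg_ne _ _ _ _ _ (by omega), hzb a' b' (by omega)]; simp
    · refine step 0 0 0 hsg0 hzero (Submodule.zero_mem _) ?_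
      intro a b hb
      simp [hz a b (by omega)]

/-- coordinates on the degree `n` part -/
lemma exists_coord (n : ℕ) : ∃ (τ : ℕ) (e : Tn A x y n ≃ₗ[A] (Fin τ → A)),
    ∀ (s : Set A) (_ : (0 : A) ∈ s) (z : Tn A x y n),
      (∀ i, e z i ∈ s) ↔ ∀ a b p q, z.1 a b p q ∈ s := by
  let ι := {s : (Σ a, Fin (x a)) × (Σ b, Fin (y b)) // s.1.1 + s.2.1 = n}
  have hfin : Finite ι := by
    let f : ι → (Σ a : Fin (n + 1), Fin (x a)) × (Σ b : Fin (n + 1), Fin (y b)) := fun s =>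
      (⟨⟨s.1.1.1, by have := s.2; omega⟩, s.1.1.2⟩, ⟨⟨s.1.2.1, by have := s.2; omega⟩, s.1.2.2⟩)
    refine Finite.of_injective f ?_
    rintro ⟨⟨⟨a, p⟩, ⟨b, q⟩⟩, h⟩ ⟨⟨⟨a', p'⟩, ⟨b', q'⟩⟩, h'⟩ hh
    simp only [f, Prod.mk.injEq, Sigma.mk.injEq, Fin.mk.injEq] at hh
    obtain ⟨⟨rfl, h2⟩, ⟨rfl, h4⟩⟩ := hh
    simp only [heq_eq_eq] at h2 h4
    subst h2 h4
    rfl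
  obtain ⟨τ, ⟨eι⟩⟩ := Finite.exists_equiv_fin ι
  let e1 : Tn A x y n ≃ₗ[A] (ι → A) :=
    { toFun := fun z s => z.1 s.1.1.1 s.1.2.1 s.1.1.2 s.1.2.2
      map_add' := fun _ _ => rfl
      map_smul' := fun _ _ => rfl
      invFun := fun f => ⟨fun a b => Matrix.of fun p q =>
        if h : a + b = n then f ⟨(⟨a, p⟩, ⟨b, q⟩), h⟩ else 0, by
          intro a b h
          ext p q
          simp [h]⟩
      left_inv := by
        intro z
        ext a b p q
        by_cases h : a + b = n
        · simp [h]
        · simp [h, z.2 a b h]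
      right_inv := by
        intro f
        funext ⟨⟨⟨a, p⟩, ⟨b, q⟩⟩, h⟩
        simp only at h
        simp [h] }
  refine ⟨τ, e1.trans (LinearEquiv.funCongrLeft A A eι.symm), ?_⟩
  intro s hs z
  constructor
  · intro h a b p q
    by_cases hab : a + b = n
    · have := h (eι ⟨(⟨a, p⟩, ⟨b, q⟩), hab⟩)
      simp only [LinearEquiv.trans_apply, LinearEquiv.funCongrLeft_apply, LinearMap.funLeft_apply,
        Equiv.symm_apply_apply] at this
      exact this
    · rw [z.2 a b hab]; exact hs
  · intro h i
    exact h _ _ _ _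

end Total

section Coord

variable {A : Type} [CommRing A] (x y : ℕ → ℕ)

def τn (A : Type) [CommRing A] (x y : ℕ → ℕ) (n : ℕ) : ℕ :=
  (exists_coord (A := A) (x := x) (y := y) n).choose

def en (A : Type) [CommRing A] (x y : ℕ → ℕ) (n : ℕ) :
    Tn A x y n ≃ₗ[A] (Fin (τn A x y n) → A) :=
  (exists_coord (A := A) (x := x) (y := y) n).choose_spec.choose

lemma en_spec (n : ℕ) (s : Set A) (hs : (0 : A) ∈ s) (z : Tn A x y n) :
      (∀ i, en A x y n z i ∈ s) ↔ ∀ a b p q, z.1 a b p q ∈ s :=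
  (exists_coord (A := A) (x := x) (y := y) n).choose_spec.choose_spec s hs z

variable {x y} (X : ∀ a, Matrix (Fin (x a)) (Fin (x (a + 1))) A)
    (S : ∀ b, Matrix (Fin (y (b + 1))) (Fin (y b)) A)

def Dm (n : ℕ) : Matrix (Fin (τn A x y n)) (Fin (τn A x y (n + 1))) A :=
  LinearMap.toMatrix' ((en A x y n).toLinearMap ∘ₗ
    ((dd X S).restrict (p := Tn A x y (n + 1)) (q := Tn A x y n) (fun _ hz => dd_mem X S hz)) ∘ₗ
    (en A x y (n + 1)).symm.toLinearMap)

lemma Dm_lin (n : ℕ) : (Dm X S n).mulVecLin = (en A x y n).toLinearMap ∘ₗ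
    ((dd X S).restrict (p := Tn A x y (n + 1)) (q := Tn A x y n) (fun _ hz => dd_mem X S hz)) ∘ₗ
    (en A x y (n + 1)).symm.toLinearMap := by
  rw [Dm, ← Matrix.toLin'_apply', Matrix.toLin'_toMatrix']

lemma Dm_ker (n : ℕ) (v : Fin (τn A x y (n + 1)) → A) : v ∈ LinearMap.ker (Dm X S n).mulVecLin ↔
    dd X S ((en A x y (n + 1)).symm v).1 = 0 := by
  rw [Dm_lin, LinearMap.mem_ker]
  simp only [LinearMap.comp_apply, LinearEquiv.coe_coe, LinearEquiv.map_eq_zero_iff]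
  rw [Subtype.ext_iff]
  rfl

lemma Dm_range (n : ℕ) (v : Fin (τn A x y n) → A) : v ∈ LinearMap.range (Dm X S n).mulVecLin ↔
    ∃ w ∈ Tn A x y (n + 1), dd X S w = ((en A x y n).symm v).1 := by
  rw [Dm_lin]
  constructor
  · rintro ⟨u, rfl⟩
    refine ⟨((en A x y (n + 1)).symm u).1, ((en A x y (n + 1)).symm u).2, ?_⟩
    simp
  · rintro ⟨w, hw, h⟩
    refine ⟨en A x y (n + 1) ⟨w, hw⟩, ?_⟩
    simp only [LinearMap.comp_apply, LinearEquiv.coe_coe, LinearEquiv.symm_apply_apply]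
    rw [← LinearEquiv.eq_symm_apply, Subtype.ext_iff, ← h]
    rfl

lemma Dm_exact (n : ℕ) (h1 : ∀ z, dd X S (dd X S z) = 0)
    (h : ∀ z ∈ Tn A x y (n + 1), dd X S z = 0 → ∃ w ∈ Tn A x y (n + 2), dd X S w = z) :
    LinearMap.ker (Dm X S n).mulVecLin = LinearMap.range (Dm X S (n + 1)).mulVecLin := by
  ext v
  rw [Dm_ker, Dm_range]
  constructor
  · intro hv
    exact h _ ((en A x y (n + 1)).symm v).2 hv
  · rintro ⟨w, -, hw⟩
    rw [← hw, h1]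

/-- the first map, with values in `A` -/
def D0 (i0 : Fin (x 0)) (j0 : Fin (y 0)) : Matrix (Fin 1) (Fin (τn A x y 1)) A :=
  LinearMap.toMatrix' 
   { toFun := fun v _ => dd X S ((en A x y 1).symm v).1 0 0 i0 j0
     map_add' := fun v w => by funext i; simp
     map_smul' := fun r w => by funext i; simp }

lemma D0_apply (i0 : Fin (x 0)) (j0 : Fin (y 0)) (v : Fin (τn A x y 1) → A) :
    (D0 X S i0 j0).mulVecLin v = fun _ => dd X S ((en A x y 1).symm v).1 0 0 i0 j0 := by
  rw [D0, ← Matrix.toLin'_apply', Matrix.toLin'_toMatrix']; rfl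

lemma D0_ker (i0 : Fin (x 0)) (j0 : Fin (y 0)) (hi : ∀ i, i = i0) (hj : ∀ j, j = j0) :
    LinearMap.ker (D0 X S i0 j0).mulVecLin = LinearMap.ker (Dm X S 0).mulVecLin := by
  ext v
  rw [Dm_ker, LinearMap.mem_ker, D0_apply]
  constructor
  · intro h
    funext a b
    by_cases hab : a + b = 0
    · obtain ⟨rfl, rfl⟩ : a = 0 ∧ b = 0 := by omega
      ext i j
      rw [hi i, hj j]
      exact congrFun h 0
    · exact dd_mem X S ((en A x y 1).symm v).2 a b hab
  · intro h
    rw [h]; rfl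

variable [Algebra k A] (G : SG k A)

lemma dd_lin (hX : ∀ a p q, X a p q ∈ G.lin) (hS : ∀ a p q, S a p q ∈ G.lin) (z : TT A x y)
    (hz : ∀ a b p q, z a b p q ∈ (Set.range (algebraMap k A))) (a b p q) :
    dd X S z a b p q ∈ G.lin := by
  rw [dd_apply]
  simp only [Matrix.add_apply, Matrix.smul_apply, Matrix.mul_apply]
  refine Submodule.add_mem _ (Submodule.sum_mem _ fun j _ => ?_) ?_
  · obtain ⟨c, hc⟩ := hz (a + 1) b j q
    rw [← hc]; exact G.lin_mul (hX _ _ _) c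
  · have h1 : ∑ j, z a (b + 1) p j * S b j q ∈ G.lin := by
      refine Submodule.sum_mem _ fun j _ => ?_
      obtain ⟨c, hc⟩ := hz a (b + 1) p j
      rw [← hc]; exact G.mul_lin (hS _ _ _) c
    rcases neg_one_pow_eq_or A a with h | h
    · rw [h, one_smul]; exact h1
    · rw [h, neg_one_smul]; exact Submodule.neg_mem _ h1

lemma single_const (n : ℕ) (j : Fin (τn A x y n)) (a b p q) :
    ((en A x y n).symm (Pi.single j 1)).1 a b p q ∈ Set.range (algebraMap k A) := by
  refine (en_spec x y n (Set.range (algebraMap k A)) ⟨0, by simp⟩ _).1 ?_ a b p q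
  intro i
  rw [LinearEquiv.apply_symm_apply]
  by_cases h : i = j
  · subst h; exact ⟨1, by simp⟩
  · exact ⟨0, by simp [h]⟩

lemma Dm_entry (hX : ∀ a p q, X a p q ∈ G.lin) (hS : ∀ a p q, S a p q ∈ G.lin) (n : ℕ) (i j) :
    Dm X S n i j ∈ G.lin := by
  have h1 : Dm X S n i j = (Dm X S n).mulVecLin (Pi.single j 1) i := by simp
  rw [h1, Dm_lin]
  refine (en_spec x y n (G.lin : Set A) (Submodule.zero_mem _) _).2 ?_ i
  intro a b p q
  exact dd_lin X S G hX hS _ (single_const _ _) a b p q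

lemma D0_entry (hX : ∀ a p q, X a p q ∈ G.lin) (hS : ∀ a p q, S a p q ∈ G.lin)
    (i0 : Fin (x 0)) (j0 : Fin (y 0)) (i j) :
    D0 X S i0 j0 i j ∈ G.lin := by
  have h1 : D0 X S i0 j0 i j = (D0 X S i0 j0).mulVecLin (Pi.single j 1) i := by simp
  rw [h1, D0_apply]
  exact dd_lin X S G hX hS _ (single_const _ _) _ _ _ _

lemma Dm_min (n : ℕ) (h : ∀ z ∈ Tn A x y (n + 1), dd X S z = 0 → ∀ a b p q, G.ε (z a b p q) = 0)
    (v) (hv : (Dm X S n).mulVec v = 0) (i) : G.ε (v i) = 0 := by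
  have h1 := h _ ((en A x y (n + 1)).symm v).2 ((Dm_ker X S n v).1 hv)
  have h2 := (en_spec x y (n + 1) {a : A | G.ε a = 0} (by simp) ((en A x y (n + 1)).symm v)).2 h1 i
  simpa using h2

lemma cyc_span (n t : ℕ)
    (h : LinSolvable (G.lin : Set A) t (LinearMap.ker (Dm X S n).mulVecLin))
    (z : TT A x y) (hz : z ∈ Tn A x y (n + 1)) (hdz : dd X S z = 0) :
    z ∈ Submodule.span A {z | z ∈ Tn A x y (n + 1) ∧ dd X S z = 0 ∧
      ∀ a b p q, z a b p q ∈ G.lin} := by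
  have h1 := G.linSolvable_linPart h
  have h2 : en A x y (n + 1) ⟨z, hz⟩ ∈ LinearMap.ker (Dm X S n).mulVecLin := by
    rw [Dm_ker]; simpa using hdz
  rw [← h1] at h2
  have h3 := Submodule.mem_map_of_mem
    (f := (Tn A x y (n + 1)).subtype ∘ₗ (en A x y (n + 1)).symm.toLinearMap) h2
  rw [SG.linPart, Submodule.map_span] at h3
  simp only [LinearMap.comp_apply, LinearEquiv.coe_coe, LinearEquiv.symm_apply_apply,
    Submodule.subtype_apply] at h3
  refine Submodule.span_mono ?_ h3
  rintro _ ⟨v, ⟨hv1, hv2⟩, rfl⟩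
  refine ⟨((en A x y (n + 1)).symm v).2, (Dm_ker X S n v).1 hv1, ?_⟩
  refine (en_spec x y (n + 1) (G.lin : Set A) (Submodule.zero_mem _) _).1 ?_
  simpa using hv2

lemma dd_sg_left (a : ℕ) (U : Matrix (Fin (x (a + 1))) (Fin (y 0)) A) :
    dd X S (sg (a + 1) 0 U) = sg a 0 (X a * U) := by
  funext a' b'
  rw [dd_apply, sg_ne _ _ a' (b' + 1) _ (by omega)]
  by_cases h : a' = a ∧ b' = 0
  · obtain ⟨rfl, rfl⟩ := h
    rw [sg_same, sg_same]; simp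
  · rw [sg_ne _ _ _ _ _ (by omega), sg_ne _ _ _ _ _ (by omega)]; simp

lemma dd_sg_right (b : ℕ) (V : Matrix (Fin (x 0)) (Fin (y (b + 1))) A) :
    dd X S (sg 0 (b + 1) V) = sg 0 b (V * S b) := by
  funext a' b'
  rw [dd_apply, sg_ne _ _ (a' + 1) b' _ (by omega)]
  by_cases h : a' = 0 ∧ b' = b
  · obtain ⟨rfl, rfl⟩ := h
    rw [sg_same, sg_same]; simp
  · rw [sg_ne _ _ _ _ _ (by omega), sg_ne _ _ _ _ _ (by omega)]; simp

lemma sg_zero_iff (a b : ℕ) (M : Matrix (Fin (x a)) (Fin (y b)) A) :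
    (sg a b M : TT A x y) = 0 ↔ M = 0 := by
  constructor
  · intro h
    rw [← sg_same (x := x) (y := y) a b M, h]; rfl
  · rintro rfl; simp [sg]

/-- a family concentrated in one bidegree -/
lemma eq_sg (z : TT A x y) (n c : ℕ) (hz : z ∈ Tn A x y (n + c)) 
    (h : ∀ a b, b ≠ c → z a b = 0) : z = sg n c (z n c) := by
  funext a b
  by_cases hh : a = n ∧ b = c
  · obtain ⟨rfl, rfl⟩ := hh
    rw [sg_same]
  · rw [sg_ne _ _ _ _ _ (by omega)]
    by_cases hb : b = c
    · exact hz a b (by omega)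
    · exact h a b hb

end Coord

/-- data of a graded retract -/
structure RT {A B : Type} [CommRing A] [CommRing B] [Algebra k A] [Algebra k B]
    (G : SG k A) (G' : SG k B) where
  φ : A →+* B
  σ : B →+* A
  φσ : ∀ b, φ (σ b) = b
  φl : ∀ a ∈ G.lin, φ a ∈ G'.lin
  σl : ∀ a ∈ G'.lin, σ a ∈ G.lin

namespace RT

variable {A B : Type} [CommRing A] [CommRing B] [Algebra k A] [Algebra k B]
    {G : SG k A} {G' : SG k B} (R : RT G G')

def NX : Submodule A (Fin 1 → A) := idealToPi (RingHom.ker R.φ)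
def NY (_ : RT G G') : Submodule B (Fin 1 → B) := idealToPi (RingHom.ker G'.ε)
abbrev x : ℕ → ℕ := G.bx R.NX
abbrev y : ℕ → ℕ := G'.bx R.NY
def X (a : ℕ) : Matrix (Fin (R.x a)) (Fin (R.x (a + 1))) A := G.bX R.NX a
def Y (b : ℕ) : Matrix (Fin (R.y (b + 1))) (Fin (R.y b)) B := (G'.bX R.NY b).transpose
def S (b : ℕ) : Matrix (Fin (R.y (b + 1))) (Fin (R.y b)) A := (R.Y b).map R.σ
def i0 : Fin (R.x 0) := (0 : Fin 1)
def j0 : Fin (R.y 0) := (0 : Fin 1)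
lemma i0_eq (i : Fin (R.x 0)) : i = R.i0 := Subsingleton.elim (α := Fin 1) i 0
lemma j0_eq (i : Fin (R.y 0)) : i = R.j0 := Subsingleton.elim (α := Fin 1) i 0

abbrev d : TT A R.x R.y →ₗ[A] TT A R.x R.y := dd R.X R.S
abbrev T (n : ℕ) : Submodule A (TT A R.x R.y) := Tn A R.x R.y n


lemma _root_.SG.ε_span {a : A} (G : SG k A) (h : a ∈ Ideal.span (G.lin : Set A)) : G.ε a = 0 := by
  have : Ideal.span (G.lin : Set A) ≤ RingHom.ker G.ε := by
    rw [Ideal.span_le]; intro l hl; exact G.ε_lin l hl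
  exact this h

lemma σ_span {b : B} (h : b ∈ Ideal.span (G'.lin : Set B)) :
    R.σ b ∈ Ideal.span (G.lin : Set A) := by
  have : Ideal.span (G'.lin : Set B) ≤ (Ideal.span (G.lin : Set A)).comap R.σ := by
    rw [Ideal.span_le]; intro l hl; exact Ideal.subset_span (R.σl l hl)
  exact this h

lemma φ_span {a : A} (h : a ∈ Ideal.span (G.lin : Set A)) :
    R.φ a ∈ Ideal.span (G'.lin : Set B) := by
  have : Ideal.span (G.lin : Set A) ≤ (Ideal.span (G'.lin : Set B)).comap R.φ := by
    rw [Ideal.span_le]; intro l hl; exact Ideal.subset_span (R.φl l hl)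
  exact this h

lemma σ_ε {b : B} (h : G'.ε b = 0) : G.ε (R.σ b) = 0 :=
  G.ε_span (R.σ_span (G'.ker_le b h))

lemma φ_ε {a : A} (h : G.ε a = 0) : G'.ε (R.φ a) = 0 :=
  G'.ε_span (R.φ_span (G.ker_le a h))

lemma X_lin (a p q) : R.X a p q ∈ G.lin := G.bX_lin _ a p q
lemma S_lin (a p q) : R.S a p q ∈ G.lin := R.σl _ (G'.bX_lin _ a q p)
lemma XX (a) : R.X a * R.X (a + 1) = 0 := G.bX_mul _ a
lemma YY (b) : R.Y (b + 1) * R.Y b = 0 := by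
  unfold Y; rw [← Matrix.transpose_mul, G'.bX_mul]; rfl
lemma SS (b) : R.S (b + 1) * R.S b = 0 := by
  unfold S; rw [← Matrix.map_mul, R.YY]; ext; simp
lemma d_d (z) : R.d (R.d z) = 0 := dd_dd _ _ R.XX R.SS z

lemma mem_NX {v : Fin 1 → A} : v ∈ R.NX ↔ R.φ (v 0) = 0 := mem_idealToPi
lemma mem_NY {v : Fin 1 → B} : v ∈ R.NY ↔ G'.ε (v 0) = 0 := mem_idealToPi

lemma X0 : (R.X 0).map R.φ = 0 := by
  ext p q
  have h : LinearMap.range (G.bX R.NX 0).mulVecLin ≤ R.NX := by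
    rw [G.bX_zero]; exact G.linPart_le _
  have h1 := R.mem_NX.1 (h ⟨Pi.single q 1, rfl⟩)
  rw [Matrix.mulVecLin_apply, Matrix.mulVec_single_one] at h1
  rw [R.i0_eq p]
  exact h1

lemma EX_of (a : ℕ) (h : G.Ex R.NX a) : EX R.φ R.X a := by
  cases a with
  | zero =>
    intro s M hM
    refine exists_mat_of_range _ _ fun j => ?_
    have h1 := G.bX_zero R.NX
    rw [h] at h1
    unfold X
    rw [h1]
    refine R.mem_NX.2 ?_
    exact congrFun (congrFun hM R.i0) j
  | succ a =>
    intro s M hM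
    refine exists_mat_of_range _ _ fun j => ?_
    have h1 := G.bX_succ R.NX a
    rw [h] at h1
    unfold X
    rw [h1, LinearMap.mem_ker]
    funext i
    exact congrFun (congrFun hM i) j

/-- exactness over `B` -/
lemma EY_of (b : ℕ) (h : G'.Ex R.NY (b + 1)) (s : ℕ) (v : Matrix (Fin s) (Fin (R.y (b + 1))) B)
    (hv : v * R.Y b = 0) : ∃ u : Matrix (Fin s) (Fin (R.y (b + 2))) B, u * R.Y (b + 1) = v := by
  have h2 : G'.bX R.NY b * v.transpose = 0 := by
    rw [← Matrix.transpose_transpose (G'.bX R.NY b), ← Matrix.transpose_mul]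
    unfold Y at hv; rw [hv]; rfl
  obtain ⟨U, hU⟩ := exists_mat_of_range (G'.bX R.NY (b + 1)) v.transpose (fun j => by
    have h1 := G'.bX_succ R.NY b
    rw [h] at h1
    rw [h1, LinearMap.mem_ker]
    funext i
    exact congrFun (congrFun h2 i) j)
  refine ⟨U.transpose, ?_⟩
  unfold Y
  rw [← Matrix.transpose_mul, hU, Matrix.transpose_transpose]

lemma map_σφ {m n : ℕ} (M : Matrix (Fin m) (Fin n) B) : (M.map R.σ).map R.φ = M := by
  ext i j; simp [R.φσ]

lemma cyc_right (i : ℕ) (v : Matrix (Fin (R.x 0)) (Fin (R.y (i + 1))) B) :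
    R.d (sg 0 (i + 1) (v.map R.σ)) = 0 ↔ v * R.Y i = 0 := by
  rw [d, dd_sg_right, sg_zero_iff, S, ← Matrix.map_mul]
  constructor
  · intro h
    have := congrArg (fun M => M.map R.φ) h
    simp only [R.map_σφ] at this
    rw [this]; ext; simp
  · intro h; rw [h]; ext; simp

lemma cyc_left (i : ℕ) (U : Matrix (Fin (R.x (i + 1))) (Fin (R.y 0)) A) :
    R.d (sg (i + 1) 0 U) = 0 ↔ R.X i * U = 0 := by
  rw [d, dd_sg_left, sg_zero_iff]

/-- decomposition of cycles -/
lemma decomp (i : ℕ) (hE : ∀ a, a ≤ i → G.Ex R.NX a) (z) (hz : z ∈ R.T (i + 1))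
    (hdz : R.d z = 0) : ∃ (U : Matrix (Fin (R.x (i + 1))) (Fin (R.y 0)) A)
      (v : Matrix (Fin (R.x 0)) (Fin (R.y (i + 1))) B) (w : TT A R.x R.y), w ∈ R.T (i + 2) ∧
      R.X i * U = 0 ∧ v * R.Y i = 0 ∧ z = sg (i + 1) 0 U + sg 0 (i + 1) (v.map R.σ) + R.d w := by
  obtain ⟨z', w, v, h1, h2, h3, h4, h5⟩ := zigzag R.φ R.σ R.X R.Y R.φσ R.X0 R.XX R.YY (i + 1) 0
    (fun a ha => R.EX_of a (hE a (by omega))) z hz (fun a b _ => by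
      exact congrFun (congrFun hdz a) b)
  have h6 := eq_sg z' (i + 1) 0 h1 (fun a b hb => h3 a b (by omega))
  have hd' : R.d z' = 0 := by
    have e : R.d z = R.d z' + R.d (sg 0 (i + 1) (v.map R.σ)) + R.d (R.d w) := by
      rw [h5, map_add, map_add]; rfl
    have h4' : R.d (sg 0 (i + 1) (v.map R.σ)) = 0 := h4
    rw [hdz, R.d_d, h4'] at e
    simpa using e.symm
  refine ⟨z' (i + 1) 0, v, w, h2, ?_, (R.cyc_right i v).1 h4, ?_⟩
  · rw [h6] at hd'; exact (R.cyc_left i _).1 hd'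
  · rw [← h6]; exact h5

lemma ε_d (w) (a b p q) : G.ε (R.d w a b p q) = 0 := by
  rw [d, dd_apply, Matrix.add_apply, map_add, G.ε_mul _ (R.X_lin a), Matrix.smul_apply, smul_eq_mul,
    map_mul, G.ε_mul' _ (R.S_lin b)]
  simp

lemma ε_sg (a' b' : ℕ) (M : Matrix (Fin (R.x a')) (Fin (R.y b')) A)
    (h : ∀ p q, G.ε (M p q) = 0) (a b p q) :
    G.ε ((sg a' b' M : TT A R.x R.y) a b p q) = 0 := by
  by_cases hh : a = a' ∧ b = b'
  · obtain ⟨rfl, rfl⟩ := hh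
    rw [sg_same]; exact h p q
  · rw [sg_ne _ _ _ _ _ (by omega)]; simp

lemma minl (i : ℕ) (hE : ∀ a, a ≤ i → G.Ex R.NX a) (z) (hz : z ∈ R.T (i + 1))
    (hdz : R.d z = 0) (a b p q) : G.ε (z a b p q) = 0 := by
  obtain ⟨U, v, w, -, h1, h2, rfl⟩ := R.decomp i hE z hz hdz
  simp only [Pi.add_apply, Matrix.add_apply, map_add]
  rw [R.ε_d, R.ε_sg, R.ε_sg]
  · simp
  · intro p q
    refine R.σ_ε ?_
    refine G'.bX_min R.NY i (fun q => v p q) ?_ q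
    funext j
    have := congrFun (congrFun h2 p) j
    simp only [Matrix.mul_apply, Y, Matrix.transpose_apply] at this
    simp only [Matrix.mulVec, dotProduct]
    rw [Pi.zero_apply]
    refine Eq.trans ?_ this
    exact Finset.sum_congr rfl fun _ _ => mul_comm _ _
  · intro p q
    refine G.bX_min R.NX i (fun p => U p q) ?_ p
    funext j
    exact congrFun (congrFun h1 j) q

lemma exactness (i : ℕ) (hE : ∀ a, a ≤ i + 1 → G.Ex R.NX a) (hY : G'.Ex R.NY (i + 1)) (z)
    (hz : z ∈ R.T (i + 1)) (hdz : R.d z = 0) : ∃ w ∈ R.T (i + 2), R.d w = z := by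
  obtain ⟨U, v, w, hw, h1, h2, rfl⟩ := R.decomp i (fun a ha => hE a (by omega)) z hz hdz
  obtain ⟨U', hU'⟩ := R.EX_of (i + 1) (hE _ le_rfl) _ U h1
  obtain ⟨v', hv'⟩ := R.EY_of i hY _ v h2
  refine ⟨sg (i + 2) 0 U' + sg 0 (i + 2) (v'.map R.σ) + w,
    Submodule.add_mem _ (Submodule.add_mem _ (sg_mem _ _ _ _ (by omega))
      (sg_mem _ _ _ _ (by omega))) hw, ?_⟩
  rw [map_add, map_add, d, dd_sg_left, dd_sg_right, hU', S, ← Matrix.map_mul, hv']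

/-- the ideal `𝔪` -/
lemma range_D0 (hX : G.Ex R.NX 0) (hY : G'.Ex R.NY 0) :
    LinearMap.range (D0 R.X R.S R.i0 R.j0).mulVecLin = idealToPi (RingHom.ker G.ε) := by
  apply le_antisymm
  · rintro _ ⟨v, rfl⟩
    rw [D0_apply, mem_idealToPi]
    exact R.ε_d _ _ _ _ _
  · intro v hv
    have hv : G.ε (v 0) = 0 := mem_idealToPi.1 hv
    have h1 := G'.bX_zero R.NY
    rw [hY] at h1
    have h2 : (fun _ => R.φ (v 0)) ∈ R.NY := R.mem_NY.2 (R.φ_ε hv)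
    rw [← h1] at h2
    obtain ⟨u, hu⟩ := h2
    have h3 : ∃ V : Matrix (Fin (R.x 0)) (Fin (R.y 1)) B, (V * R.Y 0) R.i0 R.j0 = R.φ (v 0) := by
      refine ⟨Matrix.of fun _ q => u q, ?_⟩
      rw [← congrFun hu R.j0]
      simp only [Matrix.mul_apply, Y, Matrix.transpose_apply, Matrix.mulVecLin_apply, Matrix.mulVec,
        dotProduct, Matrix.of_apply]
      exact Finset.sum_congr rfl fun _ _ => mul_comm _ _
    obtain ⟨V, hV⟩ := h3
    have h4 : ∃ U : Matrix (Fin (R.x 1)) (Fin (R.y 0)) A,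
        R.X 0 * U = Matrix.of fun _ _ => v 0 - R.σ (R.φ (v 0)) := by
      refine R.EX_of 0 hX _ _ ?_
      ext i j
      simp [R.φσ]
    obtain ⟨U, hU⟩ := h4
    let w : Tn A R.x R.y 1 := ⟨sg 1 0 U + sg 0 1 (V.map R.σ),
      Submodule.add_mem _ (sg_mem _ _ _ _ rfl) (sg_mem _ _ _ _ rfl)⟩
    refine ⟨en A R.x R.y 1 w, ?_⟩
    rw [D0_apply, LinearEquiv.symm_apply_apply]
    funext i
    rw [Subsingleton.elim i 0]
    simp only [w]
    rw [map_add, dd_sg_left R.X R.S 0, dd_sg_right R.X R.S 0, hU, Pi.add_apply, Pi.add_apply,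
      sg_same, sg_same, S, ← Matrix.map_mul, Matrix.add_apply, Matrix.map_apply, hV]
    simp

lemma ker_D0 : LinearMap.ker (D0 R.X R.S R.i0 R.j0).mulVecLin
      = LinearMap.ker (Dm R.X R.S 0).mulVecLin :=
  D0_ker _ _ _ _ R.i0_eq R.j0_eq

theorem backward (hX : ∀ a, G.Ex R.NX a) (hY : ∀ a, G'.Ex R.NY a) (t : ℕ) :
    LinSolvable (G.lin : Set A) t (idealToPi (RingHom.ker G.ε)) := by
  have hex : ∀ i, LinearMap.ker (Dm R.X R.S i).mulVecLin
      = LinearMap.range (Dm R.X R.S (i + 1)).mulVecLin := fun i =>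
    Dm_exact _ _ i R.d_d (R.exactness i (fun a _ => hX a) (hY _))
  have key : ∀ t i, LinSolvable (G.lin : Set A) t
      (LinearMap.range (Dm R.X R.S i).mulVecLin) := by
    intro t
    induction t with
    | zero => exact fun i => ⟨_, _, Dm_entry _ _ G R.X_lin R.S_lin i, rfl⟩
    | succ t ih =>
      exact fun i => ⟨_, _, Dm_entry _ _ G R.X_lin R.S_lin i, rfl, by rw [hex]; exact ih _⟩
  rw [← R.range_D0 (hX 0) (hY 0)]
  cases t with
  | zero => exact ⟨_, _, D0_entry _ _ G R.X_lin R.S_lin _ _, rfl⟩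
  | succ t =>
    exact ⟨_, _, D0_entry _ _ G R.X_lin R.S_lin _ _, rfl, by
      rw [R.ker_D0, hex]; exact key t _⟩

lemma exY0 : G'.Ex R.NY 0 := by
  refine le_antisymm (G'.linPart_le _) ?_
  intro v hv
  have hv' := G'.ker_le _ (R.mem_NY.1 hv)
  have : Ideal.span (G'.lin : Set B) ≤ (G'.linPart R.NY).comap
      (LinearMap.pi fun _ : Fin 1 => (LinearMap.id : B →ₗ[B] B)) := by
    refine Submodule.span_le.2 ?_
    intro l hl
    refine Submodule.subset_span ⟨R.mem_NY.2 (G'.ε_lin l hl), fun i => hl⟩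
  have h := this hv'
  have e : v = (LinearMap.pi fun _ : Fin 1 => (LinearMap.id : B →ₗ[B] B)) (v 0) := by
    funext i; rw [Subsingleton.elim i 0]; rfl
  rw [e]; exact h

lemma ker_ε {z : A} (hz : R.φ z = 0) : G.ε z = 0 := by
  have h1 : G.ε (z - algebraMap k A (G.ε z)) = 0 := by simp
  have h2 := R.φ_ε h1
  rw [map_sub, hz, zero_sub, map_neg, neg_eq_zero] at h2
  let f : k →+* k := ((G'.ε : B →+* k).comp R.φ).comp (algebraMap k A)
  have h3 : f (G.ε z) = 0 := h2
  exact (map_eq_zero f).1 h3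

lemma exX0 : G.Ex R.NX 0 := by
  refine G.nakayama _ ?_
  intro v hv
  have hv0 := R.mem_NX.1 hv
  have key : ∀ z ∈ Ideal.span (G.lin : Set A), (fun _ : Fin 1 => z - R.σ (R.φ z)) ∈
      G.linPart R.NX ⊔ Ideal.span (G.lin : Set A) • R.NX := by
    intro z hz
    induction hz using Submodule.span_induction with
    | mem l hl =>
      refine Submodule.mem_sup_left (Submodule.subset_span ⟨R.mem_NX.2 (by simp [R.φσ]), ?_⟩)
      intro i
      exact Submodule.sub_mem _ hl (R.σl _ (R.φl _ hl))
    | zero =>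
      convert Submodule.zero_mem (G.linPart R.NX ⊔ Ideal.span (G.lin : Set A) • R.NX) using 1
      funext i; simp
    | add a b _ _ ha hb =>
      convert Submodule.add_mem _ ha hb using 1
      funext i
      simp only [map_add, Pi.add_apply]; ring
    | smul r z hz' ih =>
      have h2 : (R.σ (R.φ z)) • (fun _ : Fin 1 => r - R.σ (R.φ r)) ∈
          Ideal.span (G.lin : Set A) • R.NX :=
        Submodule.smul_mem_smul (R.σ_span (R.φ_span hz')) (R.mem_NX.2 (by simp [R.φσ]))
      convert Submodule.add_mem _ (Submodule.smul_mem _ r ih) (Submodule.mem_sup_right h2) using 1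
      funext i
      simp only [map_mul, Pi.add_apply, Pi.smul_apply, smul_eq_mul]; ring
  have h := key (v 0) (G.ker_le _ (R.ker_ε hv0))
  convert h using 1
  funext i
  rw [hv0, Subsingleton.elim i 0]; simp

lemma ker_solv (hK : ∀ t, LinSolvable (G.lin : Set A) t (idealToPi (RingHom.ker G.ε))) (m : ℕ)
    (hX : ∀ a, a ≤ m → G.Ex R.NX a) (hY : ∀ a, a ≤ m → G'.Ex R.NY a) :
    ∀ t, LinSolvable (G.lin : Set A) t (LinearMap.ker (Dm R.X R.S m).mulVecLin) := by
  induction m with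
  | zero =>
    intro t
    rw [← R.ker_D0]
    refine G.solvable_ker _ (D0_entry _ _ G R.X_lin R.S_lin _ _) ?_ ?_
    · intro v hv
      have : v ∈ LinearMap.ker (D0 R.X R.S R.i0 R.j0).mulVecLin := hv
      rw [R.ker_D0] at this
      exact Dm_min _ _ G 0 (R.minl 0 hX) v this
    · rw [R.range_D0 (hX 0 le_rfl) (hY 0 le_rfl)]; exact hK _
  | succ m ih =>
    intro t
    refine G.solvable_ker _ (Dm_entry _ _ G R.X_lin R.S_lin _)
      (Dm_min _ _ G _ (R.minl _ hX)) ?_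
    rw [← Dm_exact _ _ m R.d_d (R.exactness m hX (hY _ le_rfl))]
    exact ih (fun a ha => hX a (by omega)) (fun a ha => hY a (by omega)) _

/-- linear cycles -/
def LC (m : ℕ) : Set (TT A R.x R.y) :=
  {z | z ∈ R.T (m + 1) ∧ R.d z = 0 ∧ ∀ a b p q, z a b p q ∈ G.lin}

lemma exY_succ (m : ℕ)
    (hc : ∀ z ∈ R.T (m + 1), R.d z = 0 → z ∈ Submodule.span A (R.LC m)) :
    G'.Ex R.NY (m + 1) := by
  refine le_antisymm (G'.linPart_le _) ?_
  intro v hv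
  rw [LinearMap.mem_ker, Matrix.mulVecLin_apply] at hv
  have hcyc : ∀ V : Matrix (Fin (R.x 0)) (Fin (R.y (m + 1))) B,
      V * R.Y m = 0 ↔ ∀ p, (G'.bX R.NY m).mulVec (V p) = 0 := by
    intro V
    have e : ∀ p j, (V * R.Y m) p j = (G'.bX R.NY m).mulVec (V p) j := by
      intro p j
      simp only [Matrix.mul_apply, Y, Matrix.transpose_apply, Matrix.mulVec, dotProduct]
      exact Finset.sum_congr rfl fun _ _ => mul_comm _ _
    constructor
    · intro h p; funext j; rw [← e, h]; rfl
    · intro h; ext p j; rw [e, h]; rfl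
  have key : ∀ z ∈ Submodule.span A (R.LC m), (fun q => R.φ (z 0 (m + 1) R.i0 q)) ∈
      G'.linPart (LinearMap.ker (G'.bX R.NY m).mulVecLin) := by
    intro z hz
    induction hz using Submodule.span_induction with
    | mem z hz =>
      obtain ⟨h1, h2, h3⟩ := hz
      refine Submodule.subset_span ⟨?_, fun i => R.φl _ (h3 _ _ _ _)⟩
      rw [LinearMap.mem_ker, Matrix.mulVecLin_apply]
      refine (hcyc ((z 0 (m + 1)).map R.φ)).1 ?_ R.i0
      have h4 := congrArg (fun M => M.map R.φ) (congrFun (congrFun h2 0) m)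
      simp only [d, dd_apply, pow_zero, one_smul] at h4
      rw [Matrix.map_add _ (map_add R.φ), Matrix.map_mul, Matrix.map_mul, R.X0, S, R.map_σφ] at h4
      rw [Matrix.zero_mul, zero_add] at h4
      rw [h4]; ext; simp
    | zero =>
      convert Submodule.zero_mem (G'.linPart (LinearMap.ker (G'.bX R.NY m).mulVecLin)) using 1
      funext i; simp
    | add a b _ _ ha hb =>
      convert Submodule.add_mem _ ha hb using 1
      funext i
      simp
    | smul r z hz' ih =>
      convert Submodule.smul_mem _ (R.φ r) ih using 1
      funext i
      simp
  let V : Matrix (Fin (R.x 0)) (Fin (R.y (m + 1))) B := Matrix.of fun _ q => v q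
  have h := key _ (hc (sg 0 (m + 1) (V.map R.σ)) (sg_mem _ _ _ _ (by omega))
    ((R.cyc_right m V).2 ((hcyc V).2 fun p => hv)))
  convert h using 1
  funext q
  rw [sg_same]
  simp [V, R.φσ]

/-- entrywise projection -/
def P (R : RT G G') (n : ℕ) (z : TT A R.x R.y) : TT A R.x R.y := fun a b => (z a b).map (G.π n)

lemma P_add (n : ℕ) (z w : TT A R.x R.y) : R.P n (z + w) = R.P n z + R.P n w := by
  funext a b; ext p q; simp [P]

lemma P_lin (z : TT A R.x R.y) (hz : ∀ a b p q, z a b p q ∈ G.lin) : R.P 1 z = z := by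
  funext a b; ext p q; exact G.π_one_lin (hz a b p q)

lemma P_sg (n a b : ℕ) (M : Matrix (Fin (R.x a)) (Fin (R.y b)) A) :
    R.P n (sg a b M) = sg a b (M.map (G.π n)) := by
  funext a' b'
  by_cases hh : a' = a ∧ b' = b
  · obtain ⟨rfl, rfl⟩ := hh
    rw [P, sg_same, sg_same]
  · rw [P, sg_ne _ _ _ _ _ (by omega), sg_ne _ _ _ _ _ (by omega)]; ext; simp

lemma P_mem (n m : ℕ) (z : TT A R.x R.y) (hz : z ∈ R.T m) : R.P n z ∈ R.T m := by
  intro a b h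
  rw [P, hz a b h]; ext; simp

lemma P_d (n : ℕ) (z : TT A R.x R.y) : R.P (n + 1) (R.d z) = R.d (R.P n z) := by
  funext a b
  rw [d, dd_apply]
  simp only [P]
  rw [dd_apply, ← G.π_matmul _ (R.X_lin a), ← G.π_matmul' _ (R.S_lin b)]
  rcases neg_one_pow_eq_or A a with h | h <;> rw [h] <;> ext p q <;> simp

lemma linBd (m : ℕ) (hX : ∀ a, a ≤ m → G.Ex R.NX a) (hY : G'.Ex R.NY (m + 1)) (z)
    (hz : z ∈ R.LC m) : ∃ w ∈ R.T (m + 2), R.d w = z := by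
  obtain ⟨h1, h2, h3⟩ := hz
  obtain ⟨U, v, w, hw, hU, hv, he⟩ := R.decomp m hX z h1 h2
  obtain ⟨v', hv'⟩ := R.EY_of m hY _ v hv
  have e2 : (sg 0 (m + 1) (v.map R.σ) : TT A R.x R.y) = R.d (sg 0 (m + 2) (v'.map R.σ)) := by
    rw [d, dd_sg_right, S, ← Matrix.map_mul, hv']
  have e3 := R.P_lin z h3
  rw [he, e2, P_add, P_add, R.P_d 0, R.P_d 0, P_sg, ← e2, ← he] at e3
  have h4 : R.X m * U.map (G.π 1) = 0 := by
    unfold X at hU ⊢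
    rw [← G.π_matmul _ (G.bX_lin _ m), hU]; ext; simp
  obtain ⟨U', hU'⟩ := exists_mat_of_range (R.X (m + 1)) (U.map (G.π 1)) (fun j => by
    unfold X
    rw [G.bX_succ]
    refine Submodule.subset_span ⟨?_, fun i => G.π_one _⟩
    rw [LinearMap.mem_ker]
    funext i
    exact congrFun (congrFun h4 i) j)
  refine ⟨sg (m + 2) 0 U' + R.P 0 (sg 0 (m + 2) (v'.map R.σ)) + R.P 0 w,
    Submodule.add_mem _ (Submodule.add_mem _ (sg_mem _ _ _ _ (by omega))
      (R.P_mem _ _ _ (sg_mem _ _ _ _ (by omega)))) (R.P_mem _ _ _ hw), ?_⟩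
  rw [map_add, map_add, ← e3, ← hU', ← dd_sg_left]

lemma exX_succ (m : ℕ) (hX : ∀ a, a ≤ m → G.Ex R.NX a) (hY : G'.Ex R.NY (m + 1))
    (hc : ∀ z ∈ R.T (m + 1), R.d z = 0 → z ∈ Submodule.span A (R.LC m)) :
    G.Ex R.NX (m + 1) := by
  have hb : Submodule.span A (R.LC m) ≤ (R.T (m + 2)).map R.d := by
    rw [Submodule.span_le]
    exact fun z hz => R.linBd m hX hY z hz
  refine G.nakayama _ ?_
  intro v hv
  rw [LinearMap.mem_ker, Matrix.mulVecLin_apply] at hv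
  let M : Matrix (Fin (R.x (m + 1))) (Fin (R.y 0)) A := Matrix.of fun p _ => v p
  have hM : R.X m * M = 0 := by
    ext p q
    exact congrFun hv p
  obtain ⟨W, hW, hWM⟩ := hb (hc (sg (m + 1) 0 M) (sg_mem _ _ _ _ (by omega))
    ((R.cyc_left m M).2 hM))
  obtain ⟨W', w, u, h1, h2, h3, h4, h5⟩ := zigzag R.φ R.σ R.X R.Y R.φσ R.X0 R.XX R.YY (m + 2) 1
    (fun a ha => R.EX_of a (hX a (by omega))) W hW (fun a b hab => by
      have := congrFun (congrFun hWM a) b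
      refine this.trans ?_
      rw [sg_ne _ _ _ _ _ (by omega)])
  have h6 : R.d W' = sg (m + 1) 0 M := by
    have e : R.d W = R.d W' + R.d (sg 0 (m + 2) (u.map R.σ)) + R.d (R.d w) := by
      rw [h5, map_add, map_add]; rfl
    have h4' : R.d (sg 0 (m + 2) (u.map R.σ)) = 0 := h4
    rw [R.d_d, h4', hWM] at e
    simpa using e.symm
  have h7 : R.X m * W' (m + 1) 1 = 0 := by
    have := congrFun (congrFun h6 m) 1
    rw [sg_ne _ _ _ _ _ (by omega), d, dd_apply, h3 m (1 + 1) (by omega)] at this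
    simpa using this
  have h8 := congrFun (congrFun h6 (m + 1)) 0
  rw [sg_same, d, dd_apply] at h8
  have h9 : v = (R.X (m + 1)).mulVec (fun p => W' (m + 1 + 1) 0 p R.j0) +
      (-1 : A) ^ (m + 1) • ∑ q, R.S 0 q R.j0 • (fun p => W' (m + 1) (0 + 1) p q) := by
    funext p
    have h10 := congrFun (congrFun h8 p) R.j0
    refine (h10.symm : v p = _).trans ?_
    simp only [Matrix.add_apply, Matrix.smul_apply, Pi.add_apply, Pi.smul_apply, Finset.sum_apply,
      Matrix.mul_apply, Matrix.mulVec, dotProduct, smul_eq_mul]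
    congr 2
    exact Finset.sum_congr rfl fun _ _ => mul_comm _ _
  rw [h9]
  refine Submodule.add_mem_sup ?_ (Submodule.smul_mem _ _ (Submodule.sum_mem _ fun q _ => 
    Submodule.smul_mem_smul (Ideal.subset_span (R.S_lin _ _ _)) ?_))
  · rw [← G.bX_succ]
    exact ⟨_, rfl⟩
  · rw [LinearMap.mem_ker]
    funext i
    exact congrFun (congrFun h7 i) q

theorem forward (hK : ∀ t, LinSolvable (G.lin : Set A) t (idealToPi (RingHom.ker G.ε))) :
    (∀ a, G.Ex R.NX a) ∧ (∀ a, G'.Ex R.NY a) := by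
  have key : ∀ m, ∀ a, a ≤ m → G.Ex R.NX a ∧ G'.Ex R.NY a := by
    intro m
    induction m with
    | zero =>
      intro a ha
      obtain rfl : a = 0 := by omega
      exact ⟨R.exX0, R.exY0⟩
    | succ m ih =>
      intro a ha
      by_cases h : a ≤ m
      · exact ih a h
      · obtain rfl : a = m + 1 := by omega
        have hX := fun a ha => (ih a ha).1
        have hY := fun a ha => (ih a ha).2
        have hc : ∀ z ∈ R.T (m + 1), R.d z = 0 → z ∈ Submodule.span A (R.LC m) :=
          cyc_span R.X R.S G m 0 (R.ker_solv hK m hX hY 0)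
        have hY' := R.exY_succ m hc
        exact ⟨R.exX_succ m hX hY' hc, hY'⟩
  exact ⟨fun a => (key a a le_rfl).1, fun a => (key a a le_rfl).2⟩

theorem main : (∀ t, LinSolvable (G.lin : Set A) t (idealToPi (RingHom.ker G.ε))) ↔
    ((∀ t, LinSolvable (G'.lin : Set B) t (idealToPi (RingHom.ker G'.ε))) ∧
      ∀ t, LinSolvable (G.lin : Set A) t (idealToPi (RingHom.ker R.φ))) := by
  constructor
  · intro h
    obtain ⟨h1, h2⟩ := R.forward h
    exact ⟨G'.lin_of_ex _ h2, G.lin_of_ex _ h1⟩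
  · rintro ⟨h1, h2⟩
    exact R.backward (G.ex_of_solvable _ h2) (G'.ex_of_solvable _ h1)

end RT

section Quot
variable {n : ℕ} (I : Ideal (MvPolynomial (Fin n) k))

lemma const_mem (hI : I ≠ ⊤) (hIhom : ∀ f ∈ I, ∀ d : ℕ, homogeneousComponent d f ∈ I)
    (f) (hf : f ∈ I) : (MvPolynomial.aeval (fun _ => (0 : k)) : MvPolynomial (Fin n) k →ₐ[k] k) f = 0 := by
  have h := hIhom f hf 0
  rw [homogeneousComponent_zero] at h
  have e : (MvPolynomial.aeval (fun _ => (0 : k)) : MvPolynomial (Fin n) k →ₐ[k] k) f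
      = coeff 0 f := by
    rw [aeval_zero']; rfl
  rw [e]
  by_contra hc
  apply hI
  refine Ideal.eq_top_of_isUnit_mem I h ?_
  exact (IsUnit.mk0 _ hc).map C

def qε (hI : I ≠ ⊤) (hIhom : ∀ f ∈ I, ∀ d : ℕ, homogeneousComponent d f ∈ I) :
    (MvPolynomial (Fin n) k ⧸ I) →ₐ[k] k :=
  Ideal.Quotient.liftₐ I (MvPolynomial.aeval (fun _ => (0 : k))) (const_mem I hI hIhom)

lemma qε_mk (hI : I ≠ ⊤) (hIhom : ∀ f ∈ I, ∀ d : ℕ, homogeneousComponent d f ∈ I) (f) :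
    qε I hI hIhom (Ideal.Quotient.mk I f) = coeff 0 f := by
  have : qε I hI hIhom (Ideal.Quotient.mk I f) =
    (MvPolynomial.aeval (fun _ => (0 : k)) : MvPolynomial (Fin n) k →ₐ[k] k) f := rfl
  rw [this, aeval_zero']; rfl

def qπ (hIhom : ∀ f ∈ I, ∀ d : ℕ, homogeneousComponent d f ∈ I) (d : ℕ) :
    (MvPolynomial (Fin n) k ⧸ I) →+ (MvPolynomial (Fin n) k ⧸ I) :=
  QuotientAddGroup.map I.toAddSubgroup I.toAddSubgroup
    (homogeneousComponent d : MvPolynomial (Fin n) k →ₗ[k] _).toAddMonoidHom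
    (fun f hf => hIhom f hf d)

lemma qπ_mk (hIhom : ∀ f ∈ I, ∀ d : ℕ, homogeneousComponent d f ∈ I) (d : ℕ) (f) :
    qπ I hIhom d (Ideal.Quotient.mk I f) = Ideal.Quotient.mk I (homogeneousComponent d f) := rfl

lemma hc_mul (d : ℕ) (l a : MvPolynomial (Fin n) k) (hl : l.IsHomogeneous 1) :
    homogeneousComponent (d + 1) (l * a) = l * homogeneousComponent d a := by
  classical
  conv_lhs => rw [← sum_homogeneousComponent a, Finset.mul_sum, map_sum]
  have : ∀ i ∈ Finset.range (a.totalDegree + 1),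
      homogeneousComponent (d + 1) (l * homogeneousComponent i a) =
        if i = d then l * homogeneousComponent d a else 0 := by
    intro i _
    have hi : (l * homogeneousComponent i a).IsHomogeneous (1 + i) :=
      hl.mul (homogeneousComponent_isHomogeneous i a)
    rw [homogeneousComponent_of_mem hi]
    by_cases h : i = d
    · subst h; rw [if_pos (by omega), if_pos rfl]
    · rw [if_neg (by omega), if_neg h]
  rw [Finset.sum_congr rfl this, Finset.sum_ite_eq']
  split_ifs with h
  · rfl
  · rw [homogeneousComponent_eq_zero, mul_zero]
    simp only [Finset.mem_range] at h; omega

lemma irr_eq (f : MvPolynomial (Fin n) k) (h : coeff 0 f = 0) :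
    f ∈ Ideal.span (Set.range (X : Fin n → MvPolynomial (Fin n) k)) := by
  rw [← Set.image_univ, mem_ideal_span_X_image]
  intro m hm
  have : m ≠ 0 := by
    rintro rfl
    rw [mem_support_iff] at hm; exact hm h
  obtain ⟨i, hi⟩ := Finsupp.ne_iff.1 this
  exact ⟨i, trivial, hi⟩

lemma X_qdeg (i : Fin n) : Ideal.Quotient.mk I (X i) ∈ qdeg I 1 :=
  ⟨X i, isHomogeneous_X k i, rfl⟩

lemma map_irr_le_span : Ideal.map (Ideal.Quotient.mk I)
      (Ideal.span (Set.range (X : Fin n → MvPolynomial (Fin n) k))) ≤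
      Ideal.span (qdeg I 1 : Set (MvPolynomial (Fin n) k ⧸ I)) := by
  rw [Ideal.map_le_iff_le_comap, Ideal.span_le]
  rintro _ ⟨i, rfl⟩
  exact Ideal.subset_span (X_qdeg I i)

def qSG (hI : I ≠ ⊤) (hIhom : ∀ f ∈ I, ∀ d : ℕ, homogeneousComponent d f ∈ I) :
    SG k (MvPolynomial (Fin n) k ⧸ I) where
  lin := qdeg I 1
  fin := by
    have h1 : (homogeneousSubmodule (Fin n) k 1) ≤
        Submodule.span k (Set.range (X : Fin n → MvPolynomial (Fin n) k)) :=
      homogeneousSubmodule_one_eq_span_X.le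
    have h2 : qdeg I 1 ≤ (Submodule.span k (Set.range (X : Fin n → MvPolynomial (Fin n) k))).map
       (Ideal.Quotient.mkₐ k I).toLinearMap := Submodule.map_mono h1
    have : Module.Finite k (Submodule.span k (Set.range (X : Fin n → MvPolynomial (Fin n) k))) :=
      Module.Finite.span_of_finite k (Set.finite_range _)
    exact Submodule.finiteDimensional_of_le h2
  ε := qε I hI hIhom
  π := qπ I hIhom
  π_zero a := by
    obtain ⟨f, rfl⟩ := Ideal.Quotient.mk_surjective a
    rw [qπ_mk, qε_mk, homogeneousComponent_zero]; rfl
  π_mul d l a hl := by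
    obtain ⟨f, rfl⟩ := Ideal.Quotient.mk_surjective a
    obtain ⟨l, hl, rfl⟩ := hl
    change qπ I hIhom (d + 1) (Ideal.Quotient.mk I l * Ideal.Quotient.mk I f) =
      Ideal.Quotient.mk I l * _
    rw [← map_mul, qπ_mk, qπ_mk, hc_mul d l f hl, map_mul]
  ε_lin l hl := by
    obtain ⟨l, hl, rfl⟩ := hl
    refine (qε_mk I hI hIhom l).trans ?_
    exact IsHomogeneous.coeff_eq_zero hl (by simp)
  π_one a := by
    obtain ⟨f, rfl⟩ := Ideal.Quotient.mk_surjective a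
    rw [qπ_mk]
    exact ⟨_, homogeneousComponent_isHomogeneous 1 f, rfl⟩
  ker_le a ha := by
    obtain ⟨f, rfl⟩ := Ideal.Quotient.mk_surjective a
    rw [qε_mk] at ha
    exact map_irr_le_span I (Ideal.mem_map_of_mem _ (irr_eq f ha))
  sum_π a := by
    obtain ⟨f, rfl⟩ := Ideal.Quotient.mk_surjective a
    refine ⟨f.totalDegree + 1, fun m hm => ?_⟩
    simp only [qπ_mk]
    rw [← map_sum]
    congr 1
    conv_lhs => rw [← sum_homogeneousComponent f]
    refine Finset.sum_subset (by simpa using hm) ?_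
    intro i _ hi
    rw [homogeneousComponent_eq_zero]
    simp only [Finset.mem_range] at hi; omega

lemma irr_ker (hI : I ≠ ⊤) (hIhom : ∀ f ∈ I, ∀ d : ℕ, homogeneousComponent d f ∈ I) :
    Ideal.map (Ideal.Quotient.mk I)
      (Ideal.span (Set.range (X : Fin n → MvPolynomial (Fin n) k))) =
      RingHom.ker (qSG I hI hIhom).ε := by
  apply le_antisymm
  · intro a ha
    exact (qSG I hI hIhom).ε_span (map_irr_le_span I ha)
  · intro a ha
    obtain ⟨f, rfl⟩ := Ideal.Quotient.mk_surjective a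
    have ha : qε I hI hIhom (Ideal.Quotient.mk I f) = 0 := ha
    rw [qε_mk] at ha
    exact Ideal.mem_map_of_mem _ (irr_eq f ha)

end Quot

/-- If `φ : R → R'` is a surjective algebra retract of standard graded `k`-algebras, with
graded section `σ`, then `R` is Koszul iff `R'` is Koszul and `R'` has a linear free
resolution as an `R`-module (equivalently, `ker φ` admits linear resolutions of every finite
length over `R`). -/
theorem koszul_iff_of_algebra_retract {n n' : ℕ}
    (I : Ideal (MvPolynomial (Fin n) k)) (I' : Ideal (MvPolynomial (Fin n') k))
    (hI : I ≠ ⊤) (hI' : I' ≠ ⊤)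
    (hIhom : ∀ f ∈ I, ∀ d : ℕ, homogeneousComponent d f ∈ I)
    (hI'hom : ∀ f ∈ I', ∀ d : ℕ, homogeneousComponent d f ∈ I')
    (φ : (MvPolynomial (Fin n) k ⧸ I) →+* (MvPolynomial (Fin n') k ⧸ I'))
    (σ : (MvPolynomial (Fin n') k ⧸ I') →+* (MvPolynomial (Fin n) k ⧸ I))
    (hretract : φ.comp σ = RingHom.id _)
    (hφsurj : Function.Surjective φ)
    (hφgr : ∀ d : ℕ, ∀ a ∈ qdeg I d, φ a ∈ qdeg I' d)
    (hσgr : ∀ d : ℕ, ∀ a ∈ qdeg I' d, σ a ∈ qdeg I d)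
    (hφk : ∀ c : k, φ (algebraMap k _ c) = algebraMap k _ c)
    (hσk : ∀ c : k, σ (algebraMap k _ c) = algebraMap k _ c) :
    IsKoszul I ↔
      (IsKoszul I' ∧ ∀ t : ℕ, LinSolvable (↑(qdeg I 1)) t (idealToPi (RingHom.ker φ))) := by
  let R : RT (qSG I hI hIhom) (qSG I' hI' hI'hom) :=
    { φ := φ
      σ := σ
      φσ := fun b => RingHom.congr_fun hretract b
      φl := hφgr 1
      σl := hσgr 1 }
  have h := R.main
  unfold IsKoszul
  rw [irr_ker I hI hIhom, irr_ker I' hI' hI'hom]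
  exact h

end
end

section
/- Let S be a standard graded polynomial ring over a field, I ⊆ S a graded ideal with ht I = c, and set 𝔞_i = Ann_S Ext^i_S(S/I, S). Then ht 𝔞_i ≥ i for all i, and 𝔞_c equals the unmixed part I^{unm} of I (the intersection of the height-c primary components of I). -/
open CategoryTheory MvPolynomial

/-- The height of an ideal: the infimum of the heights of the primes containing it. -/
noncomputable def idealHeight {S : Type} [CommRing S] (I : Ideal S) : ℕ∞ :=
  ⨅ p ∈ {p : PrimeSpectrum S | I ≤ p.asIdeal}, Order.height p

theorem aux_devissage {S : Type} [CommRing S] [IsNoetherianRing S]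
    (P : (N : Type) → [AddCommGroup N] → [Module S N] → Prop)
    (hzero : ∀ (N : Type) [AddCommGroup N] [Module S N] [Module.Finite S N] [Subsingleton N], P N)
    (hext : ∀ (N₁ N₂ N₃ : Type) [AddCommGroup N₁] [Module S N₁] [Module.Finite S N₁]
      [AddCommGroup N₂] [Module S N₂] [Module.Finite S N₂]
      [AddCommGroup N₃] [Module S N₃] [Module.Finite S N₃]
      (f : N₁ →ₗ[S] N₂) (g : N₂ →ₗ[S] N₃), Function.Injective f → Function.Surjective g →
      Function.Exact f g → P N₁ → P N₃ → P N₂)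
    (hprime : ∀ (q : Ideal S) [q.IsPrime],
      (∀ (N : Type) [AddCommGroup N] [Module S N] [Module.Finite S N],
        q < Module.annihilator S N → P N) → P (S ⧸ q))
    (N : Type) [AddCommGroup N] [Module S N] [Module.Finite S N] : P N := by
  have hiso : ∀ (N₁ N₂ : Type) [AddCommGroup N₁] [Module S N₁] [Module.Finite S N₁]
      [AddCommGroup N₂] [Module S N₂] [Module.Finite S N₂] (_ : N₁ ≃ₗ[S] N₂), P N₁ → P N₂ := by
    intro N₁ N₂ _ _ _ _ _ _ e h
    refine hext N₁ N₂ PUnit e.toLinearMap 0 e.injective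
      (fun x => ⟨0, Subsingleton.elim _ _⟩) ?_ h (hzero PUnit)
    intro y
    simp only [LinearMap.zero_apply, true_iff]
    exact e.surjective y
  have key : ∀ q : Ideal S, q.IsPrime → P (S ⧸ q) := by
    intro q
    induction q using WellFoundedGT.induction with
    | ind q ih =>
      intro hq
      apply hprime q
      intro N _ _ _
      induction ‹Module.Finite S N› using
        IsNoetherianRing.induction_on_isQuotientEquivQuotientPrime S with
      | subsingleton N => intro _; exact hzero N
      | quotient N p e =>
        intro h
        rw [e.annihilator_eq, Ideal.annihilator_quotient] at h
        exact hiso _ _ e.symm (ih _ h p.2)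
      | exact N₁ N₂ N₃ f g hf hg hfg h₁ h₃ =>
        intro h
        exact hext N₁ N₂ N₃ f g hf hg hfg
          (h₁ (h.trans_le (f.annihilator_le_of_injective hf)))
          (h₃ (h.trans_le (g.annihilator_le_of_surjective hg)))
  induction ‹Module.Finite S N› using
    IsNoetherianRing.induction_on_isQuotientEquivQuotientPrime S with
  | subsingleton N => exact hzero N
  | quotient N p e => exact hiso _ _ e.symm (key _ p.2)
  | exact N₁ N₂ N₃ f g hf hg hfg h₁ h₃ => exact hext N₁ N₂ N₃ f g hf hg hfg h₁ h₃

/-- The localization at `p` vanishes. -/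
def AuxLocZero {S : Type} [CommRing S] (p : Ideal S) (E : Type) [AddCommGroup E] [Module S E] :
    Prop := ∀ e : E, ∃ s ∉ p, s • e = 0

/-- Ext of modules -/
abbrev AExt (S : Type) [CommRing S] (M N : Type) [AddCommGroup M] [Module S M]
    [AddCommGroup N] [Module S N] (i : ℕ) : Type :=
  Abelian.Ext (ModuleCat.of S M) (ModuleCat.of S N) i

theorem aux_shortExact {S : Type} [CommRing S] {N₁ N₂ N₃ : Type} [AddCommGroup N₁] [Module S N₁]
    [AddCommGroup N₂] [Module S N₂] [AddCommGroup N₃] [Module S N₃]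
    (f : N₁ →ₗ[S] N₂) (g : N₂ →ₗ[S] N₃) (hf : Function.Injective f) (hg : Function.Surjective g)
    (hfg : Function.Exact f g) :
    (ModuleCat.shortComplexOfCompEqZero f g hfg.linearMap_comp_eq_zero).ShortExact :=
  ModuleCat.shortComplex_shortExact _ hfg hf hg

theorem aux_locZero_mid {S : Type} [CommRing S] {p : Ideal S} [hp : p.IsPrime]
    {T : ShortComplex (ModuleCat.{0} S)} (hT : T.ShortExact) (Y : ModuleCat.{0} S) (i : ℕ)
    (h1 : AuxLocZero p (Abelian.Ext T.X₁ Y i)) (h3 : AuxLocZero p (Abelian.Ext T.X₃ Y i)) :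
    AuxLocZero p (Abelian.Ext T.X₂ Y i) := by
  intro e
  obtain ⟨s, hs, hse⟩ := h1 ((Abelian.Ext.mk₀ T.f).comp e (zero_add i))
  rw [← Abelian.Ext.comp_smul] at hse
  obtain ⟨e', he'⟩ := Abelian.Ext.contravariant_sequence_exact₂ hT Y _ hse
  obtain ⟨t, ht, hte⟩ := h3 e'
  refine ⟨t * s, fun h => (hp.mem_or_mem h).elim ht hs, ?_⟩
  rw [mul_smul, ← he', ← Abelian.Ext.comp_smul, hte, Abelian.Ext.comp_zero]

theorem aux_locZero_conn {S : Type} [CommRing S] {p : Ideal S}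
    {T : ShortComplex (ModuleCat.{0} S)} (hT : T.ShortExact) (Y : ModuleCat.{0} S) (i : ℕ)
    (h3 : AuxLocZero p (Abelian.Ext T.X₃ Y (i + 1))) (e : Abelian.Ext T.X₁ Y i) :
    ∃ s ∉ p, ∃ e' : Abelian.Ext T.X₂ Y i, (Abelian.Ext.mk₀ T.f).comp e' (zero_add i) = s • e := by
  obtain ⟨s, hs, hse⟩ := h3 (hT.extClass.comp e (add_comm 1 i))
  rw [← Abelian.Ext.comp_smul] at hse
  exact ⟨s, hs, Abelian.Ext.contravariant_sequence_exact₁ hT _ _ _ hse⟩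

theorem aux_locZero_ann {S : Type} [CommRing S] {p : Ideal S} {E : Type} [AddCommGroup E]
    [Module S E] {s : S} (hs : s ∉ p) (h : ∀ e : E, s • e = 0) : AuxLocZero p E :=
  fun e => ⟨s, hs, h e⟩

theorem aux_ext_smul_eq_zero {S : Type} [CommRing S] {X Y : ModuleCat.{0} S} {s : S}
    (h : s ∈ Module.annihilator S X) {i : ℕ} (e : Abelian.Ext X Y i) : s • e = 0 := by
  have : s • 𝟙 X = 0 := by
    refine ModuleCat.hom_ext (LinearMap.ext fun x => ?_)
    exact Module.mem_annihilator.mp h x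
  have h2 : s • e = (Abelian.Ext.mk₀ (s • 𝟙 X)).comp e (zero_add i) := by
    simp [Abelian.Ext.mk₀_smul]
  rw [h2, this]; simp

theorem aux_smul_f {S : Type} [CommRing S] {X Y : ModuleCat.{0} S} (x : S) {i : ℕ}
    (e : Abelian.Ext X Y i) :
    (Abelian.Ext.mk₀ (X.smulShortComplex x).f).comp e (zero_add i) = x • e := by
  rw [ModuleCat.smulShortComplex_f_eq_smul_id]
  have h2 : (Abelian.Ext.mk₀ (x • 𝟙 X)).comp e (zero_add i) = x • e := by
    simp [Abelian.Ext.mk₀_smul]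
  exact h2

/-- The multiplication sequence. -/
theorem aux_quot_shortExact {S : Type} [CommRing S] (q : Ideal S) [hq : q.IsPrime] {x : S}
    (hx : x ∉ q) : ((ModuleCat.of S (S ⧸ q)).smulShortComplex x).ShortExact := by
  apply IsSMulRegular.smulShortComplex_shortExact
  intro a b hab
  obtain ⟨a, rfl⟩ := Ideal.Quotient.mk_surjective a
  obtain ⟨b, rfl⟩ := Ideal.Quotient.mk_surjective b
  have h : Ideal.Quotient.mk q (x * a) = Ideal.Quotient.mk q (x * b) := hab
  rw [Ideal.Quotient.eq, ← mul_sub] at h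
  exact Ideal.Quotient.eq.mpr ((hq.mem_or_mem h).resolve_left hx)

theorem aux_quot_ann {S : Type} [CommRing S] (q : Ideal S) {x : S}
    (hx : x ∉ q) : q < Module.annihilator S (QuotSMulTop x (S ⧸ q)) := by
  have h1 : x ∈ Module.annihilator S (QuotSMulTop x (S ⧸ q)) := QuotSMulTop.mem_annihilator _ x
  have h2 : q ≤ Module.annihilator S (QuotSMulTop x (S ⧸ q)) := by
    have := LinearMap.annihilator_le_of_surjective
      (f := (Submodule.mkQ _ : (S ⧸ q) →ₗ[S] QuotSMulTop x (S ⧸ q))) (Submodule.mkQ_surjective _)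
    rwa [Ideal.annihilator_quotient] at this
  exact lt_of_le_of_ne h2 (fun h => hx (h ▸ h1))

theorem aux_locZero_iff {S : Type} [CommRing S] {p : Ideal S} [hp : p.IsPrime]
    {E : Type} [AddCommGroup E] [Module S E] :
    AuxLocZero p E ↔ (⟨p, hp⟩ : PrimeSpectrum S) ∉ Module.support S E :=
  (Module.notMem_support_iff' (p := (⟨p, hp⟩ : PrimeSpectrum S))).symm

theorem aux_bass {S : Type} [CommRing S] [IsNoetherianRing S] (p : Ideal S) [hp : p.IsPrime]
    (Y : Type) [AddCommGroup Y] [Module S Y] [Module.Finite S Y] (i₀ : ℕ)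
    (h : ∀ i, i₀ ≤ i → AuxLocZero p (AExt S (S ⧸ p) Y i))
    (M : Type) [AddCommGroup M] [Module S M] [Module.Finite S M] :
    ∀ i, i₀ ≤ i → AuxLocZero p (AExt S M Y i) := by
  apply aux_devissage (S := S) (fun M _ _ => ∀ i, i₀ ≤ i → AuxLocZero p (AExt S M Y i))
  · intro N _ _ _ _ i _
    apply aux_locZero_ann (s := 1) (fun h => hp.ne_top ((Ideal.eq_top_iff_one _).mpr h))
    intro e
    apply aux_ext_smul_eq_zero
    rw [Module.mem_annihilator]
    intro n
    exact Subsingleton.elim (α := N) _ _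
  · intro N₁ N₂ N₃ _ _ _ _ _ _ _ _ _ f g hf hg hfg h₁ h₃ i hi
    exact aux_locZero_mid (aux_shortExact f g hf hg hfg) (ModuleCat.of S Y) i (h₁ i hi) (h₃ i hi)
  · intro q hq ih i hi
    by_cases hqp : q ≤ p
    · rcases hqp.eq_or_lt with rfl | hlt
      · exact h i hi
      · obtain ⟨x, hxp, hxq⟩ := SetLike.exists_of_lt hlt
        have hT := aux_quot_shortExact q hxq
        have h3 : AuxLocZero p (AExt S (QuotSMulTop x (S ⧸ q)) Y (i + 1)) :=
          ih _ (aux_quot_ann q hxq) (i + 1) (by omega)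
        rw [aux_locZero_iff]
        intro hmem
        have hfin : Module.Finite S (AExt S (S ⧸ q) Y i) :=
          ModuleCat.finite_ext S _ _ i
        have hmem2 : (⟨p, hp⟩ : PrimeSpectrum S) ∈
            Module.support S (QuotSMulTop x (AExt S (S ⧸ q) Y i)) := by
          rw [Module.support_quotSMulTop]
          exact ⟨hmem, by simpa using hxp⟩
        refine aux_locZero_iff.mp ?_ hmem2
        intro e
        obtain ⟨e, rfl⟩ := Submodule.mkQ_surjective _ e
        obtain ⟨s, hs, e', he'⟩ := aux_locZero_conn hT (ModuleCat.of S Y) i h3 e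
        refine ⟨s, hs, ?_⟩
        rw [← map_smul, Submodule.mkQ_apply, Submodule.Quotient.mk_eq_zero]
        exact (Submodule.mem_smul_pointwise_iff_exists _ _ _).mpr
          ⟨e', trivial, (aux_smul_f x e').symm.trans he'⟩
    · obtain ⟨s, hsq, hsp⟩ := SetLike.not_le_iff_exists.mp hqp
      apply aux_locZero_ann hsp
      intro e
      apply aux_ext_smul_eq_zero
      change s ∈ Module.annihilator S (S ⧸ q)
      rwa [Ideal.annihilator_quotient]

/-- Vanishing below the height. -/
theorem aux_grade {S : Type} [CommRing S] [IsNoetherianRing S]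
    (h : ∀ (q : Ideal S) [q.IsPrime] (i : ℕ), (i : ℕ∞) < q.height →
      AuxLocZero q (AExt S (S ⧸ q) S i))
    (M : Type) [AddCommGroup M] [Module S M] [Module.Finite S M] :
    ∀ i : ℕ, (i : ℕ∞) < (Module.annihilator S M).height → Subsingleton (AExt S M S i) := by
  apply aux_devissage (S := S) (fun M _ _ => ∀ i : ℕ, (i : ℕ∞) < (Module.annihilator S M).height → 
    Subsingleton (AExt S M S i))
  · intro N _ _ _ _ i _
    refine subsingleton_of_forall_eq 0 (fun e => ?_)
    rw [← one_smul S e]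
    apply aux_ext_smul_eq_zero
    rw [Module.mem_annihilator]
    intro n
    exact Subsingleton.elim (α := N) _ _
  · intro N₁ N₂ N₃ _ _ _ _ _ _ _ _ _ f g hf hg hfg h₁ h₃ i hi
    have h1 := h₁ i (hi.trans_le (Ideal.height_mono (f.annihilator_le_of_injective hf)))
    have h3 := h₃ i (hi.trans_le (Ideal.height_mono (g.annihilator_le_of_surjective hg)))
    refine subsingleton_of_forall_eq 0 (fun e => ?_)
    obtain ⟨e', he'⟩ := Abelian.Ext.contravariant_sequence_exact₂ (aux_shortExact f g hf hg hfg)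
      (ModuleCat.of S S) e (h1.elim _ _)
    rw [← he', h3.elim e' 0]
    exact Abelian.Ext.comp_zero _ _ _ _ _
  · intro q hq ih i hi
    rw [Ideal.annihilator_quotient] at hi
    refine subsingleton_of_forall_eq 0 (fun e => ?_)
    obtain ⟨x, hxq, hxe⟩ := h q i hi e
    have hT := aux_quot_shortExact q hxq
    have h3 : Subsingleton (AExt S (QuotSMulTop x (S ⧸ q)) S i) := 
      ih _ (aux_quot_ann q hxq) i (hi.trans_le (Ideal.height_mono (aux_quot_ann q hxq).le))
    obtain ⟨e', he'⟩ := Abelian.Ext.contravariant_sequence_exact₂ hT (ModuleCat.of S S) e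
      ((aux_smul_f x e).trans hxe)
    rw [← he', h3.elim e' 0]
    exact Abelian.Ext.comp_zero _ _ _ _ _

theorem aux_loc_hom_zero {S : Type} [CommRing S] [IsNoetherianRing S] (W : Submonoid S)
    {M N : Type} [AddCommGroup M] [Module S M] [Module.Finite S M] [AddCommGroup N] [Module S N]
    (g : M →ₗ[S] N) (h : LocalizedModule.map W g = 0) : ∃ s ∈ W, s • g = 0 := by
  have : Module.FinitePresentation S M := Module.finitePresentation_of_finite S M
  obtain ⟨s, hs⟩ := (IsLocalizedModule.eq_zero_iff W (LocalizedModule.map W (M := M) (N := N))).mp h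
  exact ⟨s, s.2, hs⟩

theorem aux_loc_shortExact {S : Type} [CommRing S] (W : Submonoid S) {N₁ N₂ N₃ : Type}
    [AddCommGroup N₁] [Module S N₁]
    [AddCommGroup N₂] [Module S N₂] [AddCommGroup N₃] [Module S N₃]
    (f : N₁ →ₗ[S] N₂) (g : N₂ →ₗ[S] N₃) (hf : Function.Injective f) (hg : Function.Surjective g)
    (hfg : Function.Exact f g) :
    ∃ h0, (ModuleCat.shortComplexOfCompEqZero (LocalizedModule.map W f) (LocalizedModule.map W g)
      h0).ShortExact := by
  have h1 : Function.Exact (LocalizedModule.map W f) (LocalizedModule.map W g) :=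
    LocalizedModule.map_exact W f g hfg
  exact ⟨h1.linearMap_comp_eq_zero, aux_shortExact _ _ (LocalizedModule.map_injective W f hf)
    (LocalizedModule.map_surjective W g hg) h1⟩

theorem aux_localize {S : Type} [CommRing S] [IsNoetherianRing S] (p : Ideal S) [hp : p.IsPrime]
    (N : Type) [AddCommGroup N] [Module S N] (i : ℕ) :
    ∀ (M : Type) [AddCommGroup M] [Module S M] [Module.Finite S M],
    Subsingleton (AExt (Localization p.primeCompl) (LocalizedModule p.primeCompl M)
      (LocalizedModule p.primeCompl N) i) → AuxLocZero p (AExt S M N i) := by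
  induction i with
  | zero =>
    intro M _ _ _ hsub e
    obtain ⟨g, rfl⟩ := (Abelian.Ext.mk₀_bijective _ _).2 e
    have h0 : LocalizedModule.map p.primeCompl g.hom = 0 := by
      have h1 : ModuleCat.ofHom (LocalizedModule.map p.primeCompl g.hom) = 0 :=
        (Abelian.Ext.mk₀_bijective _ _).1 (hsub.elim _ _)
      exact ModuleCat.hom_ext_iff.mp h1
    obtain ⟨s, hs, hsg⟩ := aux_loc_hom_zero p.primeCompl g.hom h0
    refine ⟨s, hs, ?_⟩
    rw [← Abelian.Ext.mk₀_smul]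
    have : s • g = 0 := ModuleCat.hom_ext hsg
    rw [this, Abelian.Ext.mk₀_zero]
  | succ n ih =>
    intro M _ _ _ hsub e
    obtain ⟨F, _, _, hfree, hfin, f, hf⟩ := Module.exists_finite_presentation.{0} S M
    set K := LinearMap.ker f with hK
    have hex : Function.Exact K.subtype f := LinearMap.exact_subtype_ker_map f
    have hT := aux_shortExact K.subtype f K.injective_subtype hf hex
    obtain ⟨h0, hT'⟩ := aux_loc_shortExact p.primeCompl K.subtype f K.injective_subtype hf hex
    have hprF : Projective (ModuleCat.of S F) := inferInstance
    have hprFp : Module.Projective (Localization p.primeCompl) (LocalizedModule p.primeCompl F) :=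
      Module.projective_of_isLocalizedModule p.primeCompl (LocalizedModule.mkLinearMap p.primeCompl F)
    have hprFp' : Projective (ModuleCat.of (Localization p.primeCompl)
      (LocalizedModule p.primeCompl F)) := inferInstance
    have hprF2 : Projective (ModuleCat.shortComplexOfCompEqZero K.subtype f
      hex.linearMap_comp_eq_zero).X₂ := hprF
    obtain ⟨y, rfl⟩ := precomp_extClass_surjective_of_projective_X₂ (ModuleCat.of S N) hT n e
    cases n with
    | zero =>
      obtain ⟨g, rfl⟩ := (Abelian.Ext.mk₀_bijective _ _).2 y
      obtain ⟨x₂, hx₂⟩ := Abelian.Ext.contravariant_sequence_exact₁ hT'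
        (ModuleCat.of _ (LocalizedModule p.primeCompl N)) (n₀ := 0)
        (Abelian.Ext.mk₀ (ModuleCat.ofHom (LocalizedModule.map p.primeCompl g.hom))) (add_zero 1)
        (hsub.elim _ _)
      obtain ⟨φ, rfl⟩ := (Abelian.Ext.mk₀_bijective _ _).2 x₂
      rw [Abelian.Ext.mk₀_comp_mk₀] at hx₂
      have hφ := ModuleCat.hom_ext_iff.mp ((Abelian.Ext.mk₀_bijective _ _).1 hx₂)
      have hφ' : φ.hom ∘ₗ LocalizedModule.map p.primeCompl K.subtype =
        LocalizedModule.map p.primeCompl g.hom := hφ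
      have : Module.FinitePresentation S F := Module.finitePresentation_of_finite S F
      obtain ⟨⟨ψ, s⟩, hψ⟩ := IsLocalizedModule.surj p.primeCompl
        (LocalizedModule.map p.primeCompl (M := F) (N := N)) φ.hom
      simp only at hψ
      have hz : LocalizedModule.map p.primeCompl (ψ ∘ₗ K.subtype - (s : S) • g.hom) = 0 := by
        have hc : LocalizedModule.map p.primeCompl (ψ ∘ₗ K.subtype) =
            LocalizedModule.map p.primeCompl ψ ∘ₗ LocalizedModule.map p.primeCompl K.subtype := by
          refine LinearMap.ext fun z => ?_
          induction z using LocalizedModule.induction_on with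
          | h a b => simp [LocalizedModule.map_mk]
        rw [map_sub, map_smul, hc, ← hψ, ← hφ', sub_eq_zero]
        refine LinearMap.ext fun z => ?_
        rfl
      obtain ⟨t, ht, hts⟩ := aux_loc_hom_zero p.primeCompl _ hz
      refine ⟨t * s, fun h => (hp.mem_or_mem h).elim ht s.2, ?_⟩
      have hg : (t * (s : S)) • g = (ModuleCat.shortComplexOfCompEqZero K.subtype f
          hex.linearMap_comp_eq_zero).f ≫ (t • ModuleCat.ofHom ψ) := by
        refine ModuleCat.hom_ext ?_
        rw [smul_sub, sub_eq_zero, smul_smul] at hts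
        exact hts.symm
      have := hT.extClass_comp_assoc (Abelian.Ext.mk₀ (t • ModuleCat.ofHom ψ)) (h := rfl)
      rw [Abelian.Ext.mk₀_comp_mk₀, ← hg, Abelian.Ext.mk₀_smul, Abelian.Ext.comp_smul] at this
      exact this
    | succ k =>
      have hs2 : Subsingleton (AExt (Localization p.primeCompl) (LocalizedModule p.primeCompl K)
          (LocalizedModule p.primeCompl N) (k + 1)) := by
        refine subsingleton_of_forall_eq 0 (fun z => ?_)
        obtain ⟨x₂, hx₂⟩ := Abelian.Ext.contravariant_sequence_exact₁ hT'
          (ModuleCat.of _ (LocalizedModule p.primeCompl N)) z (add_comm 1 (k + 1)) (hsub.elim _ _)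
        have hx0 : x₂ = 0 := Abelian.Ext.eq_zero_of_projective (P := ModuleCat.of _ (LocalizedModule p.primeCompl F)) x₂
        rw [← hx₂, hx0]
        exact Abelian.Ext.comp_zero _ _ _ _ _
      obtain ⟨s, hs, hsy⟩ := ih K hs2 y
      refine ⟨s, hs, ?_⟩
      have h4 : hT.extClass.comp (s • y) (add_comm 1 (k + 1)) = 0 := by
        have : s • y = 0 := hsy
        rw [this, Abelian.Ext.comp_zero]
      rw [Abelian.Ext.comp_smul] at h4
      exact h4

open Pointwise in
theorem aux_regular (d : ℕ) : ∀ (R : Type) [CommRing R] [IsLocalRing R] [IsNoetherianRing R]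
    (f : Fin d → R), Ideal.span (Set.range f) = IsLocalRing.maximalIdeal R →
    (d : WithBot ℕ∞) ≤ ringKrullDim R →
    IsDomain R ∧ ∃ rs : List R, rs.length = d ∧ RingTheory.Sequence.IsWeaklyRegular R rs ∧
      Ideal.ofList rs = IsLocalRing.maximalIdeal R := by
  induction d with
  | zero =>
    intro R _ _ _ f hf _
    rw [Set.range_eq_empty, Ideal.span_empty] at hf
    refine ⟨?_, [], rfl, RingTheory.Sequence.IsWeaklyRegular.nil _ _, by simpa using hf⟩
    have : (⊥ : Ideal R).IsPrime := by rw [hf]; infer_instance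
    exact IsDomain.of_bot_isPrime R
  | succ d ih =>
    intro R _ _ _ f hf hd
    set m := IsLocalRing.maximalIdeal R with hm
    have hmin : ∀ q ∈ minimalPrimes R, ¬ m ≤ q := by
      intro q hq hle
      have hqp : q.IsPrime := hq.1.1
      have h1 : q = m := le_antisymm (IsLocalRing.le_maximalIdeal hqp.ne_top) hle
      have h2 : m.height = 0 := by
        rw [h1] at hq
        rw [Ideal.height_eq_zero_iff]
        exact hq
      rw [← IsLocalRing.maximalIdeal_height_eq_ringKrullDim, ← hm, h2] at hd
      have h3 : ((d + 1 : ℕ) : ℕ∞) ≤ 0 := by exact_mod_cast hd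
      simp at h3
    have hsq : ¬ m ≤ m * m := by
      intro hle
      have h0 : m = ⊥ := Submodule.eq_bot_of_le_smul_of_le_jacobson_bot m m (IsNoetherian.noetherian m)
        hle (IsLocalRing.maximalIdeal_le_jacobson _)
      obtain ⟨q, hq, -⟩ := Ideal.exists_minimalPrimes_le (I := (⊥ : Ideal R)) (J := m) bot_le
      exact hmin q hq (h0 ▸ bot_le)
    obtain ⟨x, hxm, hxsq, hxmin⟩ : ∃ x ∈ m, x ∉ m * m ∧ ∀ q ∈ minimalPrimes R, x ∉ q := by
      by_contra hcon
      push Not at hcon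
      have hfin : (minimalPrimes R).Finite := minimalPrimes.finite_of_isNoetherianRing R
      have := (Ideal.subset_union_prime (s := insert (m * m) hfin.toFinset) (f := id) (m * m) (m * m)
        (I := m) (by
          intro i hi hne _
          simp [hne] at hi
          exact hi.1.1)).mp (by
            intro x hx
            by_cases h : x ∈ m * m
            · simp [h]
            · obtain ⟨q, hq, hxq⟩ := hcon x hx h
              simp only [Finset.coe_insert, Set.mem_iUnion]
              exact ⟨q, by simp [hq], hxq⟩)
      obtain ⟨i, hi, hle⟩ := this
      simp at hi
      rcases hi with rfl | hi
      · exact hsq hle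
      · exact hmin i hi hle
    have hxf : x ∈ Ideal.span (Set.range f) := hf ▸ hxm
    obtain ⟨a, ha⟩ := (Ideal.mem_span_range_iff_exists_fun).mp hxf
    obtain ⟨i, hi⟩ : ∃ i, a i ∉ m := by
      by_contra hcon
      push Not at hcon
      apply hxsq
      rw [← ha]
      exact Ideal.sum_mem _ fun i _ => Ideal.mul_mem_mul (hcon i)
        (hf ▸ Ideal.subset_span (Set.mem_range_self i))
    have hu : IsUnit (a i) := by simpa [hm] using hi
    let J : Ideal R := x • (⊤ : Ideal R)
    have hJ : J = Ideal.span {x} := by simp [J, ← Submodule.ideal_span_singleton_smul]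
    have hxJ : x ∈ J := hJ ▸ Ideal.mem_span_singleton_self x
    have hJm : J ≤ m := by rw [hJ, Ideal.span_singleton_le_iff_mem]; exact hxm
    have hJtop : J ≠ ⊤ := fun h => (IsLocalRing.maximalIdeal.isMaximal R).ne_top (top_le_iff.mp (h ▸ hJm))
    have : Nontrivial (R ⧸ J) := Ideal.Quotient.nontrivial_iff.mpr hJtop
    have hloc : IsLocalRing (R ⧸ J) := IsLocalRing.of_surjective' _ Ideal.Quotient.mk_surjective
    have hmapm : m.map (Ideal.Quotient.mk J) = IsLocalRing.maximalIdeal (R ⧸ J) := by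
      have h1 : (m.map (Ideal.Quotient.mk J)).IsMaximal := by
        refine Ideal.IsMaximal.map_of_surjective_of_ker_le Ideal.Quotient.mk_surjective ?_
        rwa [Ideal.mk_ker]
      exact IsLocalRing.eq_maximalIdeal h1
    have hgen : Ideal.span (Set.range fun j => Ideal.Quotient.mk J (f (i.succAbove j))) =
        IsLocalRing.maximalIdeal (R ⧸ J) := by
      rw [← hmapm, ← hf, Ideal.map_span]
      apply le_antisymm
      · apply Ideal.span_mono
        rintro _ ⟨j, rfl⟩
        exact ⟨_, ⟨_, rfl⟩, rfl⟩
      · rw [Ideal.span_le]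
        rintro _ ⟨_, ⟨j, rfl⟩, rfl⟩
        by_cases hji : j = i
        · subst hji
          have h0 : Ideal.Quotient.mk J x = 0 := Ideal.Quotient.eq_zero_iff_mem.mpr hxJ
          rw [← ha, Fin.sum_univ_succAbove _ j, map_add, map_mul, map_sum] at h0
          have h1 := eq_neg_of_add_eq_zero_left h0
          have hu' := hu.map (Ideal.Quotient.mk J)
          rw [SetLike.mem_coe, ← Ideal.unit_mul_mem_iff_mem _ hu', h1]
          apply neg_mem
          apply Ideal.sum_mem
          intro l _
          rw [map_mul]
          exact Ideal.mul_mem_left _ _ (Ideal.subset_span ⟨l, rfl⟩)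
        · obtain ⟨l, rfl⟩ := Fin.exists_succAbove_eq hji
          exact Ideal.subset_span ⟨l, rfl⟩
    have hdim : (d : WithBot ℕ∞) ≤ ringKrullDim (R ⧸ J) := by
      have h1 := hd.trans (ringKrullDim_le_ringKrullDim_quotSMulTop_succ hxm)
      have h2 : (d : WithBot ℕ∞) + 1 ≤ ringKrullDim (R ⧸ J) + 1 := by exact_mod_cast h1
      rw [← IsLocalRing.maximalIdeal_height_eq_ringKrullDim] at h2 ⊢
      have h3 : (d : ℕ∞) + 1 ≤ (IsLocalRing.maximalIdeal (R ⧸ J)).height + 1 := by exact_mod_cast h2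
      have h4 := (ENat.add_le_add_iff_right ENat.one_ne_top).mp h3
      exact_mod_cast h4
    obtain ⟨hdom, rs', hlen, hreg, hofl⟩ := ih (R ⧸ J) _ hgen hdim
    have hJp : J.IsPrime := (Ideal.Quotient.isDomain_iff_prime J).mp hdom
    have hdomR : IsDomain R := by
      obtain ⟨q, hq, hqJ⟩ := Ideal.exists_minimalPrimes_le (I := (⊥ : Ideal R)) (J := J) bot_le
      have hqp : q.IsPrime := hq.1.1
      have h0 : q = ⊥ := by
        apply Submodule.eq_bot_of_le_smul_of_le_jacobson_bot m q (IsNoetherian.noetherian q) ?_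
          (IsLocalRing.maximalIdeal_le_jacobson _)
        intro y hy
        have hy' := hqJ hy
        rw [hJ, Ideal.mem_span_singleton'] at hy'
        obtain ⟨z, rfl⟩ := hy'
        rw [mul_comm]
        exact Ideal.mul_mem_mul hxm ((hqp.mem_or_mem hy).resolve_right (hxmin q hq))
      subst h0
      exact IsDomain.of_bot_isPrime R
    refine ⟨hdomR, ?_⟩
    obtain ⟨rs, rfl⟩ : ∃ rs : List R, rs.map (Ideal.Quotient.mk J) = rs' :=
      List.map_surjective_iff.mpr Ideal.Quotient.mk_surjective rs'
    have hx0 : x ≠ 0 := fun h => hxsq (h ▸ zero_mem _)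
    refine ⟨x :: rs, by simpa using hlen, ?_, ?_⟩
    · refine RingTheory.Sequence.IsWeaklyRegular.cons ?_ ?_
      · intro a b hab
        exact mul_left_cancel₀ hx0 hab
      · exact (RingTheory.Sequence.isWeaklyRegular_map_algebraMap_iff (R ⧸ J) (R ⧸ J) rs).mp hreg
    · rw [Ideal.ofList_cons, ← hJ]
      rw [← Ideal.map_ofList, ← hmapm] at hofl
      have := congrArg (Ideal.comap (Ideal.Quotient.mk J)) hofl
      rw [Ideal.comap_map_of_surjective _ Ideal.Quotient.mk_surjective,
        Ideal.comap_map_of_surjective _ Ideal.Quotient.mk_surjective] at this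
      have hb : Ideal.comap (Ideal.Quotient.mk J) ⊥ = J := by
        rw [← RingHom.ker_eq_comap_bot, Ideal.mk_ker]
      rw [hb, sup_eq_left.mpr hJm] at this
      rw [sup_comm]; exact this

theorem aux_regular_seq (R : Type) [CommRing R] [IsRegularLocalRing R] (h : ℕ)
    (hh : ringKrullDim R = h) :
    ∃ rs : List R, rs.length = h ∧ RingTheory.Sequence.IsRegular R rs ∧
      Ideal.ofList rs = IsLocalRing.maximalIdeal R := by
  have hfg : Submodule.FG (IsLocalRing.maximalIdeal R) := IsNoetherian.noetherian _
  have h1 := IsRegularLocalRing.spanFinrank_maximalIdeal (R := R)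
  rw [hh] at h1
  have h1' : (IsLocalRing.maximalIdeal R).spanFinrank = h := by exact_mod_cast h1
  obtain ⟨s, hs1, hs2⟩ := Submodule.FG.exists_span_finset_card_eq_spanFinrank hfg
  rw [h1'] at hs1
  obtain ⟨-, rs, hlen, hreg, hofl⟩ := aux_regular h R (fun i => ((s.equivFinOfCardEq hs1).symm i : R))
    (by
      rw [← hs2]
      have : (Set.range fun i => ((s.equivFinOfCardEq hs1).symm i : R)) = (s : Set R) := by
        ext x
        constructor
        · rintro ⟨i, rfl⟩; exact ((s.equivFinOfCardEq hs1).symm i).2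
        · intro hx; exact ⟨s.equivFinOfCardEq hs1 ⟨x, hx⟩, by simp⟩
      rw [this]) (by rw [hh])
  refine ⟨rs, hlen, ?_, hofl⟩
  apply RingTheory.Sequence.IsRegular.of_isWeaklyRegular_of_mem_maximalIdeal R ?_ hreg
  intro r hr
  rw [← hofl]
  exact Ideal.subset_span hr

theorem aux_regular_ext_gt (R : Type) [CommRing R] [IsRegularLocalRing R] (h : ℕ)
    (hh : ringKrullDim R = h) (X Y : ModuleCat.{0} R)
    (e : X ≃ₗ[R] (R ⧸ IsLocalRing.maximalIdeal R)) (i : ℕ) (hi : h < i) :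
    Subsingleton (Abelian.Ext X Y i) := by
  obtain ⟨rs, hlen, hreg, hofl⟩ := aux_regular_seq R h hh
  have h1 := ModuleCat.projectiveDimension_quotient_eq_length.{0} rs hreg
  rw [hofl, hlen] at h1
  have e' : X ≃ₗ[R] Shrink.{0} (R ⧸ IsLocalRing.maximalIdeal R) :=
    e.trans (Shrink.linearEquiv R _).symm
  have h2 : projectiveDimension X = h := by
    rw [← h1]
    exact projectiveDimension_eq_of_iso (Y := ModuleCat.of R _) e'.toModuleIso
  have h3 := (projectiveDimension_le_iff X h).mp h2.le
  exact HasProjectiveDimensionLT.subsingleton X (h + 1) i hi Y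

theorem aux_regular_ext_lt (R : Type) [CommRing R] [IsRegularLocalRing R] (h : ℕ)
    (hh : ringKrullDim R = h) (X Y : ModuleCat.{0} R)
    (e : X ≃ₗ[R] (R ⧸ IsLocalRing.maximalIdeal R)) (e' : Y ≃ₗ[R] R) (i : ℕ) (hi : i < h) :
    Subsingleton (Abelian.Ext X Y i) := by
  obtain ⟨rs, hlen, hreg, hofl⟩ := aux_regular_seq R h hh
  have : Module.Finite R X := Module.Finite.equiv e.symm
  have : Module.Finite R Y := Module.Finite.equiv e'.symm
  have : Nontrivial Y := e'.toEquiv.nontrivial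
  refine ModuleCat.subsingleton_ext_of_exists_isRegular (IsLocalRing.maximalIdeal R) X ?_ Y ?_ rs
    ?_ ((e'.isRegular_congr rs).mpr hreg) i (hlen ▸ hi)
  · rw [e.support_eq, Module.support_eq_zeroLocus, Ideal.annihilator_quotient]
  · rw [lt_top_iff_ne_top]
    intro htop
    have := Submodule.eq_bot_of_le_smul_of_le_jacobson_bot (IsLocalRing.maximalIdeal R) 
      (⊤ : Submodule R Y) Module.Finite.fg_top htop.ge (IsLocalRing.maximalIdeal_le_jacobson _)
    exact top_ne_bot this
  · intro r hr
    rw [← hofl]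
    exact Ideal.subset_span hr

theorem aux_quot_equiv {S : Type} [CommRing S] (p : Ideal S) [hp : p.IsPrime] :
    Nonempty (LocalizedModule p.primeCompl (S ⧸ p) ≃ₗ[Localization p.primeCompl]
      (Localization p.primeCompl ⧸ IsLocalRing.maximalIdeal (Localization.AtPrime p))) := by
  let φ : Localization p.primeCompl →ₗ[Localization p.primeCompl]
    LocalizedModule p.primeCompl (S ⧸ p) :=
    LinearMap.toSpanSingleton _ _ (LocalizedModule.mk 1 1)
  have hφ : ∀ a b, φ (Localization.mk a b) = LocalizedModule.mk (Ideal.Quotient.mk p a) b := by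
    intro a b
    simp only [φ, LinearMap.toSpanSingleton_apply, LocalizedModule.mk_smul_mk, mul_one]
    congr 1
    rw [Algebra.smul_def, mul_one]; rfl
  have hsurj : Function.Surjective φ := by
    intro z
    induction z using LocalizedModule.induction_on with
    | h a b =>
      obtain ⟨a, rfl⟩ := Ideal.Quotient.mk_surjective a
      exact ⟨_, hφ a b⟩
  have hker : LinearMap.ker φ = IsLocalRing.maximalIdeal (Localization.AtPrime p) := by
    ext z
    induction z using Localization.induction_on with
    | H y =>
      obtain ⟨a, b⟩ := y
      have h2 : Localization.mk a b ∈ IsLocalRing.maximalIdeal (Localization.AtPrime p) ↔ a ∈ p := by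
        rw [Localization.mk_eq_mk']
        exact IsLocalization.AtPrime.mk'_mem_maximal_iff (Localization.AtPrime p) p a b
      rw [LinearMap.mem_ker, hφ, h2, ← LocalizedModule.zero_mk b, LocalizedModule.mk_eq]
      constructor
      · rintro ⟨u, hu⟩
        have h3 : Ideal.Quotient.mk p ((u : S) * ((b : S) * a)) = 0 := by
          refine Eq.trans hu ?_
          simp
        rw [Ideal.Quotient.eq_zero_iff_mem] at h3
        exact (hp.mem_or_mem ((hp.mem_or_mem h3).resolve_left u.2)).resolve_left b.2
      · intro ha
        exact ⟨1, by rw [Ideal.Quotient.eq_zero_iff_mem.mpr ha]⟩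
  exact ⟨((Submodule.quotEquivOfEq _ _ hker).symm.trans
    (φ.quotKerEquivOfSurjective hsurj)).symm⟩

theorem aux_self_equiv {S : Type} [CommRing S] (p : Ideal S) [hp : p.IsPrime] :
    Nonempty (LocalizedModule p.primeCompl S ≃ₗ[Localization p.primeCompl]
      Localization p.primeCompl) :=
  ⟨(IsLocalizedModule.linearEquiv p.primeCompl (LocalizedModule.mkLinearMap p.primeCompl S)
    (Algebra.linearMap S (Localization p.primeCompl))).extendScalarsOfIsLocalization p.primeCompl _⟩

theorem aux_prime_gt {S : Type} [CommRing S] [IsRegularRing S] (p : Ideal S) [hp : p.IsPrime]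
    (N : Type) [AddCommGroup N] [Module S N] (i : ℕ) (hi : p.height < i) :
    AuxLocZero p (AExt S (S ⧸ p) N i) := by
  obtain ⟨h, hh⟩ := ENat.ne_top_iff_exists.mp (hi.trans_le le_top).ne
  rw [← hh] at hi
  apply aux_localize
  have h1 := IsLocalization.AtPrime.ringKrullDim_eq_height p (Localization.AtPrime p)
  rw [← hh] at h1
  obtain ⟨e⟩ := aux_quot_equiv p
  exact aux_regular_ext_gt (Localization.AtPrime p) h h1 _ _ e i (by exact_mod_cast hi)

theorem aux_prime_lt {S : Type} [CommRing S] [IsRegularRing S] (p : Ideal S) [hp : p.IsPrime]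
    (i : ℕ) (hi : i < p.height) :
    AuxLocZero p (AExt S (S ⧸ p) S i) := by
  obtain ⟨h, hh⟩ := ENat.ne_top_iff_exists.mp (Ideal.height_ne_top_of_isPrime (I := p))
  rw [← hh] at hi
  apply aux_localize
  have h1 := IsLocalization.AtPrime.ringKrullDim_eq_height p (Localization.AtPrime p)
  rw [← hh] at h1
  obtain ⟨e⟩ := aux_quot_equiv p
  obtain ⟨e'⟩ := aux_self_equiv p
  exact aux_regular_ext_lt (Localization.AtPrime p) h h1 _ _ e e' i (by exact_mod_cast hi)

theorem aux_homology_ann {S : Type} [CommRing S] (T : ShortComplex (ModuleCat.{0} S)) (x : S) :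
    x ∈ Module.annihilator S T.homology ↔
      ∀ z : T.X₂, T.g z = 0 → ∃ y : T.X₁, T.f y = x • z := by
  have e : T.homology ≃ₗ[S] (LinearMap.ker T.g.hom ⧸ LinearMap.range T.moduleCatToCycles) :=
    T.moduleCatHomologyIso.toLinearEquiv
  rw [e.annihilator_eq, Module.mem_annihilator]
  constructor
  · intro h z hz
    have := h (Submodule.Quotient.mk ⟨z, hz⟩)
    rw [← Submodule.Quotient.mk_smul] at this
    obtain ⟨y, hy⟩ := (Submodule.Quotient.mk_eq_zero _).mp this
    exact ⟨y, congrArg Subtype.val hy⟩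
  · intro h z
    obtain ⟨⟨z, hz⟩, rfl⟩ := Submodule.Quotient.mk_surjective _ z
    obtain ⟨y, hy⟩ := h z hz
    rw [← Submodule.Quotient.mk_smul]
    exact (Submodule.Quotient.mk_eq_zero _).mpr ⟨y, Subtype.ext hy⟩


theorem aux_root_ann {S : Type} [CommRing S] {X Y : ModuleCat.{0} S} (P : ProjectiveResolution X)
    (n : ℕ) (x : S) :
    x ∈ Module.annihilator S (((Ext S (ModuleCat.{0} S) n).obj (Opposite.op X)).obj Y) ↔
      ∀ f : P.complex.X n ⟶ Y, P.complex.d (n + 1) n ≫ f = 0 →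
        ∃ g : P.complex.X ((ComplexShape.up ℕ).prev n) ⟶ Y,
          P.complex.d n ((ComplexShape.up ℕ).prev n) ≫ g = x • f := by
  rw [(P.isoExt n Y).toLinearEquiv.annihilator_eq]
  have h1 : (ComplexShape.up ℕ).next n = n + 1 := by simp
  have := aux_homology_ann ((P.complex.linearYonedaObj S Y).sc n) x
  refine this.trans ?_
  rw [← h1]
  exact Iff.rfl

theorem aux_abelian_ann {S : Type} [CommRing S] {X Y : ModuleCat.{0} S} (P : ProjectiveResolution X)
    (n : ℕ) (x : S) :
    x ∈ Module.annihilator S (Abelian.Ext X Y n) ↔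
      ∀ f : P.complex.X n ⟶ Y, P.complex.d (n + 1) n ≫ f = 0 →
        ∃ g : P.complex.X ((ComplexShape.up ℕ).prev n) ⟶ Y,
          P.complex.d n ((ComplexShape.up ℕ).prev n) ≫ g = x • f := by
  have key : ∀ (f : P.complex.X n ⟶ Y) (hf : P.complex.d (n + 1) n ≫ f = 0),
      P.extMk f (n + 1) rfl hf = 0 ↔ ∃ g : P.complex.X ((ComplexShape.up ℕ).prev n) ⟶ Y,
          P.complex.d n ((ComplexShape.up ℕ).prev n) ≫ g = f := by
    intro f hf
    cases n with
    | zero =>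
      have h1 : P.complex.d 0 ((ComplexShape.up ℕ).prev 0) = 0 := by
        apply P.complex.shape; simp
      simp only [h1, Limits.zero_comp, exists_const]
      rw [← P.extEquivCohomologyClass.apply_eq_iff_eq,
        ProjectiveResolution.extEquivCohomologyClass_extMk,
        ProjectiveResolution.extEquivCohomologyClass_zero,
        CochainComplex.HomComplex.CohomologyClass.mk_eq_zero_iff,
        CochainComplex.HomComplex.Cocycle.toSingleMk_mem_coboundaries_iff _ _ _ _ _ 1 (by simp)]
      have hz : Limits.IsZero (P.cochainComplex.X 1) :=
        CochainComplex.isZero_of_isStrictlyLE _ 0 1 (by norm_num)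
      constructor
      · rintro ⟨g, hg⟩
        rw [hz.eq_of_src g 0, Limits.comp_zero] at hg
        rw [← cancel_epi (P.cochainComplexXIso _ 0 rfl).hom, ← hg, Limits.comp_zero]
      · rintro rfl
        exact ⟨0, by simp⟩
    | succ k =>
      have h1 : (ComplexShape.up ℕ).prev (k + 1) = k := by simp
      rw [h1]
      exact P.extMk_eq_zero_iff f _ rfl hf k rfl
  have hsm : ∀ (f : P.complex.X n ⟶ Y) (hf : P.complex.d (n + 1) n ≫ f = 0),
      x • P.extMk f (n + 1) rfl hf = P.extMk (x • f) (n + 1) rfl (by simp [hf]) := by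
    intro f hf
    rw [Abelian.Ext.smul_eq_comp_mk₀, P.extMk_comp_mk₀]
    congr 1
  rw [Module.mem_annihilator]
  constructor
  · intro h f hf
    rw [← key _ (by simp [hf]), ← hsm f hf]
    exact h _
  · intro h e
    obtain ⟨f, hf, rfl⟩ := P.extMk_surjective e (n + 1) rfl
    rw [hsm, key]
    exact h f hf

theorem aux_ann_eq {S : Type} [CommRing S] (X Y : ModuleCat.{0} S) (n : ℕ) :
    Module.annihilator S (((Ext S (ModuleCat.{0} S) n).obj (Opposite.op X)).obj Y) =
      Module.annihilator S (Abelian.Ext X Y n) := by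
  ext x
  rw [aux_root_ann (projectiveResolution X), aux_abelian_ann (projectiveResolution X)]

theorem aux_idealHeight {S : Type} [CommRing S] (I : Ideal S) : idealHeight I = I.height := by
  unfold idealHeight
  apply le_antisymm
  · rw [Ideal.height_eq_inf_minimalPrimes]
    refine le_iInf₂ fun J hJ => ?_
    refine (iInf₂_le (⟨J, hJ.1.1⟩ : PrimeSpectrum S) hJ.1.2).trans ?_
    rw [← PrimeSpectrum.height_eq_orderHeight]
  · refine le_iInf₂ fun p hp => ?_
    rw [← PrimeSpectrum.height_eq_orderHeight]
    exact Ideal.height_mono hp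

theorem aux_part1 {S : Type} [CommRing S] [IsRegularRing S] (M N : Type)
    [AddCommGroup M] [Module S M] [Module.Finite S M] [AddCommGroup N] [Module S N]
    [Module.Finite S N] (i : ℕ) :
    (i : ℕ∞) ≤ (Module.annihilator S (AExt S M N i)).height := by
  by_contra hlt
  rw [not_le] at hlt
  obtain ⟨n, hn⟩ := ENat.ne_top_iff_exists.mp (hlt.trans_le le_top).ne
  obtain ⟨p, hp, hle, hpn⟩ := Ideal.exists_isPrime_height_eq hn.symm
  rw [← hn, ← hpn] at hlt
  have h1 := aux_bass p N i (fun j hj => aux_prime_gt p N j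
    (hlt.trans_le (by exact_mod_cast hj))) M i le_rfl
  have hfin : Module.Finite S (AExt S M N i) := ModuleCat.finite_ext S _ _ i
  rw [aux_locZero_iff, Module.mem_support_iff_of_finite] at h1
  exact h1 hle

theorem aux_vanish {S : Type} [CommRing S] [IsRegularRing S] (M : Type)
    [AddCommGroup M] [Module S M] [Module.Finite S M] (i : ℕ)
    (hi : (i : ℕ∞) < (Module.annihilator S M).height) : Subsingleton (AExt S M S i) :=
  aux_grade (fun q _ i hi => aux_prime_lt q i hi) M i hi

theorem aux_epi_inj {S : Type} [CommRing S] [IsRegularRing S] {M N : Type}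
    [AddCommGroup M] [Module S M] [Module.Finite S M] [AddCommGroup N] [Module S N]
    (f : M →ₗ[S] N) (hf : Function.Surjective f) (c : ℕ)
    (hc : (c : ℕ∞) ≤ (Module.annihilator S M).height) (e : AExt S N S c)
    (he : (Abelian.Ext.mk₀ (ModuleCat.ofHom f)).comp e (zero_add c) = 0) : e = 0 := by
  cases c with
  | zero =>
    have : Epi (ModuleCat.ofHom f) := (ModuleCat.epi_iff_surjective _).mpr hf
    refine Abelian.Ext.precomp_mk₀_injective_of_epi (ModuleCat.of S S) (ModuleCat.ofHom f) ?_
    rw [map_zero]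
    exact he
  | succ c =>
    have hT := aux_shortExact (LinearMap.ker f).subtype f (Submodule.injective_subtype _) hf
      (LinearMap.exact_subtype_ker_map f)
    obtain ⟨y, hy⟩ := Abelian.Ext.contravariant_sequence_exact₃ hT (ModuleCat.of S S) e he
      (add_comm 1 c)
    have hs : Subsingleton (AExt S (LinearMap.ker f) S c) := by
      apply aux_vanish
      refine lt_of_lt_of_le ?_ (hc.trans (Ideal.height_mono
        (LinearMap.annihilator_le_of_injective (LinearMap.ker f).subtype
          (Submodule.injective_subtype _))))
      exact_mod_cast Nat.lt_succ_self c
    rw [← hy, hs.elim y 0]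
    exact Abelian.Ext.comp_zero _ _ _ _ _

theorem aux_not_locZero {S : Type} [CommRing S] [IsRegularRing S] (p : Ideal S) [hp : p.IsPrime]
    (c : ℕ) (hc : p.height = c) (h : AuxLocZero p (AExt S (S ⧸ p) S c)) : False := by
  have h1 := aux_bass p S 0 (fun i _ => by
    rcases lt_trichotomy i c with hi | rfl | hi
    · exact aux_prime_lt p i (by rw [hc]; exact_mod_cast hi)
    · exact h
    · exact aux_prime_gt p S i (by rw [hc]; exact_mod_cast hi)) S 0 le_rfl
  obtain ⟨s, hs, hs0⟩ := h1 (Abelian.Ext.mk₀ (𝟙 (ModuleCat.of S S)))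
  rw [← Abelian.Ext.mk₀_smul, Abelian.Ext.mk₀_eq_zero_iff] at hs0
  have h2 := congrArg (fun g : ModuleCat.of S S ⟶ ModuleCat.of S S => g.hom (1 : S)) hs0
  have h3 : s * 1 = 0 := h2
  rw [mul_one] at h3
  exact hs (h3 ▸ zero_mem p)

theorem aux_part2 {S : Type} [CommRing S] [IsRegularRing S] (I : Ideal S) (c : ℕ)
    (hc : I.height = c) (x : S) :
    x ∈ Module.annihilator S (AExt S (S ⧸ I) S c) ↔
      ∀ p ∈ I.minimalPrimes, p.height = c → ∃ s ∉ p, s * x ∈ I := by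
  let φ : S →ₗ[S] (S ⧸ I) := LinearMap.toSpanSingleton S (S ⧸ I) (Ideal.Quotient.mk I x)
  have hφ : ∀ a, φ a = Ideal.Quotient.mk I (a * x) := fun a => rfl
  let J : Ideal S := LinearMap.ker φ
  have hJ : ∀ a, a ∈ J ↔ a * x ∈ I := by
    intro a
    rw [LinearMap.mem_ker, hφ, Ideal.Quotient.eq_zero_iff_mem]
  have hIJ : I ≤ J := fun a ha => (hJ a).mpr (I.mul_mem_right x ha)
  let ι : (S ⧸ J) →ₗ[S] (S ⧸ I) := Submodule.liftQ J φ le_rfl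
  have hι : Function.Injective ι := by
    rw [← LinearMap.ker_eq_bot]
    exact Submodule.ker_liftQ_eq_bot _ _ _ le_rfl
  let π : (S ⧸ I) →ₗ[S] (S ⧸ J) := Submodule.factor hIJ
  have hπ : Function.Surjective π := Submodule.factor_surjective hIJ
  have hcomp : ModuleCat.ofHom π ≫ ModuleCat.ofHom ι = x • 𝟙 (ModuleCat.of S (S ⧸ I)) := by
    refine ModuleCat.hom_ext (LinearMap.ext fun z => ?_)
    obtain ⟨z, rfl⟩ := Ideal.Quotient.mk_surjective (I := I) z
    have h1 : (Ideal.Quotient.mk I (z * x)) = x • (Ideal.Quotient.mk I z) := by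
      rw [mul_comm]; rfl
    exact h1
  have hx : ∀ e : AExt S (S ⧸ I) S c, x • e = (Abelian.Ext.mk₀ (ModuleCat.ofHom π)).comp
      ((Abelian.Ext.mk₀ (ModuleCat.ofHom ι)).comp e (zero_add c)) (zero_add c) := by
    intro e
    rw [Abelian.Ext.mk₀_comp_mk₀_assoc, hcomp, Abelian.Ext.mk₀_smul, Abelian.Ext.smul_comp,
      Abelian.Ext.mk₀_id_comp]
  constructor
  · intro hann p hpI hpc
    have hp : p.IsPrime := hpI.1.1
    by_contra hcon
    push Not at hcon
    have hJp : J ≤ p := by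
      intro a ha
      by_contra hap
      exact hcon a hap ((hJ a).mp ha)
    have hbass := aux_bass p S (c + 1) (fun j hj => aux_prime_gt p S j
      (by rw [hpc]; exact_mod_cast hj)) ((S ⧸ I) ⧸ LinearMap.range ι) (c + 1) le_rfl
    have hT := aux_shortExact ι (LinearMap.range ι).mkQ hι (Submodule.mkQ_surjective _)
      (LinearMap.exact_map_mkQ_range ι)
    have hJ0 : AuxLocZero p (AExt S (S ⧸ J) S c) := by
      intro e
      obtain ⟨s, hs, e', he'⟩ := aux_locZero_conn hT (ModuleCat.of S S) c hbass e
      refine ⟨s, hs, ?_⟩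
      refine aux_epi_inj π hπ c (by rw [Ideal.annihilator_quotient, hc]) _ ?_
      have h4 : (Abelian.Ext.mk₀ (ModuleCat.ofHom ι)).comp e' (zero_add c) = s • e := he'
      rw [← h4, ← hx]
      exact Module.mem_annihilator.mp hann e'
    apply aux_not_locZero p c hpc
    intro e
    obtain ⟨s, hs, hse⟩ := hJ0 ((Abelian.Ext.mk₀ (ModuleCat.ofHom
      (Submodule.factor hJp : (S ⧸ J) →ₗ[S] (S ⧸ p)))).comp e (zero_add c))
    refine ⟨s, hs, ?_⟩
    refine aux_epi_inj (Submodule.factor hJp : (S ⧸ J) →ₗ[S] (S ⧸ p))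
      (Submodule.factor_surjective hJp) c ?_ _ ?_
    · rw [Ideal.annihilator_quotient, ← hc]
      exact Ideal.height_mono hIJ
    · rw [Abelian.Ext.comp_smul]; exact hse
  · intro h
    have hlt : (c : ℕ∞) < J.height := by
      by_contra hcon
      rw [not_lt] at hcon
      obtain ⟨n, hn⟩ := ENat.ne_top_iff_exists.mp (hcon.trans_lt (ENat.natCast_lt_top c)).ne
      obtain ⟨q, hq, hJq, hqn⟩ := Ideal.exists_isPrime_height_eq hn.symm
      have hqc : q.height ≤ c := by rw [hqn, hn]; exact hcon
      have hmin : q ∈ I.minimalPrimes :=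
        Ideal.mem_minimalPrimes_of_height_le (hIJ.trans hJq) (by rw [hc]; exact hqc)
      obtain ⟨s, hs, hsx⟩ := h q hmin
        (le_antisymm hqc (hc ▸ Ideal.height_mono (hIJ.trans hJq)))
      exact hs (hJq ((hJ s).mpr hsx))
    have hsub : Subsingleton (AExt S (S ⧸ J) S c) := by
      apply aux_vanish
      rwa [Ideal.annihilator_quotient]
    rw [Module.mem_annihilator]
    intro e
    rw [hx, hsub.elim ((Abelian.Ext.mk₀ (ModuleCat.ofHom ι)).comp e (zero_add c)) 0,
      Abelian.Ext.comp_zero]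

/-- Let `S` be a polynomial ring over a field, `I` a proper homogeneous ideal of height `c`,
and `𝔞ᵢ = Ann_S Ext^i_S(S/I, S)`.  Then `ht 𝔞ᵢ ≥ i` for all `i`, and `𝔞_c` is the unmixed
part of `I`: an element `x` lies in `𝔞_c` iff for every minimal prime `p` of `I` of height
`c`, `x` lies in the `p`-primary component (saturation) of `I`. -/
theorem ann_ext_height_and_unmixed_part {k : Type} [Field k] {n : ℕ} {c : ℕ}
    (I : Ideal (MvPolynomial (Fin n) k)) (hInetop : I ≠ ⊤)
    (hIhom : ∀ f ∈ I, ∀ j : ℕ, MvPolynomial.homogeneousComponent j f ∈ I)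
    (hc : idealHeight I = (c : ℕ∞))
    (𝔞 : ℕ → Ideal (MvPolynomial (Fin n) k))
    (h𝔞 : ∀ i : ℕ, 𝔞 i = Module.annihilator (MvPolynomial (Fin n) k)
      (((Ext (MvPolynomial (Fin n) k) (ModuleCat.{0} (MvPolynomial (Fin n) k)) i).obj
          (Opposite.op (ModuleCat.of (MvPolynomial (Fin n) k)
            (MvPolynomial (Fin n) k ⧸ I)))).obj
        (ModuleCat.of (MvPolynomial (Fin n) k) (MvPolynomial (Fin n) k)))) :
    (∀ i : ℕ, (i : ℕ∞) ≤ idealHeight (𝔞 i)) ∧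
    (∀ x : MvPolynomial (Fin n) k,
      x ∈ 𝔞 c ↔
        ∀ p ∈ I.minimalPrimes, idealHeight p = (c : ℕ∞) → ∃ s ∉ p, s * x ∈ I) := by
  constructor
  · intro i
    rw [aux_idealHeight, h𝔞, aux_ann_eq]
    exact aux_part1 _ _ i
  · intro x
    rw [aux_idealHeight] at hc
    simp only [aux_idealHeight]
    rw [h𝔞, aux_ann_eq]
    exact aux_part2 I c hc x
end

section
/- Let S be a standard graded polynomial ring over a field, I ⊆ S a graded ideal, and L an ideal generated by c linear forms. If the graded Betti numbers of S/I over S coincide with the graded Betti numbers of S/(I+L) over S/L, then L is generated by a regular sequence modulo I. -/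
open MvPolynomial

noncomputable section

/-- `MinResShape deg sh t N` : the submodule `N` of the graded free module with generator
degrees `t` admits a finite minimal graded free resolution whose shape (ranks and twists,
i.e. graded Betti numbers) is recorded in the list `sh`; all the entries of the matrices
are homogeneous of the appropriate positive degrees (`deg d` is the set of homogeneous
elements of degree `d`). -/
def MinResShape {A : Type} [CommRing A] (deg : ℕ → Set A) :
    List ((r : ℕ) × (Fin r → ℕ)) → ∀ {m : ℕ}, (Fin m → ℕ) → Submodule A (Fin m → A) → Prop
  | [], _, _, N => N = ⊥
  | (⟨r, t'⟩ :: rest), m, t, N =>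
      ∃ C : Matrix (Fin m) (Fin r) A,
        (∀ i j, (t i < t' j ∧ C i j ∈ deg (t' j - t i)) ∨ C i j = 0) ∧
        LinearMap.range C.mulVecLin = N ∧
        MinResShape deg rest t' (LinearMap.ker C.mulVecLin)


section Helpers

open Module

structure GrProj {k A : Type} [Field k] [CommRing A] [Algebra k A]
    (deg : ℕ → Submodule k A) (π : ℕ → A →ₗ[k] A) : Prop where
  mem : ∀ d a, π d a ∈ deg d
  id : ∀ d, ∀ a ∈ deg d, π d a = a
  mul_le : ∀ e d a b, a ∈ deg e → e ≤ d → π d (a * b) = a * π (d - e) b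
  mul_lt : ∀ e d a b, a ∈ deg e → d < e → π d (a * b) = 0
  fin : ∀ d, Module.Finite k (deg d)

/-- twisted graded piece -/
def twD {k A : Type} [Field k] [CommRing A] [Algebra k A]
    (deg : ℕ → Submodule k A) (t d : ℕ) : Submodule k A :=
  if t ≤ d then deg (d - t) else ⊥

/-- graded piece of the free module -/
def frD {k A : Type} [Field k] [CommRing A] [Algebra k A]
    (deg : ℕ → Submodule k A) {m : ℕ} (t : Fin m → ℕ) (d : ℕ) : Submodule k (Fin m → A) :=
  Submodule.pi Set.univ (fun i => twD deg (t i) d)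

def frEquiv {k A : Type} [Field k] [CommRing A] [Algebra k A]
    (deg : ℕ → Submodule k A) {m : ℕ} (t : Fin m → ℕ) (d : ℕ) :
    frD deg t d ≃ₗ[k] (∀ i, twD deg (t i) d) where
  toFun v i := ⟨v.1 i, v.2 i trivial⟩
  invFun w := ⟨fun i => (w i).1, fun i _ => (w i).2⟩
  map_add' _ _ := rfl
  map_smul' _ _ := rfl
  left_inv _ := rfl
  right_inv _ := rfl

/-- Hilbert series -/
def hilb {k A : Type} [Field k] [CommRing A] [Algebra k A]
    (deg : ℕ → Submodule k A) : PowerSeries ℤ := PowerSeries.mk fun d => (finrank k (deg d) : ℤ)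

def kPol : List ((r : ℕ) × (Fin r → ℕ)) → PowerSeries ℤ
  | [] => 0
  | (⟨_, t'⟩ :: rest) => ∑ j, PowerSeries.X ^ (t' j) - kPol rest

section
variable {k A : Type} [Field k] [CommRing A] [Algebra k A]
    {deg : ℕ → Submodule k A} {π : ℕ → A →ₗ[k] A}

theorem twD_fin (h : GrProj deg π) (t d : ℕ) : Module.Finite k (twD deg t d) := by
  by_cases hd : t ≤ d
  · rw [twD, if_pos hd]
    exact h.fin _
  · rw [twD, if_neg hd]
    infer_instance

theorem frD_fin (h : GrProj deg π) {m : ℕ} (t : Fin m → ℕ) (d : ℕ) :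
    Module.Finite k (frD deg t d) := by
  have := twD_fin h
  exact Module.Finite.equiv (frEquiv deg t d).symm

theorem frD_finrank (h : GrProj deg π) {m : ℕ} (t : Fin m → ℕ) (d : ℕ) :
    (finrank k (frD deg t d) : ℤ) = PowerSeries.coeff d ((∑ j, PowerSeries.X ^ (t j)) * hilb deg) := by
  have := twD_fin h
  rw [(frEquiv deg t d).finrank_eq, Module.finrank_pi_fintype, Finset.sum_mul, map_sum]
  push_cast
  refine Finset.sum_congr rfl fun i _ => ?_
  rw [PowerSeries.coeff_X_pow_mul', twD]
  by_cases hd : t i ≤ d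
  · rw [if_pos hd, if_pos hd]
    simp [hilb]
  · rw [if_neg hd, if_neg hd]
    simp

theorem mulmem (h : GrProj deg π) {e d : ℕ} {a b : A} (ha : a ∈ deg e) (hb : b ∈ deg d) :
    a * b ∈ deg (e + d) := by
  have := h.mul_le e (e + d) a b ha (by omega)
  rw [Nat.add_sub_cancel_left, h.id d b hb] at this
  rw [← this]
  exact h.mem _ _

theorem step_mem (h : GrProj deg π) {m r : ℕ} (t : Fin m → ℕ) (t' : Fin r → ℕ)
    (C : Matrix (Fin m) (Fin r) A)
    (hC : ∀ i j, (t i < t' j ∧ C i j ∈ deg (t' j - t i)) ∨ C i j = 0) (d : ℕ)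
    (v : Fin r → A) (hv : v ∈ frD deg t' d) : C.mulVec v ∈ frD deg t d := by
  intro i _
  show ∑ j, C i j * v j ∈ twD deg (t i) d
  refine Submodule.sum_mem (twD deg (t i) d) fun j _ => ?_
  have hj : v j ∈ twD deg (t' j) d := hv j trivial
  rcases hC i j with ⟨h1, h2⟩ | h0
  · unfold twD at hj ⊢
    split_ifs at hj with h3
    · rw [if_pos (by omega)]
      have := mulmem h h2 hj
      rwa [show t' j - t i + (d - t' j) = d - t i by omega] at this
    · rw [(Submodule.mem_bot k).1 hj]
      simp
  · simp [h0]

/-- degree `d` component in the free module -/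
def frP (π : ℕ → A →ₗ[k] A) {m : ℕ} (t : Fin m → ℕ) (d : ℕ) (v : Fin m → A) : Fin m → A :=
  fun i => if t i ≤ d then π (d - t i) (v i) else 0

theorem frP_mem (h : GrProj deg π) {m : ℕ} (t : Fin m → ℕ) (d : ℕ) (v : Fin m → A) :
    frP π t d v ∈ frD deg t d := by
  intro i _
  simp only [frP, twD]
  split_ifs
  · exact h.mem _ _
  · simp

theorem frP_id (h : GrProj deg π) {m : ℕ} (t : Fin m → ℕ) (d : ℕ) (v : Fin m → A)
    (hv : v ∈ frD deg t d) : frP π t d v = v := by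
  funext i
  have hj : v i ∈ twD deg (t i) d := hv i trivial
  simp only [frP, twD] at hj ⊢
  split_ifs at hj ⊢
  · exact h.id _ _ hj
  · exact ((Submodule.mem_bot k).1 hj).symm

theorem frP_mulVec (h : GrProj deg π) {m r : ℕ} (t : Fin m → ℕ) (t' : Fin r → ℕ)
    (C : Matrix (Fin m) (Fin r) A)
    (hC : ∀ i j, (t i < t' j ∧ C i j ∈ deg (t' j - t i)) ∨ C i j = 0) (d : ℕ)
    (v : Fin r → A) : C.mulVec (frP π t' d v) = frP π t d (C.mulVec v) := by
  funext i
  simp only [frP, Matrix.mulVec, dotProduct]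
  split_ifs with h1
  · rw [map_sum]
    refine Finset.sum_congr rfl fun j _ => ?_
    rcases hC i j with ⟨h2, h3⟩ | h0
    · split_ifs with h4
      · rw [h.mul_le _ _ _ _ h3 (by omega)]
        congr 3
        omega
      · rw [h.mul_lt _ _ _ _ h3 (by omega), mul_zero]
    · simp [h0]
  · refine Finset.sum_eq_zero fun j _ => ?_
    rcases hC i j with ⟨h2, h3⟩ | h0
    · rw [if_neg (by omega), mul_zero]
    · simp [h0]

theorem res_hilb (h : GrProj deg π) (sh : List ((r : ℕ) × (Fin r → ℕ))) :
    ∀ {m : ℕ} (t : Fin m → ℕ) (N : Submodule A (Fin m → A)),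
      MinResShape (fun d => (deg d : Set A)) sh t N → ∀ d,
      (finrank k (frD deg t d ⊓ N.restrictScalars k : Submodule k (Fin m → A)) : ℤ) =
        PowerSeries.coeff d (kPol sh * hilb deg) := by
  induction sh with
  | nil =>
    intro m t N hN d
    have hN : N = ⊥ := hN
    subst hN
    have : (frD deg t d ⊓ (⊥ : Submodule A (Fin m → A)).restrictScalars k) = ⊥ := by
      rw [Submodule.restrictScalars_bot, inf_bot_eq]
    rw [this]
    simp [kPol]
  | cons a rest ih =>
    obtain ⟨r, t'⟩ := a
    intro m t N hN d
    obtain ⟨C, hC, hr, hk⟩ := hN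
    have ih := ih t' _ hk d
    have := frD_fin h t' d
    let φ : frD deg t' d →ₗ[k] (Fin m → A) :=
      (C.mulVecLin.restrictScalars k).domRestrict (frD deg t' d)
    have e1 : LinearMap.range φ = frD deg t d ⊓ N.restrictScalars k := by
      ext w
      constructor
      · rintro ⟨⟨v, hv⟩, rfl⟩
        refine ⟨step_mem h t t' C hC d v hv, ?_⟩
        show _ ∈ N
        rw [← hr]
        exact ⟨v, rfl⟩
      · rintro ⟨hw, hw2⟩
        have hw2 : w ∈ N := hw2
        rw [← hr] at hw2
        obtain ⟨v, rfl⟩ := hw2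
        refine ⟨⟨frP π t' d v, frP_mem h t' d v⟩, ?_⟩
        show C.mulVec (frP π t' d v) = C.mulVec v
        rw [frP_mulVec h t t' C hC]
        exact frP_id h t d _ hw
    have e2 : (LinearMap.ker φ).map (frD deg t' d).subtype =
        frD deg t' d ⊓ (LinearMap.ker C.mulVecLin).restrictScalars k := by
      ext w
      constructor
      · rintro ⟨⟨v, hv⟩, hv2, rfl⟩
        exact ⟨hv, hv2⟩
      · rintro ⟨hw, hw2⟩
        exact ⟨⟨w, hw⟩, hw2, rfl⟩
    have e3 := φ.finrank_range_add_finrank_ker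
    rw [← Submodule.finrank_map_subtype_eq, e1, e2] at e3
    have e4 := frD_finrank h t' d
    rw [kPol, sub_mul, map_sub, ← e4, ← ih, ← e3]
    push_cast
    ring

theorem idealToPi_finrank (J : Ideal A) (d : ℕ) :
    finrank k (frD deg (fun _ : Fin 1 => 0) d ⊓ (idealToPi J).restrictScalars k :
      Submodule k (Fin 1 → A)) = finrank k (deg d ⊓ J.restrictScalars k : Submodule k A) := by
  refine LinearEquiv.finrank_eq ?_
  have key : ∀ v : Fin 1 → A, v ∈ (frD deg (fun _ : Fin 1 => 0) d ⊓ (idealToPi J).restrictScalars k :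
      Submodule k (Fin 1 → A)) ↔ v 0 ∈ (deg d ⊓ J.restrictScalars k : Submodule k A) := by
    intro v
    constructor
    · rintro ⟨h1, h2⟩
      refine ⟨by simpa [twD] using h1 0 trivial, ?_⟩
      obtain ⟨a, ha, rfl⟩ := h2
      exact ha
    · rintro ⟨h1, h2⟩
      refine ⟨fun i _ => ?_, ⟨v 0, h2, ?_⟩⟩
      · rw [Subsingleton.elim i 0]
        simpa [twD] using h1
      · funext i
        rw [Subsingleton.elim i 0]
        rfl
  exact
    { toFun := fun v => ⟨v.1 0, (key _).1 v.2⟩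
      invFun := fun a => ⟨fun _ => a.1, (key _).2 a.2⟩
      map_add' := fun _ _ => rfl
      map_smul' := fun _ _ => rfl
      left_inv := fun v => by
        ext i
        rw [Subsingleton.elim i 0]
      right_inv := fun _ => rfl }

end

section
variable {k : Type} [Field k] {n : ℕ}

local notation "SS" => MvPolynomial (Fin n) k

theorem hc_mul_le (e d : ℕ) (a b : SS) (ha : a ∈ homogeneousSubmodule (Fin n) k e) (h : e ≤ d) :
    homogeneousComponent d (a * b) = a * homogeneousComponent (d - e) b := by
  conv_lhs => rw [← sum_homogeneousComponent b, Finset.mul_sum, map_sum]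
  have : ∀ i, homogeneousComponent d (a * homogeneousComponent i b) =
      if i = d - e then a * homogeneousComponent i b else 0 := by
    intro i
    rw [homogeneousComponent_of_mem (n := e + i)]
    · congr 1
      exact propext (by omega)
    · exact IsHomogeneous.mul ha (homogeneousComponent_isHomogeneous i b)
  simp only [this]
  rw [Finset.sum_ite_eq']
  split_ifs with h1
  · rfl
  · rw [homogeneousComponent_eq_zero, mul_zero]
    simp only [Finset.mem_range, not_lt] at h1
    omega

theorem hc_mul_lt (e d : ℕ) (a b : SS) (ha : a ∈ homogeneousSubmodule (Fin n) k e) (h : d < e) :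
    homogeneousComponent d (a * b) = 0 := by
  conv_lhs => rw [← sum_homogeneousComponent b, Finset.mul_sum, map_sum]
  refine Finset.sum_eq_zero fun i _ => ?_
  rw [homogeneousComponent_of_mem (n := e + i)]
  · rw [if_neg (by omega)]
  · exact IsHomogeneous.mul ha (homogeneousComponent_isHomogeneous i b)

theorem hs_fin (d : ℕ) : Module.Finite k (homogeneousSubmodule (Fin n) k d) := by
  exact Module.Finite.iff_fg.2 (homogeneousSubmodule_fg _ _ d)

theorem grS : GrProj (homogeneousSubmodule (Fin n) k) (fun d => homogeneousComponent d) where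
  mem d a := homogeneousComponent_mem d a
  id d a ha := by rw [homogeneousComponent_of_mem ha, if_pos rfl]
  mul_le := hc_mul_le
  mul_lt := hc_mul_lt
  fin := hs_fin

def HomI (J : Ideal SS) : Prop := ∀ f ∈ J, ∀ d : ℕ, homogeneousComponent d f ∈ J

theorem grQ (J : Ideal SS) (hJ : HomI J) : ∃ π, GrProj (A := SS ⧸ J)
    (fun d => (homogeneousSubmodule (Fin n) k d).map (Ideal.Quotient.mkₐ k J).toLinearMap) π := by
  have hsurj : Function.Surjective (Ideal.Quotient.mk J) := Ideal.Quotient.mk_surjective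
  let π : ℕ → (SS ⧸ J) →ₗ[k] (SS ⧸ J) := fun d =>
    Submodule.mapQ (J.restrictScalars k) (J.restrictScalars k) (homogeneousComponent d)
      (fun f hf => hJ f hf d)
  have hπ : ∀ d f, π d (Ideal.Quotient.mk J f) = Ideal.Quotient.mk J (homogeneousComponent d f) :=
    fun d f => rfl
  refine ⟨π, ?_, ?_, ?_, ?_, ?_⟩
  · intro d a
    obtain ⟨f, rfl⟩ := hsurj a
    exact ⟨_, homogeneousComponent_mem d f, rfl⟩
  · rintro d _ ⟨f, hf, rfl⟩
    show π d (Ideal.Quotient.mk J f) = Ideal.Quotient.mk J f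
    rw [hπ, grS.id d f hf]
  · rintro e d _ b ⟨f, hf, rfl⟩ h
    obtain ⟨g, rfl⟩ := hsurj b
    show π d (Ideal.Quotient.mk J f * Ideal.Quotient.mk J g) = Ideal.Quotient.mk J f * _
    rw [← map_mul, hπ, hπ, hc_mul_le e d f g hf h, map_mul]
  · rintro e d _ b ⟨f, hf, rfl⟩ h
    obtain ⟨g, rfl⟩ := hsurj b
    show π d (Ideal.Quotient.mk J f * Ideal.Quotient.mk J g) = 0
    rw [← map_mul, hπ, hc_mul_lt e d f g hf h, map_zero]
  · intro d
    have := hs_fin (k := k) (n := n) d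
    infer_instance

/-- dimension of `J_d` -/
def gd (J : Ideal SS) (d : ℕ) : ℕ :=
  finrank k (homogeneousSubmodule (Fin n) k d ⊓ J.restrictScalars k : Submodule k SS)

/-- Hilbert series of `S/J` -/
def HJ (J : Ideal SS) : PowerSeries ℤ :=
  hilb (homogeneousSubmodule (Fin n) k) - PowerSeries.mk fun d => (gd J d : ℤ)

/-- rank nullity for the quotient map on a graded piece -/
theorem quot_rank (L J : Ideal SS) (hLJ : L ≤ J) (d : ℕ) :
    finrank k ((homogeneousSubmodule (Fin n) k d).map (Ideal.Quotient.mkₐ k L).toLinearMap ⊓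
      (Ideal.map (Ideal.Quotient.mk L) J).restrictScalars k : Submodule k (SS ⧸ L)) + gd L d
      = gd J d := by
  have := hs_fin (k := k) (n := n) d
  let P : Submodule k SS := homogeneousSubmodule (Fin n) k d ⊓ J.restrictScalars k
  have : Module.Finite k P := Submodule.finiteDimensional_of_le (inf_le_left : P ≤ _)
  let φ : P →ₗ[k] (SS ⧸ L) := (Ideal.Quotient.mkₐ k L).toLinearMap.domRestrict P
  have e1 : LinearMap.range φ =
      (homogeneousSubmodule (Fin n) k d).map (Ideal.Quotient.mkₐ k L).toLinearMap ⊓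
      (Ideal.map (Ideal.Quotient.mk L) J).restrictScalars k := by
    ext w
    constructor
    · rintro ⟨⟨v, hv, hv2⟩, rfl⟩
      exact ⟨⟨v, hv, rfl⟩, Ideal.mem_map_of_mem _ hv2⟩
    · rintro ⟨⟨v, hv, rfl⟩, hv2⟩
      have hv2 : Ideal.Quotient.mk L v ∈ Ideal.map (Ideal.Quotient.mk L) J := hv2
      have : v ∈ J := by
        rw [← Ideal.mem_comap, Ideal.comap_map_of_surjective _ Ideal.Quotient.mk_surjective] at hv2
        rw [← RingHom.ker_eq_comap_bot, Ideal.mk_ker, sup_eq_left.2 hLJ] at hv2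
        exact hv2
      exact ⟨⟨v, hv, this⟩, rfl⟩
  have e2 : (LinearMap.ker φ).map P.subtype =
      homogeneousSubmodule (Fin n) k d ⊓ L.restrictScalars k := by
    ext w
    constructor
    · rintro ⟨⟨v, hv⟩, hv2, rfl⟩
      exact ⟨hv.1, Ideal.Quotient.eq_zero_iff_mem.1 hv2⟩
    · rintro ⟨hw, hw2⟩
      exact ⟨⟨w, hw, hLJ hw2⟩, Ideal.Quotient.eq_zero_iff_mem.2 hw2, rfl⟩
  have e3 := φ.finrank_range_add_finrank_ker
  rw [← Submodule.finrank_map_subtype_eq, e1, e2] at e3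
  exact e3

theorem gd_top (d : ℕ) : gd (⊤ : Ideal SS) d = finrank k (homogeneousSubmodule (Fin n) k d) := by
  unfold gd
  have : homogeneousSubmodule (Fin n) k d ⊓ (⊤ : Ideal SS).restrictScalars k =
      homogeneousSubmodule (Fin n) k d := inf_eq_left.2 (fun _ _ => trivial)
  rw [this]

theorem hilb_quot (L : Ideal SS) :
    hilb (fun d => (homogeneousSubmodule (Fin n) k d).map (Ideal.Quotient.mkₐ k L).toLinearMap)
      = HJ L := by
  ext d
  have := quot_rank (k := k) (n := n) L ⊤ le_top d
  rw [Ideal.map_top, gd_top, Submodule.restrictScalars_top, inf_top_eq] at this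
  simp only [HJ, hilb, map_sub, PowerSeries.coeff_mk]
  omega

theorem HJ_I (I : Ideal SS) (sh : List ((r : ℕ) × (Fin r → ℕ)))
    (h : MinResShape (fun d => ((homogeneousSubmodule (Fin n) k d : Submodule k SS) : Set SS)) sh
        (fun _ : Fin 1 => 0) (idealToPi I)) : HJ I = (1 - kPol sh) * HJ (⊥ : Ideal SS) := by
  have h0 : HJ (⊥ : Ideal SS) = hilb (homogeneousSubmodule (Fin n) k) := by
    ext d
    have hb : homogeneousSubmodule (Fin n) k d ⊓ (⊥ : Ideal SS).restrictScalars k = ⊥ := by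
      rw [eq_bot_iff]
      exact fun v hv => hv.2
    simp only [HJ, map_sub, PowerSeries.coeff_mk, gd]
    rw [hb, finrank_bot]
    simp
  rw [h0]
  ext d
  have := res_hilb grS sh _ _ h d
  rw [idealToPi_finrank] at this
  rw [sub_mul, one_mul, HJ, map_sub, map_sub, ← this, PowerSeries.coeff_mk, gd]

theorem HJ_IL (I L : Ideal SS) (hL : HomI L) (sh : List ((r : ℕ) × (Fin r → ℕ)))
    (h : MinResShape
        (fun d => (((homogeneousSubmodule (Fin n) k d).map
          (Ideal.Quotient.mkₐ k L).toLinearMap : Submodule k (SS ⧸ L)) : Set (SS ⧸ L))) sh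
        (fun _ : Fin 1 => 0) (idealToPi (Ideal.map (Ideal.Quotient.mk L) I))) :
    HJ (I ⊔ L) = (1 - kPol sh) * HJ L := by
  obtain ⟨π, hπ⟩ := grQ L hL
  ext d
  have h1 := res_hilb hπ sh _ _ h d
  rw [idealToPi_finrank, hilb_quot] at h1
  have h2 := quot_rank L (I ⊔ L) le_sup_right d
  rw [Ideal.map_sup, Ideal.map_quotient_self, sup_bot_eq] at h2
  rw [sub_mul, one_mul, map_sub, ← h1]
  simp only [HJ, hilb, map_sub, PowerSeries.coeff_mk]
  omega


theorem mem_of_map {L J : Ideal SS} (hLJ : L ≤ J) {v : SS}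
    (hv2 : Ideal.Quotient.mk L v ∈ Ideal.map (Ideal.Quotient.mk L) J) : v ∈ J := by
  rw [← Ideal.mem_comap, Ideal.comap_map_of_surjective _ Ideal.Quotient.mk_surjective] at hv2
  rw [← RingHom.ker_eq_comap_bot, Ideal.mk_ker, sup_eq_left.2 hLJ] at hv2
  exact hv2

theorem mem_sup_sing {J : Ideal SS} {l v : SS} (h : v ∈ J ⊔ Ideal.span {l}) :
    ∃ j ∈ J, ∃ a, v = j + l * a := by
  obtain ⟨j, hj, y, hy, rfl⟩ := Submodule.mem_sup.1 h
  obtain ⟨a, rfl⟩ := Ideal.mem_span_singleton'.1 hy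
  exact ⟨j, hj, a, by ring⟩

theorem lemA (J : Ideal SS) (hJ : HomI J) (l : SS) (hl : l ∈ homogeneousSubmodule (Fin n) k 1)
    (d : ℕ) : finrank k (homogeneousSubmodule (Fin n) k d) + gd J (d + 1) =
      gd (J ⊔ Ideal.span {l}) (d + 1) + gd (Submodule.colon J {l}) d := by
  have := hs_fin (k := k) (n := n) d
  have q := quot_rank J (J ⊔ Ideal.span {l}) le_sup_left (d + 1)
  let φ : homogeneousSubmodule (Fin n) k d →ₗ[k] (SS ⧸ J) :=
    ((Ideal.Quotient.mkₐ k J).toLinearMap ∘ₗ LinearMap.mulLeft k l).domRestrict _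
  have e1 : LinearMap.range φ =
      (homogeneousSubmodule (Fin n) k (d + 1)).map (Ideal.Quotient.mkₐ k J).toLinearMap ⊓
      (Ideal.map (Ideal.Quotient.mk J) (J ⊔ Ideal.span {l})).restrictScalars k := by
    ext w
    constructor
    · rintro ⟨⟨v, hv⟩, rfl⟩
      refine ⟨⟨l * v, ?_, rfl⟩, Ideal.mem_map_of_mem _ ?_⟩
      · have := IsHomogeneous.mul (show IsHomogeneous l 1 from hl) hv
        rwa [add_comm] at this
      · exact Ideal.mem_sup_right (Ideal.mul_mem_right _ _ (Ideal.mem_span_singleton_self l))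
    · rintro ⟨⟨v, hv, rfl⟩, hv2⟩
      obtain ⟨j, hj, a, h1⟩ := mem_sup_sing (mem_of_map le_sup_left hv2)
      have h2 : v = homogeneousComponent (d + 1) j + l * homogeneousComponent d a := by
        have h3 := hc_mul_le 1 (d + 1) l a hl (by omega)
        rw [Nat.add_sub_cancel] at h3
        rw [← h3, ← map_add, ← h1]
        exact (grS.id _ _ hv).symm
      refine ⟨⟨homogeneousComponent d a, homogeneousComponent_mem d a⟩, ?_⟩
      show Ideal.Quotient.mk J (l * homogeneousComponent d a) = Ideal.Quotient.mk J v
      rw [eq_comm, Ideal.Quotient.eq, h2, add_sub_cancel_right]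
      exact hJ j hj _
  have e2 : (LinearMap.ker φ).map (homogeneousSubmodule (Fin n) k d).subtype =
      homogeneousSubmodule (Fin n) k d ⊓
        Submodule.restrictScalars k (Submodule.colon J {l} : Ideal SS) := by
    ext w
    constructor
    · rintro ⟨⟨v, hv⟩, hv2, rfl⟩
      refine ⟨hv, Submodule.mem_colon_singleton.2 ?_⟩
      have : l * v ∈ J := Ideal.Quotient.eq_zero_iff_mem.1 hv2
      simpa [mul_comm] using this
    · rintro ⟨hw, hw2⟩
      refine ⟨⟨w, hw⟩, Ideal.Quotient.eq_zero_iff_mem.2 ?_, rfl⟩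
      have := Submodule.mem_colon_singleton.1 hw2
      simpa [mul_comm] using this
  have e3 := φ.finrank_range_add_finrank_ker
  rw [← Submodule.finrank_map_subtype_eq, e1, e2] at e3
  unfold gd at q ⊢
  omega

theorem lemA0 (J : Ideal SS) (hJ : HomI J) (l : SS) (hl : l ∈ homogeneousSubmodule (Fin n) k 1) :
    gd (J ⊔ Ideal.span {l}) 0 = gd J 0 := by
  have : homogeneousSubmodule (Fin n) k 0 ⊓ (J ⊔ Ideal.span {l}).restrictScalars k =
      homogeneousSubmodule (Fin n) k 0 ⊓ J.restrictScalars k := by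
    apply le_antisymm
    · rintro v ⟨hv, hv2⟩
      refine ⟨hv, ?_⟩
      obtain ⟨j, hj, a, h1⟩ := mem_sup_sing hv2
      have h3 := hc_mul_lt 1 0 l a hl (by omega)
      have h4 : v = homogeneousComponent 0 j := by
        rw [← grS.id _ _ hv, h1, map_add]
        show homogeneousComponent 0 j + homogeneousComponent 0 (l * a) = _
        rw [h3, add_zero]
      rw [h4]
      exact hJ j hj 0
    · exact inf_le_inf_left _ (fun v hv => Ideal.mem_sup_left hv)
  unfold gd
  rw [this]

theorem gd_mono {J J' : Ideal SS} (h : J ≤ J') (d : ℕ) : gd J d ≤ gd J' d := by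
  have := hs_fin (k := k) (n := n) d
  have : Module.Finite k (homogeneousSubmodule (Fin n) k d ⊓ J'.restrictScalars k :
    Submodule k SS) := Submodule.finiteDimensional_of_le
      (inf_le_left : _ ≤ homogeneousSubmodule (Fin n) k d)
  exact Submodule.finrank_mono (inf_le_inf_left _ (fun v hv => h hv))

theorem eq_of_gd {J J' : Ideal SS} (h : J ≤ J') (hJ' : HomI J') (hd : ∀ d, gd J d = gd J' d) :
    J = J' := by
  refine le_antisymm h fun f hf => ?_
  rw [← sum_homogeneousComponent f]
  refine Ideal.sum_mem _ fun d _ => ?_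
  have := hs_fin (k := k) (n := n) d
  have : Module.Finite k (homogeneousSubmodule (Fin n) k d ⊓ J'.restrictScalars k :
    Submodule k SS) := Submodule.finiteDimensional_of_le
      (inf_le_left : _ ≤ homogeneousSubmodule (Fin n) k d)
  have h2 : (homogeneousSubmodule (Fin n) k d ⊓ J.restrictScalars k : Submodule k SS) =
      homogeneousSubmodule (Fin n) k d ⊓ J'.restrictScalars k :=
    Submodule.eq_of_le_of_finrank_eq (inf_le_inf_left _ (fun v hv => h hv)) (hd d)
  have h3 : homogeneousComponent d f ∈
      (homogeneousSubmodule (Fin n) k d ⊓ J'.restrictScalars k : Submodule k SS) :=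
    ⟨homogeneousComponent_mem d f, hJ' f hf d⟩
  rw [← h2] at h3
  exact h3.2

theorem HomI_colon (J : Ideal SS) (hJ : HomI J) (l : SS)
    (hl : l ∈ homogeneousSubmodule (Fin n) k 1) : HomI (Submodule.colon J {l}) := by
  intro f hf d
  have h1 : l * f ∈ J := by simpa [mul_comm] using Submodule.mem_colon_singleton.1 hf
  have h3 := hc_mul_le 1 (d + 1) l f hl (by omega)
  rw [Nat.add_sub_cancel] at h3
  have h4 := hJ _ h1 (d + 1)
  rw [h3] at h4
  exact Submodule.mem_colon_singleton.2 (by simpa [mul_comm] using h4)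

theorem HomI_sup (J : Ideal SS) (hJ : HomI J) (l : SS)
    (hl : l ∈ homogeneousSubmodule (Fin n) k 1) : HomI (J ⊔ Ideal.span {l}) := by
  intro f hf d
  obtain ⟨j, hj, a, rfl⟩ := mem_sup_sing hf
  rw [map_add]
  refine Ideal.add_mem _ (Ideal.mem_sup_left (hJ j hj d)) ?_
  rcases Nat.lt_or_ge d 1 with h | h
  · rw [hc_mul_lt 1 d l a hl h]
    exact Ideal.zero_mem _
  · rw [hc_mul_le 1 d l a hl h]
    exact Ideal.mem_sup_right (Ideal.mul_mem_right _ _ (Ideal.mem_span_singleton_self l))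

theorem le_colon (J : Ideal SS) (l : SS) : J ≤ Submodule.colon J {l} := fun f hf =>
  Submodule.mem_colon_singleton.2 (by
    rw [smul_eq_mul]
    exact Ideal.mul_mem_right _ _ hf)

/-- defect of injectivity of multiplication by `l` -/
def EJ (J : Ideal SS) (l : SS) : PowerSeries ℤ :=
  PowerSeries.mk fun d => (gd (Submodule.colon J {l}) d : ℤ) - gd J d

theorem HJ_step (J : Ideal SS) (hJ : HomI J) (l : SS)
    (hl : l ∈ homogeneousSubmodule (Fin n) k 1) :
    HJ (J ⊔ Ideal.span {l}) = (1 - PowerSeries.X) * HJ J + PowerSeries.X * EJ J l := by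
  rw [sub_mul, one_mul]
  ext d
  rcases d with _ | d
  · have := lemA0 J hJ l hl
    simp [HJ, this]
  · have := lemA J hJ l hl d
    simp only [map_add, map_sub, PowerSeries.coeff_succ_X_mul]
    simp only [HJ, hilb, EJ, map_sub, PowerSeries.coeff_mk]
    omega

def NN (p : PowerSeries ℤ) : Prop := ∀ d, 0 ≤ PowerSeries.coeff d p

theorem NN.mul {p q : PowerSeries ℤ} (hp : NN p) (hq : NN q) : NN (p * q) := fun d => by
  rw [PowerSeries.coeff_mul]
  exact Finset.sum_nonneg fun x _ => mul_nonneg (hp _) (hq _)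

theorem NN.add {p q : PowerSeries ℤ} (hp : NN p) (hq : NN q) : NN (p + q) := fun d => by
  rw [map_add]
  exact add_nonneg (hp d) (hq d)

theorem NN.zero {p q : PowerSeries ℤ} (hp : NN p) (hq : NN q) (h : p + q = 0) : p = 0 ∧ q = 0 := by
  have : ∀ d, PowerSeries.coeff d p + PowerSeries.coeff d q = 0 := fun d => by
    rw [← map_add, h, map_zero]
  constructor <;> ext d <;> have := this d <;> have := hp d <;> have := hq d <;>
    rw [map_zero] <;> omega

theorem NN_G : NN (PowerSeries.mk 1) := fun d => by simp

theorem NN_X : NN PowerSeries.X := fun d => by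
  rw [PowerSeries.coeff_X]
  split_ifs <;> simp

theorem NN_E (J : Ideal SS) (l : SS) : NN (EJ J l) := fun d => by
  have := gd_mono (le_colon J l) d
  simp only [EJ, PowerSeries.coeff_mk]
  omega

theorem colon_of_E {J : Ideal SS} (hJ : HomI J) {l : SS}
    (hl : l ∈ homogeneousSubmodule (Fin n) k 1) (h : EJ J l = 0) :
    J = Submodule.colon J {l} := by
  refine eq_of_gd (le_colon J l) (HomI_colon J hJ l hl) fun d => ?_
  have : PowerSeries.coeff d (EJ J l) = 0 := by rw [h, map_zero]
  simp only [EJ, PowerSeries.coeff_mk] at this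
  omega

theorem smulReg {J : Ideal SS} {l : SS} (h : J = Submodule.colon J {l}) :
    IsSMulRegular (SS ⧸ J) l := by
  intro a b hab
  obtain ⟨a, rfl⟩ := Ideal.Quotient.mk_surjective a
  obtain ⟨b, rfl⟩ := Ideal.Quotient.mk_surjective b
  have h1 : Ideal.Quotient.mk J (l * a) = Ideal.Quotient.mk J (l * b) := hab
  rw [Ideal.Quotient.eq] at h1 ⊢
  rw [h]
  refine Submodule.mem_colon_singleton.2 ?_
  rw [smul_eq_mul]
  convert h1 using 1
  ring

def quotE (J : Ideal SS) (l : SS) : QuotSMulTop l (SS ⧸ J) ≃ₗ[SS] (SS ⧸ (J ⊔ Ideal.span {l})) :=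
  (Submodule.quotEquivOfEq _ _ (by
    ext w
    obtain ⟨w, rfl⟩ := Ideal.Quotient.mk_surjective w
    rw [Submodule.mem_smul_pointwise_iff_exists]
    constructor
    · rintro ⟨b, -, hb⟩
      obtain ⟨b, rfl⟩ := Ideal.Quotient.mk_surjective b
      exact ⟨l * b, Ideal.mul_mem_right _ _ (Ideal.mem_span_singleton_self l), hb⟩
    · rintro ⟨v, hv, hv2⟩
      obtain ⟨a, rfl⟩ := Ideal.mem_span_singleton'.1 hv
      refine ⟨Ideal.Quotient.mk J a, trivial, ?_⟩
      rw [mul_comm] at hv2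
      exact hv2)).trans (Submodule.quotientQuotientEquivQuotientSup J (Ideal.span {l}))

theorem chain (ls : List SS) : ∀ J : Ideal SS, HomI J →
    (∀ l ∈ ls, l ∈ homogeneousSubmodule (Fin n) k 1) →
    NN ((PowerSeries.mk 1) ^ ls.length * HJ (J ⊔ Ideal.ofList ls) - HJ J) ∧
    ((PowerSeries.mk 1) ^ ls.length * HJ (J ⊔ Ideal.ofList ls) = HJ J →
      RingTheory.Sequence.IsWeaklyRegular (SS ⧸ J) ls) := by
  induction ls with
  | nil =>
    intro J hJ _
    simp only [List.length_nil, pow_zero, one_mul, Ideal.ofList_nil, sup_bot_eq, sub_self]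
    refine ⟨fun d => by simp, fun _ => RingTheory.Sequence.IsWeaklyRegular.nil _ _⟩
  | cons l ls ih =>
    intro J hJ hls
    have hl := hls l (by simp)
    obtain ⟨h1, h2⟩ := ih (J ⊔ Ideal.span {l}) (HomI_sup J hJ l hl)
      (fun x hx => hls x (List.mem_cons_of_mem _ hx))
    rw [sup_assoc, ← Ideal.ofList_cons] at h1 h2
    have hst := HJ_step J hJ l hl
    have hG := PowerSeries.mk_one_mul_one_sub_eq_one ℤ
    set T := HJ (J ⊔ Ideal.ofList (l :: ls))
    set G : PowerSeries ℤ := PowerSeries.mk 1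
    have key : G ^ (l :: ls).length * T - HJ J =
        G * (G ^ ls.length * T - HJ (J ⊔ Ideal.span {l})) + G * (PowerSeries.X * EJ J l) := by
      rw [hst, List.length_cons, pow_succ]
      linear_combination (HJ J) * hG
    have n1 : NN (G * (G ^ ls.length * T - HJ (J ⊔ Ideal.span {l}))) := NN_G.mul h1
    have n2 : NN (G * (PowerSeries.X * EJ J l)) := NN_G.mul (NN_X.mul (NN_E J l))
    refine ⟨?_, fun heq => ?_⟩
    · rw [key]
      exact n1.add n2
    · rw [heq, sub_self] at key
      obtain ⟨z1, z2⟩ := n1.zero n2 key.symm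
      have hG0 : G ≠ 0 := left_ne_zero_of_mul_eq_one hG
      have z1 := (mul_eq_zero.1 z1).resolve_left hG0
      have z2 := (mul_eq_zero.1 ((mul_eq_zero.1 z2).resolve_left hG0)).resolve_left
        PowerSeries.X_ne_zero
      rw [RingTheory.Sequence.isWeaklyRegular_cons_iff]
      refine ⟨smulReg (colon_of_E hJ hl z2), ?_⟩
      rw [(quotE J l).isWeaklyRegular_congr]
      exact h2 (sub_eq_zero.1 z1)

theorem linear_eq_sum {w : SS} (hw : w ∈ homogeneousSubmodule (Fin n) k 1) :
    w ∈ Submodule.span k (Set.range (X : Fin n → SS)) := by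
  rwa [homogeneousSubmodule_one_eq_span_X] at hw

theorem prime_span (ls : List SS) (hls : ∀ l ∈ ls, l ∈ homogeneousSubmodule (Fin n) k 1) :
    (Ideal.ofList ls).IsPrime := by
  let W : Submodule k SS := Submodule.span k {l | l ∈ ls}
  obtain ⟨V, hV⟩ := W.exists_isCompl
  let P : SS →ₗ[k] SS := V.projection W hV.symm
  have hPW : ∀ w ∈ W, P w = 0 := fun w hw => by
    simpa [P] using hw
  have hP : ∀ f, P f - f ∈ W := fun f => by
    rw [← neg_sub]
    exact W.neg_mem (Submodule.sub_projection_mem hV.symm f)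
  let φ : SS →ₐ[k] SS := aeval (fun i => P (X i))
  have hφ : ∀ w ∈ homogeneousSubmodule (Fin n) k 1, φ w = P w := by
    intro w hw
    have := linear_eq_sum hw
    clear hw
    induction this using Submodule.span_induction with
    | mem x hx =>
      obtain ⟨i, rfl⟩ := hx
      simp [φ]
    | zero => simp
    | add x y _ _ hx hy => rw [map_add, map_add, hx, hy]
    | smul a x _ hx => rw [map_smul, map_smul, hx]
  have hWL : ∀ w ∈ W, w ∈ Ideal.ofList ls := by
    intro w hw
    exact Submodule.span_le_restrictScalars k SS _ hw
  have e : Ideal.ofList ls = RingHom.ker φ := by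
    apply le_antisymm
    · refine Ideal.span_le.2 fun l hl => ?_
      show φ l = 0
      rw [hφ l (hls l hl)]
      exact hPW l (Submodule.subset_span hl)
    · intro f hf
      have : (Ideal.Quotient.mkₐ k (Ideal.ofList ls)).comp φ =
          Ideal.Quotient.mkₐ k (Ideal.ofList ls) := by
        ext i
        show Ideal.Quotient.mk _ (φ (X i)) = Ideal.Quotient.mk _ (X i)
        rw [Ideal.Quotient.eq]
        simp only [φ, aeval_X]
        exact hWL _ (hP _)
      have h2 := DFunLike.congr_fun this f
      have hf : φ f = 0 := hf
      rw [AlgHom.comp_apply, hf, map_zero] at h2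
      exact Ideal.Quotient.eq_zero_iff_mem.1 h2.symm
  rw [e]
  exact RingHom.ker_isPrime _

theorem HomI_ofList (ls : List SS) (hls : ∀ l ∈ ls, l ∈ homogeneousSubmodule (Fin n) k 1) :
    HomI (Ideal.ofList ls) := by
  induction ls with
  | nil =>
    intro f hf d
    rw [Ideal.ofList_nil] at hf ⊢
    rw [(Submodule.mem_bot _).1 hf]
    simp
  | cons l ls ih =>
    rw [Ideal.ofList_cons, sup_comm]
    exact HomI_sup _ (ih fun x hx => hls x (List.mem_cons_of_mem _ hx)) l (hls l (by simp))

theorem exists_list (xs : List SS) (hxs : ∀ l ∈ xs, l ∈ homogeneousSubmodule (Fin n) k 1) :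
    ∃ ls : List SS, (∀ l ∈ ls, l ∈ homogeneousSubmodule (Fin n) k 1) ∧
      Ideal.ofList ls = Ideal.ofList xs ∧
      HJ (Ideal.ofList ls) = (1 - PowerSeries.X) ^ ls.length * HJ (⊥ : Ideal SS) := by
  induction xs with
  | nil => exact ⟨[], by simp, rfl, by simp⟩
  | cons x xs ih =>
    obtain ⟨ls, h1, h2, h3⟩ := ih fun y hy => hxs y (List.mem_cons_of_mem _ hy)
    have hx := hxs x (by simp)
    by_cases hm : x ∈ Ideal.ofList ls
    · refine ⟨ls, h1, ?_, h3⟩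
      rw [Ideal.ofList_cons, ← h2, eq_comm, sup_eq_right]
      exact (Ideal.span_singleton_le_iff_mem _).2 hm
    · refine ⟨x :: ls, ?_, ?_, ?_⟩
      · intro l hl
        rcases List.mem_cons.1 hl with rfl | hl
        · exact hx
        · exact h1 l hl
      · rw [Ideal.ofList_cons, Ideal.ofList_cons, h2]
      · have hp := prime_span ls h1
        have hc : Submodule.colon (Ideal.ofList ls) {x} = Ideal.ofList ls := by
          refine le_antisymm (fun f hf => ?_) (le_colon _ _)
          have := Submodule.mem_colon_singleton.1 hf
          exact (hp.mem_or_mem this).resolve_right hm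
        have hE : EJ (Ideal.ofList ls) x = 0 := by
          ext d
          simp [EJ, hc]
        rw [Ideal.ofList_cons, sup_comm, HJ_step _ (HomI_ofList ls h1) x hx, hE, h3,
          List.length_cons, pow_succ]
        ring

theorem le_const (I : Ideal SS) (hI : I ≠ ⊤) (hIhom : HomI I) :
    I ≤ RingHom.ker (constantCoeff : SS →+* k) := by
  intro f hf
  by_contra hne
  apply hI
  have h0 := hIhom f hf 0
  rw [homogeneousComponent_zero] at h0
  refine Ideal.eq_top_of_isUnit_mem _ h0 ?_
  have : coeff 0 f ≠ 0 := hne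
  exact (isUnit_iff_ne_zero.2 this).map C

theorem top_ne (I : Ideal SS) (hI : I ≠ ⊤) (hIhom : HomI I) (ls : List SS)
    (hls : ∀ l ∈ ls, l ∈ homogeneousSubmodule (Fin n) k 1) :
    (⊤ : Submodule SS (SS ⧸ I)) ≠ Ideal.ofList ls • ⊤ := by
  intro h
  let m := RingHom.ker (constantCoeff : SS →+* k)
  have hle : Ideal.ofList ls ≤ m := by
    refine Ideal.span_le.2 fun l hl => ?_
    have : IsHomogeneous l 1 := hls l hl
    show coeff 0 l = 0
    exact this.coeff_eq_zero (by simp)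
  have h2 : Ideal.ofList ls • (⊤ : Submodule SS (SS ⧸ I)) ≤ Submodule.map I.mkQ m := by
    refine Submodule.smul_le.2 fun r hr b _ => ?_
    obtain ⟨b, rfl⟩ := Ideal.Quotient.mk_surjective b
    exact ⟨r * b, Ideal.mul_mem_right _ _ (hle hr), rfl⟩
  rw [← h] at h2
  obtain ⟨v, hv, hv2⟩ := h2 (show Ideal.Quotient.mk I 1 ∈ ⊤ from trivial)
  have hv2 : Ideal.Quotient.mk I v = Ideal.Quotient.mk I 1 := hv2
  rw [Ideal.Quotient.eq] at hv2
  have h3 : constantCoeff (v - 1) = 0 := le_const I hI hIhom hv2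
  have h4 : constantCoeff v = 0 := hv
  rw [map_sub, h4, map_one] at h3
  simp at h3

end

end Helpers

/-- Let `S` be a polynomial ring over a field, `I` a proper homogeneous ideal and
`L = (x₁,…,x_c)` an ideal generated by linear forms.  If the graded Betti numbers of `S/I`
over `S` coincide with those of `S/(I+L)` over the polynomial ring `S/L` (i.e. both admit
minimal graded free resolutions of one and the same shape), then `L` is generated by a
regular sequence modulo `I`. -/
theorem regular_sequence_of_equal_betti_numbers {k : Type} [Field k] {n c : ℕ}
    (I : Ideal (MvPolynomial (Fin n) k)) (hInetop : I ≠ ⊤)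
    (hIhom : ∀ f ∈ I, ∀ d : ℕ, homogeneousComponent d f ∈ I)
    (x : Fin c → MvPolynomial (Fin n) k)
    (hx : ∀ i, x i ∈ homogeneousSubmodule (Fin n) k 1)
    (L : Ideal (MvPolynomial (Fin n) k)) (hL : L = Ideal.span (Set.range x))
    (hbetti : ∃ sh : List ((r : ℕ) × (Fin r → ℕ)),
      MinResShape (fun d => ↑(homogeneousSubmodule (Fin n) k d)) sh
        (fun _ : Fin 1 => 0) (idealToPi I) ∧
      MinResShape
        (fun d => ↑((homogeneousSubmodule (Fin n) k d).map
          (Ideal.Quotient.mkₐ k L).toLinearMap)) sh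
        (fun _ : Fin 1 => 0) (idealToPi (Ideal.map (Ideal.Quotient.mk L) I))) :
    ∃ l : List (MvPolynomial (Fin n) k),
      Ideal.span {f | f ∈ l} = L ∧
      RingTheory.Sequence.IsRegular (MvPolynomial (Fin n) k ⧸ I) l := by
  obtain ⟨sh, hb1, hb2⟩ := hbetti
  obtain ⟨ls, h1, h2, h3⟩ := exists_list (List.ofFn x) (by
    intro l hl
    obtain ⟨i, rfl⟩ := (List.mem_ofFn' _ _).1 hl
    exact hx i)
  have hLL : Ideal.ofList ls = L := by
    rw [h2, hL, Ideal.ofList]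
    congr 1
    ext f
    simp [List.mem_ofFn]
  have hLhom : HomI L := hLL ▸ HomI_ofList ls h1
  have e1 := HJ_I I sh hb1
  have e2 := HJ_IL I L hLhom sh hb2
  rw [hLL] at h3
  refine ⟨ls, hLL, ?_, top_ne I hInetop hIhom ls h1⟩
  refine (chain ls I hIhom h1).2 ?_
  have hG := PowerSeries.mk_one_mul_one_sub_eq_one ℤ
  rw [hLL, e2, h3, e1]
  have hGp : (PowerSeries.mk 1 : PowerSeries ℤ) ^ ls.length * (1 - PowerSeries.X) ^ ls.length = 1 := by
    rw [← mul_pow, hG, one_pow]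
  linear_combination ((1 - kPol sh) * HJ (⊥ : Ideal (MvPolynomial (Fin n) k))) * hGp

end
end
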